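/- For every ε ∈ (0,1/10) there exist γ₀ ∈ (0,1), h₀ ∈ (0,1) and a constant C, depending only on ε and the cutoffs, such that for all 0 < h ≤ h₀, all γ with h^{2/3−ε} ≤ γ ≤ γ₀, all a with 0 < a < γ/4, all X ≥ 0, Y ∈ ℝ and all T with 0 < |T| ≤ 1, writing t := √γ T: |W_{0,γ}(T,X,Y)| + |G^♭(T,X,Y)| ≤ C (√γ/h²) min(1, (h/(γ|t|))^{1/2}). -/

import Mathlib

open Real Complex Filter MeasureTheory

/-- `A₊(z) = e^{-iπ/3} Ai(e^{-iπ/3} z)`. -/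
noncomputable def Aplus (Ai : ℂ → ℂ) (z : ℂ) : ℂ :=
  Complex.exp (-(Real.pi / 3 : ℂ) * Complex.I) * Ai (Complex.exp (-(Real.pi / 3 : ℂ) * Complex.I) * z)

/-- `A₋(z) = e^{iπ/3} Ai(e^{iπ/3} z)`. -/
noncomputable def Aminus (Ai : ℂ → ℂ) (z : ℂ) : ℂ :=
  Complex.exp ((Real.pi / 3 : ℂ) * Complex.I) * Ai (Complex.exp ((Real.pi / 3 : ℂ) * Complex.I) * z)

/-- `B(u) = (4/3)u + π/2 − L(u^{2/3})`. -/
noncomputable def Bfun (L : ℝ → ℝ) (u : ℝ) : ℝ :=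
  (4/3) * u + Real.pi / 2 - L (u ^ ((2 : ℝ)/3))

/-- The phase `Ψ_{N,a,γ}(T,X,Y,Υ,S,A,η)` of the transverse reflected waves,
with `λ_γ = γ^{3/2}/h`. -/
noncomputable def PsiTrans (L : ℝ → ℝ) (h γ a : ℝ) (N : ℤ) (T X Y Υ S A η : ℝ) : ℝ :=
  η * (Y + Υ ^ 3 / 3 + Υ * (X - A) + S ^ 3 / 3 + S * (a / γ - A)
      + T * (A - 1) / (Real.sqrt (1 + γ * A) + Real.sqrt (1 + γ))
      - (4/3) * (N : ℝ) * A ^ ((3:ℝ)/2))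
    + ((N : ℝ) / (γ ^ ((3:ℝ)/2) / h)) * Bfun L (η * (γ ^ ((3:ℝ)/2) / h) * A ^ ((3:ℝ)/2))

/-- The `N`-th transverse reflected wave `W_{N,γ}(T,X,Y)`; the integration variables are
`S = v.1`, `Υ = v.2.1`, `A = v.2.2.1`, `η = v.2.2.2`. -/
noncomputable def Wtrans (L : ℝ → ℝ) (ψ χ₂ ψ₂ : ℝ → ℝ)
    (h γ a : ℝ) (N : ℤ) (T X Y : ℝ) : ℂ :=
  ((γ ^ 2 / (2 * Real.pi * h) ^ 3 : ℝ) : ℂ) * ∫ v : ℝ × ℝ × ℝ × ℝ,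
    Complex.exp (Complex.I *
      (((γ ^ ((3:ℝ)/2) / h) * PsiTrans L h γ a N T X Y v.2.1 v.1 v.2.2.1 v.2.2.2 : ℝ) : ℂ)) *
    ((v.2.2.2 ^ 2 * ψ v.2.2.2 * χ₂ v.1 * χ₂ v.2.1 * ψ₂ v.2.2.1 : ℝ) : ℂ)

/-- `G^♭(T,X,Y) = Σ_{|N| ≤ 2γ^{−1/2}} W_{N,γ}(T,X,Y)`. -/
noncomputable def Gflat (L : ℝ → ℝ) (ψ χ₂ ψ₂ : ℝ → ℝ)
    (h γ a : ℝ) (T X Y : ℝ) : ℂ :=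
  ∑' N : ℤ, Set.indicator {N : ℤ | |(N : ℝ)| ≤ 2 / Real.sqrt γ}
    (fun N => Wtrans L ψ χ₂ ψ₂ h γ a N T X Y) N

/-- `cis θ = e^{iθ}`. -/
noncomputable def cis (θ : ℝ) : ℂ := Complex.exp (Complex.I * (θ : ℂ))

lemma norm_cis (θ : ℝ) : ‖cis θ‖ = 1 := by
  rw [cis, mul_comm, Complex.norm_exp_ofReal_mul_I]

lemma cis_add (x y : ℝ) : cis (x + y) = cis x * cis y := by
  simp only [cis, Complex.ofReal_add, mul_add, Complex.exp_add]

lemma continuous_cis : Continuous cis := by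
  unfold cis; fun_prop

lemma hasDerivAt_cis {P : ℝ → ℝ} {p x : ℝ} (h : HasDerivAt P p x) :
    HasDerivAt (fun y => cis (P y)) (Complex.I * p * cis (P x)) x := by
  have := ((h.ofReal_comp).const_mul Complex.I).cexp
  unfold cis
  rw [mul_comm]
  exact this

/-- Mean value inequality with a varying majorant. -/
lemma norm_sub_le_of_norm_deriv_le {f f' : ℝ → ℂ} {B B' : ℝ → ℝ} {a b : ℝ} (hab : a ≤ b)
    (hfc : ContinuousOn f (Set.Icc a b)) (hf : ∀ x ∈ Set.Ioo a b, HasDerivAt f (f' x) x)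
    (hBc : ContinuousOn B (Set.Icc a b)) (hB : ∀ x ∈ Set.Ioo a b, HasDerivAt B (B' x) x)
    (hle : ∀ x ∈ Set.Ioo a b, ‖f' x‖ ≤ B' x) : ‖f b - f a‖ ≤ B b - B a := by
  rcases eq_or_ne (f b - f a) 0 with h0 | h0
  · rw [h0, norm_zero]
    have : MonotoneOn B (Set.Icc a b) := by
      apply monotoneOn_of_hasDerivWithinAt_nonneg (f' := B') (convex_Icc a b) hBc
      · intro x hx; rw [interior_Icc] at hx; exact (hB x hx).hasDerivWithinAt
      · intro x hx; rw [interior_Icc] at hx; exact (norm_nonneg _).trans (hle x hx)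
    linarith [this (Set.left_mem_Icc.2 hab) (Set.right_mem_Icc.2 hab) hab]
  set u : ℂ := (starRingEnd ℂ) (f b - f a) / ‖f b - f a‖ with hu
  have hn : (‖f b - f a‖ : ℂ) ≠ 0 := by simpa using h0
  have hun : ‖u‖ = 1 := by
    rw [hu, norm_div, RCLike.norm_conj]; simp only [Complex.norm_real, norm_norm]
    exact div_self (norm_ne_zero_iff.2 h0)
  have huf : (u * (f b - f a)).re = ‖f b - f a‖ := by
    have : u * (f b - f a) = (‖f b - f a‖ : ℂ) := by
      rw [hu, div_mul_eq_mul_div, mul_comm, Complex.mul_conj, div_eq_iff hn,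
        Complex.normSq_eq_norm_sq]; push_cast; ring
    rw [this]; simp
  have hmono : MonotoneOn (fun x => B x - (u * f x).re) (Set.Icc a b) := by
    apply monotoneOn_of_hasDerivWithinAt_nonneg (f' := fun x => B' x - (u * f' x).re)
      (convex_Icc a b)
    · exact hBc.sub (Complex.continuous_re.comp_continuousOn (continuousOn_const.mul hfc))
    · intro x hx; rw [interior_Icc] at hx
      refine ((hB x hx).sub ?_).hasDerivWithinAt
      exact (Complex.reCLM.hasFDerivAt.comp_hasDerivAt x ((hf x hx).const_mul u))
    · intro x hx; rw [interior_Icc] at hx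
      have h1 : (u * f' x).re ≤ ‖f' x‖ := by
        refine (Complex.re_le_norm _).trans ?_
        rw [norm_mul, hun, one_mul]
      linarith [hle x hx]
  have := hmono (Set.left_mem_Icc.2 hab) (Set.right_mem_Icc.2 hab) hab
  simp only [mul_sub, Complex.sub_re] at huf
  simp only at this
  linarith

/-- To bound an increment of a continuous function it suffices to bound it on interior intervals. -/
lemma norm_sub_le_of_interior {H : ℝ → ℂ} {a b M : ℝ} (hab : a < b)
    (hH : ContinuousOn H (Set.Icc a b))
    (h : ∀ c d, a < c → c ≤ d → d < b → ‖H d - H c‖ ≤ M) : ‖H b - H a‖ ≤ M := by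
  have h1 : ∀ c ∈ Set.Ioo a b, ‖H b - H c‖ ≤ M := by
    intro c hc
    have ht : Tendsto (fun d => ‖H d - H c‖) (nhdsWithin b (Set.Ioo c b)) (nhds ‖H b - H c‖) := by
      have : ContinuousWithinAt H (Set.Ioo c b) b :=
        (hH b (Set.right_mem_Icc.2 hab.le)).mono
          (fun x hx => ⟨(hc.1.trans hx.1).le, hx.2.le⟩)
      exact (this.sub continuousWithinAt_const).norm
    have : (nhdsWithin b (Set.Ioo c b)).NeBot := right_nhdsWithin_Ioo_neBot hc.2
    exact le_of_tendsto ht (by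
      filter_upwards [self_mem_nhdsWithin] with d hd
      exact h c d hc.1 hd.1.le hd.2)
  have ht : Tendsto (fun c => ‖H b - H c‖) (nhdsWithin a (Set.Ioo a b)) (nhds ‖H b - H a‖) := by
    have : ContinuousWithinAt H (Set.Ioo a b) a :=
      (hH a (Set.left_mem_Icc.2 hab.le)).mono Set.Ioo_subset_Icc_self
    exact (continuousWithinAt_const.sub this).norm
  have : (nhdsWithin a (Set.Ioo a b)).NeBot := left_nhdsWithin_Ioo_neBot hab
  exact le_of_tendsto ht (by filter_upwards [self_mem_nhdsWithin] with c hc using h1 c hc)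

/-- A van der Corput type bound: an increment of a primitive `H` of `v w e^{iμP}`, where
`P' = v R` and `R' ≥ τ > 0`, is `O((μτ)^{-1/2})`. -/
lemma van_der_corput {a b : ℝ} (hab : a < b) {H w w' : ℝ → ℂ} {P R R' v : ℝ → ℝ} {μ τ K M : ℝ}
    (hμ : 0 < μ) (hτ : 0 < τ) (hK : 0 ≤ K) (hM : 0 ≤ M)
    (hHc : ContinuousOn H (Set.Icc a b))
    (hH : ∀ x ∈ Set.Ioo a b, HasDerivAt H (v x * w x * cis (μ * P x)) x)
    (hP : ∀ x ∈ Set.Ioo a b, HasDerivAt P (v x * R x) x)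
    (hw : ∀ x ∈ Set.Ioo a b, HasDerivAt w (w' x) x)
    (hR : ∀ x ∈ Set.Ioo a b, HasDerivAt R (R' x) x)
    (hRτ : ∀ x ∈ Set.Ioo a b, τ ≤ R' x)
    (hwK : ∀ x ∈ Set.Ioo a b, ‖w x‖ ≤ K)
    (hvM : ∀ x ∈ Set.Ioo a b, |v x| ≤ M)
    (hw'K : ∀ x ∈ Set.Ioo a b, ‖w' x‖ * |R x| ≤ K * (|R x| + τ)) :
    ‖H b - H a‖ ≤ K * ((M + 2) * Real.pi + (b - a) / 2 + 1) / Real.sqrt (μ * τ) := by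
  apply norm_sub_le_of_interior hab hHc
  intro c d hc hcd hd
  have hsub : ∀ x ∈ Set.Icc c d, x ∈ Set.Ioo a b := fun x hx => ⟨hc.trans_le hx.1, hx.2.trans_lt hd⟩
  set δ := Real.sqrt (τ / μ) with hδ
  have hδ0 : 0 < δ := Real.sqrt_pos.2 (by positivity)
  have hδ2 : δ ^ 2 = τ / μ := Real.sq_sqrt (by positivity)
  have hs : Real.sqrt (μ * τ) = μ * δ := by
    rw [show μ * τ = μ ^ 2 * (τ / μ) by field_simp, Real.sqrt_mul (by positivity),
      Real.sqrt_sq hμ.le]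
  have hden : ∀ x, 0 < δ ^ 2 + R x ^ 2 := fun x => by positivity
  set ρ : ℝ → ℝ := fun x => R x / (δ ^ 2 + R x ^ 2) with hρ
  have hρb : ∀ x, |ρ x| ≤ 1 / (2 * δ) := by
    intro x
    rw [hρ, abs_div, abs_of_pos (hden x), div_le_div_iff₀ (hden x) (by positivity)]
    nlinarith [sq_nonneg (δ - |R x|), sq_abs (R x)]
  have hρd : ∀ x ∈ Set.Ioo a b,
      HasDerivAt ρ (R' x * (δ ^ 2 - R x ^ 2) / (δ ^ 2 + R x ^ 2) ^ 2) x := by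
    intro x hx
    have := (hR x hx).div (((hR x hx).pow 2).const_add (δ ^ 2)) (hden x).ne'
    refine this.congr_deriv ?_
    simp only [Pi.pow_apply, Nat.cast_ofNat]; ring
  set Z : ℝ → ℂ := fun x => w x * (ρ x : ℂ) * cis (μ * P x) / (Complex.I * μ) with hZ
  have hIμ : (Complex.I * μ : ℂ) ≠ 0 := by simp [hμ.ne']
  have hZb : ∀ x ∈ Set.Icc c d, ‖Z x‖ ≤ K / (2 * δ * μ) := by
    intro x hx
    simp only [hZ, norm_div, norm_mul, norm_cis, Complex.norm_real, Complex.norm_I, one_mul,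
      mul_one, Real.norm_eq_abs, abs_of_pos hμ]
    rw [← div_div]
    gcongr
    rw [div_eq_mul_one_div K]
    exact mul_le_mul (hwK x (hsub x hx)) (hρb x) (abs_nonneg _) hK
  have hZd : ∀ x ∈ Set.Ioo a b, HasDerivAt Z
      ((w' x * (ρ x : ℂ) + w x * ((R' x * (δ ^ 2 - R x ^ 2) / (δ ^ 2 + R x ^ 2) ^ 2 : ℝ) : ℂ))
        * cis (μ * P x) / (Complex.I * μ) + w x * (ρ x : ℂ) * (v x * R x : ℝ) * cis (μ * P x)) x := by
    intro x hx
    have h1 := (((hw x hx).mul (hρd x hx).ofReal_comp).mul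
      (hasDerivAt_cis ((hP x hx).const_mul μ))).div_const (Complex.I * μ)
    refine h1.congr_deriv ?_
    have hμC : (μ : ℂ) ≠ 0 := by exact_mod_cast hμ.ne'
    simp only [Pi.mul_apply]
    push_cast
    field_simp
  set G : ℝ → ℂ := fun x => H x - Z x with hG
  set B : ℝ → ℝ := fun x => K * (M + 2) / (μ * δ) * Real.arctan (R x / δ) + K / (2 * μ * δ) * x
    with hB
  have key : ‖G d - G c‖ ≤ B d - B c := by
    apply norm_sub_le_of_norm_deriv_le (f' := fun x => v x * w x * cis (μ * P x) -
        ((w' x * (ρ x : ℂ) + w x * ((R' x * (δ ^ 2 - R x ^ 2) / (δ ^ 2 + R x ^ 2) ^ 2 : ℝ) : ℂ))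
        * cis (μ * P x) / (Complex.I * μ) + w x * (ρ x : ℂ) * (v x * R x : ℝ) * cis (μ * P x)))
        (B' := fun x => K * (M + 2) / μ * (R' x / (δ ^ 2 + R x ^ 2)) + K / (2 * μ * δ)) hcd
    · intro x hx
      exact ((hH x (hsub x hx)).sub (hZd x (hsub x hx))).continuousAt.continuousWithinAt
    · intro x hx
      have hx := hsub x (Set.Ioo_subset_Icc_self hx)
      exact (hH x hx).sub (hZd x hx)
    · intro x hx
      refine ContinuousAt.continuousWithinAt ?_
      have := (hR x (hsub x hx)).continuousAt
      fun_prop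
    · intro x hx
      have hx := hsub x (Set.Ioo_subset_Icc_self hx)
      have h1 := (((((hR x hx).div_const δ).arctan).const_mul (K * (M + 2) / (μ * δ)))).add
        ((hasDerivAt_id x).const_mul (K / (2 * μ * δ)))
      refine h1.congr_deriv ?_
      have := hden x
      field_simp
    · intro x hx
      have hx := hsub x (Set.Ioo_subset_Icc_self hx)
      have hD := hden x
      have hR'0 : 0 < R' x := hτ.trans_le (hRτ x hx)
      have e1 : v x * w x * cis (μ * P x) -
        ((w' x * (ρ x : ℂ) + w x * ((R' x * (δ ^ 2 - R x ^ 2) / (δ ^ 2 + R x ^ 2) ^ 2 : ℝ) : ℂ))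
        * cis (μ * P x) / (Complex.I * μ) + w x * (ρ x : ℂ) * (v x * R x : ℝ) * cis (μ * P x))
        = v x * w x * ((δ ^ 2 / (δ ^ 2 + R x ^ 2) : ℝ) : ℂ) * cis (μ * P x) -
          (w' x * (ρ x : ℂ)) * cis (μ * P x) / (Complex.I * μ) -
          (w x * ((R' x * (δ ^ 2 - R x ^ 2) / (δ ^ 2 + R x ^ 2) ^ 2 : ℝ) : ℂ))
            * cis (μ * P x) / (Complex.I * μ) := by
        have : ((δ ^ 2 / (δ ^ 2 + R x ^ 2) : ℝ) : ℂ) = 1 - (ρ x : ℂ) * R x := by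
          rw [hρ]; norm_cast; field_simp; ring
        rw [this]; push_cast; ring
      rw [e1]
      refine (norm_sub_le _ _).trans ((add_le_add (norm_sub_le _ _) le_rfl).trans ?_)
      generalize hq1 : δ ^ 2 / (δ ^ 2 + R x ^ 2) = q1
      generalize hq2 : R' x * (δ ^ 2 - R x ^ 2) / (δ ^ 2 + R x ^ 2) ^ 2 = q2
      simp only [norm_div, norm_mul, norm_cis, Complex.norm_real, Complex.norm_I, one_mul,
        mul_one, Real.norm_eq_abs, abs_of_pos hμ]
      have t1 : |v x| * ‖w x‖ * |δ ^ 2 / (δ ^ 2 + R x ^ 2)|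
          ≤ K * M / μ * (R' x / (δ ^ 2 + R x ^ 2)) := by
        rw [abs_of_pos (by positivity : 0 < δ ^ 2 / (δ ^ 2 + R x ^ 2))]
        calc |v x| * ‖w x‖ * (δ ^ 2 / (δ ^ 2 + R x ^ 2))
            ≤ M * K * (δ ^ 2 / (δ ^ 2 + R x ^ 2)) := by
              gcongr
              · exact hvM x hx
              · exact hwK x hx
          _ = K * M / μ * (τ / (δ ^ 2 + R x ^ 2)) := by rw [hδ2]; field_simp
          _ ≤ _ := by gcongr; exact hRτ x hx
      have t2 : ‖w' x‖ * |ρ x| / μ ≤ K / (2 * μ * δ) + K / μ * (R' x / (δ ^ 2 + R x ^ 2)) := by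
        have : ‖w' x‖ * |ρ x| ≤ K * (1 / (2 * δ)) + K * (R' x / (δ ^ 2 + R x ^ 2)) := by
          calc ‖w' x‖ * |ρ x| = ‖w' x‖ * |R x| / (δ ^ 2 + R x ^ 2) := by
                rw [hρ, abs_div, abs_of_pos hD]; ring
            _ ≤ K * (|R x| + τ) / (δ ^ 2 + R x ^ 2) :=
                div_le_div_of_nonneg_right (hw'K x hx) hD.le
            _ = K * |ρ x| + K * (τ / (δ ^ 2 + R x ^ 2)) := by
                rw [hρ, abs_div, abs_of_pos hD]; ring
            _ ≤ _ := by
                gcongr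
                · exact hρb x
                · exact hRτ x hx
        calc ‖w' x‖ * |ρ x| / μ ≤ (K * (1 / (2 * δ)) + K * (R' x / (δ ^ 2 + R x ^ 2))) / μ := by gcongr
          _ = _ := by field_simp
      have t3 : ‖w x‖ * |R' x * (δ ^ 2 - R x ^ 2) / (δ ^ 2 + R x ^ 2) ^ 2| / μ
          ≤ K / μ * (R' x / (δ ^ 2 + R x ^ 2)) := by
        have : |R' x * (δ ^ 2 - R x ^ 2) / (δ ^ 2 + R x ^ 2) ^ 2| ≤ R' x / (δ ^ 2 + R x ^ 2) := by
          rw [abs_div, abs_mul, abs_of_pos hR'0, abs_of_pos (by positivity : 0 < (δ ^ 2 + R x ^ 2) ^ 2),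
            div_le_div_iff₀ (by positivity) hD]
          have : |δ ^ 2 - R x ^ 2| ≤ δ ^ 2 + R x ^ 2 := by
            rw [abs_le]; constructor <;> nlinarith [sq_nonneg δ, sq_nonneg (R x)]
          calc R' x * |δ ^ 2 - R x ^ 2| * (δ ^ 2 + R x ^ 2)
              ≤ R' x * (δ ^ 2 + R x ^ 2) * (δ ^ 2 + R x ^ 2) := by gcongr
            _ = _ := by ring
        calc _ ≤ K * (R' x / (δ ^ 2 + R x ^ 2)) / μ :=
              div_le_div_of_nonneg_right (mul_le_mul (hwK x hx) this (abs_nonneg _) hK) hμ.le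
          _ = _ := by ring
      rw [hq1] at t1
      rw [hq2] at t3
      calc |v x| * ‖w x‖ * |q1| + ‖w' x‖ * |ρ x| / μ + ‖w x‖ * |q2| / μ
          ≤ K * M / μ * (R' x / (δ ^ 2 + R x ^ 2)) +
          (K / (2 * μ * δ) + K / μ * (R' x / (δ ^ 2 + R x ^ 2)))
          + K / μ * (R' x / (δ ^ 2 + R x ^ 2)) := add_le_add (add_le_add t1 t2) t3
        _ = _ := by ring
  have hBb : B d - B c ≤ K * (M + 2) / (μ * δ) * Real.pi + K / (2 * μ * δ) * (b - a) := by
    have h1 := Real.arctan_lt_pi_div_two (R d / δ)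
    have h2 := Real.neg_pi_div_two_lt_arctan (R c / δ)
    have : B d - B c = K * (M + 2) / (μ * δ) * (Real.arctan (R d / δ) - Real.arctan (R c / δ))
      + K / (2 * μ * δ) * (d - c) := by simp only [hB]; ring
    rw [this]
    have : 0 ≤ K * (M + 2) / (μ * δ) := by positivity
    gcongr; linarith
  have e2 : H d - H c = (G d - G c) + (Z d - Z c) := by simp only [hG]; ring
  rw [e2, hs]
  calc _ ≤ ‖G d - G c‖ + (‖Z d‖ + ‖Z c‖) := (norm_add_le _ _).trans (by gcongr; exact norm_sub_le _ _)
    _ ≤ (K * (M + 2) / (μ * δ) * Real.pi + K / (2 * μ * δ) * (b - a)) +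
      (K / (2 * δ * μ) + K / (2 * δ * μ)) := by
        gcongr
        · exact key.trans hBb
        · exact hZb d (Set.right_mem_Icc.2 hcd)
        · exact hZb c (Set.left_mem_Icc.2 hcd)
    _ = _ := by field_simp; ring

/-- Integration by parts once: an increment of a primitive `H` of `v w e^{iμP}`, where
`P' = v R` and `|R| ≥ ρ > 0`. -/
lemma nonstationary_once {a b : ℝ} (hab : a < b) {H w w' : ℝ → ℂ} {P R R' v : ℝ → ℝ} {μ ρ K C : ℝ}
    (hμ : 0 < μ) (hρ : 0 < ρ) (hK : 0 ≤ K) (hC : 0 ≤ C)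
    (hHc : ContinuousOn H (Set.Icc a b))
    (hH : ∀ x ∈ Set.Ioo a b, HasDerivAt H (v x * w x * cis (μ * P x)) x)
    (hP : ∀ x ∈ Set.Ioo a b, HasDerivAt P (v x * R x) x)
    (hw : ∀ x ∈ Set.Ioo a b, HasDerivAt w (w' x) x)
    (hR : ∀ x ∈ Set.Ioo a b, HasDerivAt R (R' x) x)
    (hRρ : ∀ x ∈ Set.Ioo a b, ρ ≤ |R x|)
    (hR'C : ∀ x ∈ Set.Ioo a b, |R' x| ≤ C * |R x|)
    (hwK : ∀ x ∈ Set.Ioo a b, ‖w x‖ ≤ K)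
    (hw'K : ∀ x ∈ Set.Ioo a b, ‖w' x‖ ≤ K) :
    ‖H b - H a‖ ≤ K * ((1 + C) * (b - a) + 2) / (μ * ρ) := by
  apply norm_sub_le_of_interior hab hHc
  intro c d hc hcd hd
  have hsub : ∀ x ∈ Set.Icc c d, x ∈ Set.Ioo a b := fun x hx => ⟨hc.trans_le hx.1, hx.2.trans_lt hd⟩
  have hR0 : ∀ x ∈ Set.Ioo a b, R x ≠ 0 := fun x hx => abs_pos.1 (hρ.trans_le (hRρ x hx))
  have hIμ : (Complex.I * μ : ℂ) ≠ 0 := by simp [hμ.ne']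
  set Z : ℝ → ℂ := fun x => w x * ((R x)⁻¹ : ℝ) * cis (μ * P x) / (Complex.I * μ) with hZ
  have hinv : ∀ x ∈ Set.Ioo a b, |(R x)⁻¹| ≤ 1 / ρ := by
    intro x hx
    rw [abs_inv, inv_eq_one_div]
    exact one_div_le_one_div_of_le hρ (hRρ x hx)
  have hZb : ∀ x ∈ Set.Icc c d, ‖Z x‖ ≤ K / (μ * ρ) := by
    intro x hx
    simp only [hZ, norm_div, norm_mul, norm_cis, Complex.norm_real, Complex.norm_I, one_mul,
      mul_one, Real.norm_eq_abs, abs_of_pos hμ]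
    calc _ ≤ K * (1 / ρ) / μ := by
          gcongr
          · exact hwK x (hsub x hx)
          · exact hinv x (hsub x hx)
      _ = _ := by field_simp
  have hZd : ∀ x ∈ Set.Ioo a b, HasDerivAt Z
      ((w' x * ((R x)⁻¹ : ℝ) + w x * ((-R' x / R x ^ 2 : ℝ) : ℂ))
        * cis (μ * P x) / (Complex.I * μ) + v x * w x * cis (μ * P x)) x := by
    intro x hx
    have h1 := (((hw x hx).mul ((hR x hx).inv (hR0 x hx)).ofReal_comp).mul
      (hasDerivAt_cis ((hP x hx).const_mul μ))).div_const (Complex.I * μ)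
    refine h1.congr_deriv ?_
    have : (R x : ℂ) ≠ 0 := by exact_mod_cast hR0 x hx
    have hμC : (μ : ℂ) ≠ 0 := by exact_mod_cast hμ.ne'
    simp only [Pi.mul_apply, Pi.inv_apply, Complex.ofReal_inv]
    push_cast
    field_simp
  have key : ‖(H d - Z d) - (H c - Z c)‖ ≤ K * (1 + C) / (μ * ρ) * d - K * (1 + C) / (μ * ρ) * c := by
    apply norm_sub_le_of_norm_deriv_le (f := fun x => H x - Z x) (f' := fun x => v x * w x * cis (μ * P x) -
        ((w' x * ((R x)⁻¹ : ℝ) + w x * ((-R' x / R x ^ 2 : ℝ) : ℂ))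
        * cis (μ * P x) / (Complex.I * μ) + v x * w x * cis (μ * P x)))
        (B := fun x => K * (1 + C) / (μ * ρ) * x) (B' := fun x => K * (1 + C) / (μ * ρ)) hcd
    · intro x hx
      exact ((hH x (hsub x hx)).sub (hZd x (hsub x hx))).continuousAt.continuousWithinAt
    · intro x hx
      have hx := hsub x (Set.Ioo_subset_Icc_self hx)
      exact (hH x hx).sub (hZd x hx)
    · fun_prop
    · intro x hx
      simpa using (hasDerivAt_id x).const_mul (K * (1 + C) / (μ * ρ))
    · intro x hx
      have hx := hsub x (Set.Ioo_subset_Icc_self hx)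
      have hRx := hR0 x hx
      rw [show ∀ p q : ℂ, p - (q + p) = -q by intros; ring, norm_neg]
      simp only [norm_div, norm_mul, norm_cis, Complex.norm_I, one_mul, Complex.norm_real,
        mul_one, Real.norm_eq_abs, abs_of_pos hμ]
      have h2 : |-R' x / R x ^ 2| ≤ C * (1 / ρ) := by
        calc |-R' x / R x ^ 2| = |R' x| * |(R x)⁻¹| * |(R x)⁻¹| := by
              rw [abs_div, abs_neg, abs_inv, abs_pow]
              have := abs_pos.2 hRx
              field_simp
          _ ≤ C * |R x| * |(R x)⁻¹| * (1 / ρ) := by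
              gcongr
              · exact hR'C x hx
              · exact hinv x hx
          _ = _ := by
              have := abs_pos.2 hRx
              rw [abs_inv]; field_simp
      calc _ ≤ (‖w' x‖ * |(R x)⁻¹| + ‖w x‖ * |-R' x / R x ^ 2|) / μ := by
            gcongr
            refine (norm_add_le _ _).trans (le_of_eq ?_)
            simp only [norm_mul, Complex.norm_real, Real.norm_eq_abs]
        _ ≤ (K * (1 / ρ) + K * (C * (1 / ρ))) / μ := by
            gcongr
            · exact hw'K x hx
            · exact hinv x hx
            · exact hwK x hx
        _ = _ := by field_simp
  have e2 : H d - H c = ((H d - Z d) - (H c - Z c)) + (Z d - Z c) := by ring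
  rw [e2]
  calc _ ≤ ‖(H d - Z d) - (H c - Z c)‖ + (‖Z d‖ + ‖Z c‖) :=
        (norm_add_le _ _).trans (by gcongr; exact norm_sub_le _ _)
    _ ≤ (K * (1 + C) / (μ * ρ) * d - K * (1 + C) / (μ * ρ) * c) + (K / (μ * ρ) + K / (μ * ρ)) := by
        gcongr
        · exact hZb d (Set.right_mem_Icc.2 hcd)
        · exact hZb c (Set.left_mem_Icc.2 hcd)
    _ = K * (1 + C) / (μ * ρ) * (d - c) + 2 * K / (μ * ρ) := by ring
    _ ≤ K * (1 + C) / (μ * ρ) * (b - a) + 2 * K / (μ * ρ) := by gcongr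
    _ = _ := by field_simp

/-- Integration by parts twice, for an amplitude vanishing at both ends of the interval. -/
lemma nonstationary_twice {a b : ℝ} (hab : a ≤ b) {H w w' w'' : ℝ → ℂ} {P p p' p'' : ℝ → ℝ}
    {μ m K C : ℝ} (hμ : 0 < μ) (hm : 0 < m) (hK : 0 ≤ K) (hC : 0 ≤ C)
    (hH : ∀ x ∈ Set.Icc a b, HasDerivAt H (w x * cis (μ * P x)) x)
    (hP : ∀ x ∈ Set.Icc a b, HasDerivAt P (p x) x)
    (hp : ∀ x ∈ Set.Icc a b, HasDerivAt p (p' x) x)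
    (hp' : ∀ x ∈ Set.Icc a b, HasDerivAt p' (p'' x) x)
    (hw : ∀ x ∈ Set.Icc a b, HasDerivAt w (w' x) x)
    (hw' : ∀ x ∈ Set.Icc a b, HasDerivAt w' (w'' x) x)
    (hpm : ∀ x ∈ Set.Icc a b, m ≤ |p x|)
    (hp'C : ∀ x ∈ Set.Icc a b, |p' x| ≤ C * |p x|)
    (hp''C : ∀ x ∈ Set.Icc a b, |p'' x| ≤ C * |p x|)
    (hwK : ∀ x ∈ Set.Icc a b, ‖w x‖ ≤ K)
    (hw'K : ∀ x ∈ Set.Icc a b, ‖w' x‖ ≤ K)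
    (hw''K : ∀ x ∈ Set.Icc a b, ‖w'' x‖ ≤ K)
    (ha : w a = 0) (ha' : w' a = 0) (hb : w b = 0) (hb' : w' b = 0) :
    ‖H b - H a‖ ≤ K * (1 + 4 * C + 3 * C ^ 2) * (b - a) / (μ * m) ^ 2 := by
  have hp0 : ∀ x ∈ Set.Icc a b, p x ≠ 0 := fun x hx => abs_pos.1 (hm.trans_le (hpm x hx))
  have hp0C : ∀ x ∈ Set.Icc a b, (p x : ℂ) ≠ 0 := fun x hx => by exact_mod_cast hp0 x hx
  have hIμ : (Complex.I * μ : ℂ) ≠ 0 := by simp [hμ.ne']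
  set Z : ℝ → ℂ := fun x => (w x / p x / (Complex.I * μ)
    + (-(w' x / p x ^ 2) + w x * p' x / p x ^ 3) / (Complex.I * μ) ^ 2) * cis (μ * P x) with hZ
  set E : ℝ → ℂ := fun x => -(w'' x / p x ^ 2) + 3 * (w' x * p' x / p x ^ 3) + w x * p'' x / p x ^ 3
    - 3 * (w x * p' x ^ 2 / p x ^ 4) with hE
  have hZd : ∀ x ∈ Set.Icc a b, HasDerivAt Z
      (w x * cis (μ * P x) + E x / (Complex.I * μ) ^ 2 * cis (μ * P x)) x := by
    intro x hx
    have hpx := hp0C x hx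
    have hpd := (hp x hx).ofReal_comp
    have h1 := ((hw x hx).div hpd hpx).div_const (Complex.I * μ)
    have h2 := ((hw' x hx).div (hpd.pow 2) (pow_ne_zero 2 hpx)).neg
    have h3 := ((hw x hx).mul (hp' x hx).ofReal_comp).div (hpd.pow 3) (pow_ne_zero 3 hpx)
    have h4 := (h1.add ((h2.add h3).div_const ((Complex.I * μ) ^ 2))).mul
      (hasDerivAt_cis ((hP x hx).const_mul μ))
    refine h4.congr_deriv ?_
    have hμC : (μ : ℂ) ≠ 0 := by exact_mod_cast hμ.ne'
    simp only [hE, Pi.pow_apply, Pi.div_apply, Pi.mul_apply, Pi.add_apply, Pi.neg_apply]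
    push_cast
    field_simp
    ring
  have hEb : ∀ x ∈ Set.Icc a b, ‖E x‖ ≤ K * (1 + 4 * C + 3 * C ^ 2) / m ^ 2 := by
    intro x hx
    have hq : 0 < |p x| := abs_pos.2 (hp0 x hx)
    have h1 : ‖-(w'' x / (p x : ℂ) ^ 2)‖ ≤ K / |p x| ^ 2 := by
      rw [norm_neg, norm_div, norm_pow, Complex.norm_real, Real.norm_eq_abs]
      gcongr; exact hw''K x hx
    have h2 : ‖3 * (w' x * p' x / (p x : ℂ) ^ 3)‖ ≤ 3 * (K * C) / |p x| ^ 2 := by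
      rw [norm_mul, norm_div, norm_pow, norm_mul, Complex.norm_real, Real.norm_eq_abs,
        Complex.norm_real, Real.norm_eq_abs]
      have : ‖w' x‖ * |p' x| ≤ K * (C * |p x|) := by
        gcongr
        · exact hw'K x hx
        · exact hp'C x hx
      calc _ ≤ ‖(3 : ℂ)‖ * (K * (C * |p x|) / |p x| ^ 3) := by gcongr
        _ = _ := by simp only [Complex.norm_ofNat]; field_simp
    have h3 : ‖w x * p'' x / (p x : ℂ) ^ 3‖ ≤ (K * C) / |p x| ^ 2 := by
      rw [norm_div, norm_pow, norm_mul, Complex.norm_real, Real.norm_eq_abs,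
        Complex.norm_real, Real.norm_eq_abs]
      have : ‖w x‖ * |p'' x| ≤ K * (C * |p x|) := by
        gcongr
        · exact hwK x hx
        · exact hp''C x hx
      calc _ ≤ (K * (C * |p x|) / |p x| ^ 3) := by gcongr
        _ = _ := by field_simp
    have h4 : ‖3 * (w x * p' x ^ 2 / (p x : ℂ) ^ 4)‖ ≤ 3 * (K * C ^ 2) / |p x| ^ 2 := by
      rw [norm_mul, norm_div, norm_pow, norm_mul, norm_pow, Complex.norm_real, Real.norm_eq_abs,
        Complex.norm_real, Real.norm_eq_abs]
      have : ‖w x‖ * |p' x| ^ 2 ≤ K * (C * |p x|) ^ 2 := by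
        gcongr
        · exact hwK x hx
        · exact hp'C x hx
      calc _ ≤ ‖(3 : ℂ)‖ * (K * (C * |p x|) ^ 2 / |p x| ^ 4) := by gcongr
        _ = _ := by simp only [Complex.norm_ofNat]; field_simp
    calc ‖E x‖ ≤ K / |p x| ^ 2 + 3 * (K * C) / |p x| ^ 2 + (K * C) / |p x| ^ 2
          + 3 * (K * C ^ 2) / |p x| ^ 2 := by
          refine (norm_sub_le _ _).trans (add_le_add ?_ h4)
          refine (norm_add_le _ _).trans (add_le_add ?_ h3)
          exact (norm_add_le _ _).trans (add_le_add h1 h2)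
      _ = K * (1 + 4 * C + 3 * C ^ 2) / |p x| ^ 2 := by ring
      _ ≤ _ := by gcongr; exact hpm x hx
  set M := K * (1 + 4 * C + 3 * C ^ 2) / m ^ 2 / μ ^ 2 with hM
  have key : ‖(H b - Z b) - (H a - Z a)‖ ≤ M * b - M * a := by
    apply norm_sub_le_of_norm_deriv_le (f := fun x => H x - Z x)
      (f' := fun x => w x * cis (μ * P x) -
        (w x * cis (μ * P x) + E x / (Complex.I * μ) ^ 2 * cis (μ * P x)))
      (B := fun x => M * x) (B' := fun _ => M) hab
    · intro x hx
      exact ((hH x hx).sub (hZd x hx)).continuousAt.continuousWithinAt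
    · intro x hx
      have hx := Set.Ioo_subset_Icc_self hx
      exact (hH x hx).sub (hZd x hx)
    · fun_prop
    · intro x hx
      simpa using (hasDerivAt_id x).const_mul M
    · intro x hx
      rw [show ∀ p q : ℂ, p - (p + q) = -q by intros; ring, norm_neg]
      simp only [norm_div, norm_mul, norm_cis, Complex.norm_I, one_mul, Complex.norm_real,
        mul_one, Real.norm_eq_abs, abs_of_pos hμ, norm_pow, hM]
      gcongr
      exact hEb x (Set.Ioo_subset_Icc_self hx)
  have z1 : Z a = 0 := by simp [hZ, ha, ha']
  have z2 : Z b = 0 := by simp [hZ, hb, hb']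
  rw [z1, z2, sub_zero, sub_zero] at key
  refine key.trans (le_of_eq ?_)
  rw [hM]; field_simp

/-- Differentiation under an interval integral with a bounded derivative. -/
lemma hasDerivAt_integral_param {a b x₀ δ M : ℝ} {f f' : ℝ → ℝ → ℂ} (hab : a ≤ b) (hδ : 0 < δ)
    (hf : ∀ x ∈ Metric.ball x₀ δ, ContinuousOn (f x) (Set.Icc a b))
    (hd : ∀ x ∈ Metric.ball x₀ δ, ∀ y ∈ Set.Icc a b, HasDerivAt (fun x => f x y) (f' x y) x)
    (hM : ∀ x ∈ Metric.ball x₀ δ, ∀ y ∈ Set.Icc a b, ‖f' x y‖ ≤ M)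
    (hf' : ContinuousOn (f' x₀) (Set.Icc a b)) :
    HasDerivAt (fun x => ∫ y in a..b, f x y) (∫ y in a..b, f' x₀ y) x₀ := by
  have hI : Set.uIoc a b ⊆ Set.Icc a b := by
    rw [Set.uIoc_of_le hab]; exact Set.Ioc_subset_Icc_self
  refine (intervalIntegral.hasDerivAt_integral_of_dominated_loc_of_deriv_le
    (bound := fun _ => M) (Metric.ball_mem_nhds x₀ hδ) ?_ ?_ ?_ ?_ ?_ ?_).2
  · filter_upwards [Metric.ball_mem_nhds x₀ hδ] with x hx
    exact ((hf x hx).aestronglyMeasurable measurableSet_Icc).mono_set hI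
  · exact (hf x₀ (Metric.mem_ball_self hδ)).intervalIntegrable_of_Icc hab
  · exact (hf'.aestronglyMeasurable measurableSet_Icc).mono_set hI
  · exact Filter.Eventually.of_forall fun y hy x hx => hM x hx y (hI hy)
  · exact intervalIntegrable_const
  · exact Filter.Eventually.of_forall fun y hy x hx => hd x hx y (hI hy)

/-- A primitive of a function continuous on an interval. -/
lemma hasDerivAt_primitive {a b x : ℝ} {g : ℝ → ℂ} (hg : ContinuousOn g (Set.Icc a b))
    (hx : x ∈ Set.Ioo a b) : HasDerivAt (fun t => ∫ y in a..t, g y) (g x) x := by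
  have hab : a ≤ b := (hx.1.trans hx.2).le
  have hc : ContinuousAt g x := hg.continuousAt (Icc_mem_nhds hx.1 hx.2)
  refine intervalIntegral.integral_hasDerivAt_right ?_ ?_ hc
  · exact (hg.mono (Set.Icc_subset_Icc_right hx.2.le)).intervalIntegrable_of_Icc hx.1.le
  · exact ⟨Set.Ioo a b, Ioo_mem_nhds hx.1 hx.2, (hg.mono Set.Ioo_subset_Icc_self).aestronglyMeasurable
      measurableSet_Ioo⟩

lemma continuousOn_primitive {a b : ℝ} {g : ℝ → ℂ} (hab : a ≤ b)
    (hg : ContinuousOn g (Set.Icc a b)) :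
    ContinuousOn (fun t => ∫ y in a..t, g y) (Set.Icc a b) := by
  have := intervalIntegral.continuousOn_primitive_interval' (μ := volume)
    (hg.intervalIntegrable_of_Icc hab) (Set.left_mem_uIcc)
  rwa [Set.uIcc_of_le hab] at this

lemma van_der_corput_integral {a b : ℝ} (hab : a < b) {w w' : ℝ → ℂ} {P R R' v : ℝ → ℝ}
    {μ τ K M : ℝ} (hμ : 0 < μ) (hτ : 0 < τ) (hK : 0 ≤ K) (hM : 0 ≤ M)
    (hc : ContinuousOn (fun x => v x * w x * cis (μ * P x)) (Set.Icc a b))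
    (hP : ∀ x ∈ Set.Ioo a b, HasDerivAt P (v x * R x) x)
    (hw : ∀ x ∈ Set.Ioo a b, HasDerivAt w (w' x) x)
    (hR : ∀ x ∈ Set.Ioo a b, HasDerivAt R (R' x) x)
    (hRτ : ∀ x ∈ Set.Ioo a b, τ ≤ R' x)
    (hwK : ∀ x ∈ Set.Ioo a b, ‖w x‖ ≤ K)
    (hvM : ∀ x ∈ Set.Ioo a b, |v x| ≤ M)
    (hw'K : ∀ x ∈ Set.Ioo a b, ‖w' x‖ * |R x| ≤ K * (|R x| + τ)) :
    ‖∫ x in a..b, v x * w x * cis (μ * P x)‖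
      ≤ K * ((M + 2) * Real.pi + (b - a) / 2 + 1) / Real.sqrt (μ * τ) := by
  have := van_der_corput hab hμ hτ hK hM (continuousOn_primitive hab.le hc)
    (fun x hx => hasDerivAt_primitive hc hx) hP hw hR hRτ hwK hvM hw'K
  simpa using this

lemma nonstationary_once_integral {a b : ℝ} (hab : a < b) {w w' : ℝ → ℂ} {P R R' v : ℝ → ℝ}
    {μ ρ K C : ℝ}
    (hμ : 0 < μ) (hρ : 0 < ρ) (hK : 0 ≤ K) (hC : 0 ≤ C)
    (hc : ContinuousOn (fun x => v x * w x * cis (μ * P x)) (Set.Icc a b))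
    (hP : ∀ x ∈ Set.Ioo a b, HasDerivAt P (v x * R x) x)
    (hw : ∀ x ∈ Set.Ioo a b, HasDerivAt w (w' x) x)
    (hR : ∀ x ∈ Set.Ioo a b, HasDerivAt R (R' x) x)
    (hRρ : ∀ x ∈ Set.Ioo a b, ρ ≤ |R x|)
    (hR'C : ∀ x ∈ Set.Ioo a b, |R' x| ≤ C * |R x|)
    (hwK : ∀ x ∈ Set.Ioo a b, ‖w x‖ ≤ K)
    (hw'K : ∀ x ∈ Set.Ioo a b, ‖w' x‖ ≤ K) :
    ‖∫ x in a..b, v x * w x * cis (μ * P x)‖ ≤ K * ((1 + C) * (b - a) + 2) / (μ * ρ) := by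
  have := nonstationary_once hab hμ hρ hK hC (continuousOn_primitive hab.le hc)
    (fun x hx => hasDerivAt_primitive hc hx) hP hw hR hRρ hR'C hwK hw'K
  simpa using this

/-- Smooth functions vanishing outside an open interval. -/
def IsCutoff (c : ℝ → ℝ) (a b : ℝ) : Prop :=
  ContDiff ℝ (⊤ : ℕ∞) c ∧ ∀ x, x ∉ Set.Ioo a b → c x = 0

lemma IsCutoff.of_lt {c : ℝ → ℝ} {a b : ℝ} (hc : ContDiff ℝ (⊤ : ℕ∞) c)
    (h1 : ∀ x < a, c x = 0) (h2 : ∀ x > b, c x = 0) : IsCutoff c a b := by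
  have hcl : IsClosed {x | c x = 0} := isClosed_eq hc.continuous continuous_const
  refine ⟨hc, fun x hx => ?_⟩
  have hx' : x ≤ a ∨ b ≤ x := by
    by_contra! h; exact hx ⟨h.1, h.2⟩
  rcases hx' with h | h
  · have : closure (Set.Iio a) ⊆ {x | c x = 0} := hcl.closure_subset_iff.2 h1
    rw [closure_Iio] at this; exact this h
  · have : closure (Set.Ioi b) ⊆ {x | c x = 0} := hcl.closure_subset_iff.2 h2
    rw [closure_Ioi] at this; exact this h

lemma IsCutoff.deriv {c : ℝ → ℝ} {a b : ℝ} (hc : IsCutoff c a b) : IsCutoff (deriv c) a b := by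
  refine IsCutoff.of_lt (contDiff_infty_iff_deriv.1 hc.1).2 ?_ ?_
  · intro x hx
    have : c =ᶠ[nhds x] fun _ => 0 := by
      filter_upwards [Iio_mem_nhds hx] with y hy
      exact hc.2 y fun h => absurd h.1 (not_lt.2 (le_of_lt hy))
    rw [this.deriv_eq, deriv_const]
  · intro x hx
    have : c =ᶠ[nhds x] fun _ => 0 := by
      filter_upwards [Ioi_mem_nhds hx] with y hy
      exact hc.2 y fun h => absurd h.2 (not_lt.2 (le_of_lt hy))
    rw [this.deriv_eq, deriv_const]

lemma IsCutoff.hasDerivAt {c : ℝ → ℝ} {a b : ℝ} (hc : IsCutoff c a b) (x : ℝ) :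
    HasDerivAt c (_root_.deriv c x) x :=
  ((contDiff_infty_iff_deriv.1 hc.1).1 x).hasDerivAt

lemma IsCutoff.bounded {c : ℝ → ℝ} {a b : ℝ} (hc : IsCutoff c a b) :
    ∃ M, 0 ≤ M ∧ ∀ x, |c x| ≤ M := by
  obtain ⟨M, hM⟩ := isCompact_Icc.exists_bound_of_continuousOn
    (hc.1.continuous.continuousOn (s := Set.Icc a b))
  refine ⟨max M 0, le_max_right _ _, fun x => ?_⟩
  by_cases hx : x ∈ Set.Icc a b
  · exact (hM x hx).trans (le_max_left _ _)
  · rw [hc.2 x fun h => hx (Set.Ioo_subset_Icc_self h), abs_zero]; exact le_max_right _ _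

/-- The reduced amplitude of the `S`-integral. -/
noncomputable def kS (c : ℝ → ℝ) (j : ℕ) (μ r : ℝ) : ℂ :=
  ∫ S in (1/8 : ℝ)..(3/2), ((S + r : ℝ) : ℂ) * ((c S * ((S + r) ^ (j + 1))⁻¹ : ℝ) : ℂ) *
    cis (μ * ((S - r) ^ 2 * (S + 2 * r) / 3))

lemma kS_bound {c : ℝ → ℝ} (hc : IsCutoff c (1/8) (3/2)) (j : ℕ) :
    ∃ C, 0 ≤ C ∧ ∀ μ r : ℝ, 0 < μ → r ∈ Set.Icc (2/5 : ℝ) (3/2) →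
      ‖kS c j μ r‖ ≤ C / Real.sqrt μ := by
  obtain ⟨M₀, hM₀, h0⟩ := hc.bounded
  obtain ⟨M₁, hM₁, h1⟩ := hc.deriv.bounded
  set K := M₁ * 2 ^ (j + 1) + M₀ * ((j + 1) * 2 ^ (j + 2)) + M₀ * 2 ^ (j + 1) with hK
  have hK0 : 0 ≤ K := by positivity
  refine ⟨K * ((3 + 2) * Real.pi + (3/2 - 1/8) / 2 + 1), by have := Real.pi_pos; positivity, ?_⟩
  intro μ r hμ hr
  have hS : ∀ S ∈ Set.Icc (1/8 : ℝ) (3/2), 1/2 ≤ S + r := fun S hS => by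
    linarith [hS.1, hr.1]
  have hinv : ∀ n : ℕ, ∀ S ∈ Set.Icc (1/8 : ℝ) (3/2), ((S + r) ^ n)⁻¹ ≤ 2 ^ n := by
    intro n S h
    have h2 := hS S h
    rw [← inv_pow]
    refine pow_le_pow_left₀ (inv_nonneg.2 (by linarith)) ?_ n
    rw [inv_le_comm₀ (by linarith) (by norm_num)]; linarith
  have := van_der_corput_integral (a := 1/8) (b := 3/2) (by norm_num) (μ := μ) (τ := 1) (K := K)
    (M := 3) hμ one_pos hK0 (by norm_num) (w := fun S => ((c S * ((S + r) ^ (j + 1))⁻¹ : ℝ) : ℂ))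
    (w' := fun S => ((deriv c S * ((S + r) ^ (j + 1))⁻¹
      + c S * (-(((j + 1 : ℕ) : ℝ) * (S + r) ^ j) / ((S + r) ^ (j + 1)) ^ 2) : ℝ) : ℂ))
    (P := fun S => (S - r) ^ 2 * (S + 2 * r) / 3) (R := fun S => S - r) (R' := fun _ => 1)
    (v := fun S => S + r) ?_ ?_ ?_ ?_ ?_ ?_ ?_ ?_
  · rw [mul_one] at this; exact this
  · have hcc := hc.1.continuous
    refine ContinuousOn.mul (ContinuousOn.mul (by fun_prop) ?_) ?_
    · refine Complex.continuous_ofReal.comp_continuousOn ?_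
      refine hcc.continuousOn.mul (ContinuousOn.inv₀ (by fun_prop) ?_)
      intro S h; have := hS S h; positivity
    · exact (continuous_cis.comp (by fun_prop)).continuousOn
  · intro S h
    have := ((((hasDerivAt_id S).sub_const r).pow 2).mul ((hasDerivAt_id S).add_const (2 * r))).div_const 3
    refine this.congr_deriv ?_
    simp only [id, Pi.pow_apply]; push_cast; ring
  · intro S h
    have h' := hS S (Set.Ioo_subset_Icc_self h)
    have := ((hc.hasDerivAt S).mul ((((hasDerivAt_id S).add_const r).pow (j + 1)).inv
      (by have : (0:ℝ) < S + r := by linarith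
          simp only [id, Pi.pow_apply]; positivity)))
    refine (this.congr_deriv ?_).ofReal_comp
    simp [Pi.pow_apply]
  · intro S h
    simpa using (hasDerivAt_id S).sub_const r
  · intro S h; exact le_rfl
  · intro S h
    have h := Set.Ioo_subset_Icc_self h
    have h' := hS S h
    have hp : 0 ≤ ((S + r) ^ (j + 1))⁻¹ := by positivity
    rw [Complex.norm_real, Real.norm_eq_abs, abs_mul, abs_of_nonneg hp]
    calc _ ≤ M₀ * 2 ^ (j + 1) := by gcongr; exacts [h0 S, hinv _ S h]
      _ ≤ K := by rw [hK]; have : 0 ≤ M₁ * 2 ^ (j + 1) + M₀ * ((j + 1) * 2 ^ (j + 2)) := by positivity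
                  linarith
  · intro S h
    have := hS S (Set.Ioo_subset_Icc_self h)
    rw [abs_of_nonneg (by linarith)]; linarith [h.2, hr.2]
  · intro S h
    have h := Set.Ioo_subset_Icc_self h
    have h' := hS S h
    have hSr : 0 < S + r := by linarith
    have hp : 0 ≤ ((S + r) ^ (j + 1))⁻¹ := by positivity
    have e : -(((j + 1 : ℕ) : ℝ) * (S + r) ^ j) / ((S + r) ^ (j + 1)) ^ 2
      = -(((j : ℝ) + 1) * ((S + r) ^ (j + 2))⁻¹) := by
      push_cast; field_simp; ring
    have hb : ‖((deriv c S * ((S + r) ^ (j + 1))⁻¹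
      + c S * (-(((j + 1 : ℕ) : ℝ) * (S + r) ^ j) / ((S + r) ^ (j + 1)) ^ 2) : ℝ) : ℂ)‖ ≤ K := by
      rw [e, Complex.norm_real, Real.norm_eq_abs]
      refine (abs_add_le _ _).trans ?_
      rw [abs_mul, abs_mul, abs_neg, abs_of_nonneg hp,
        abs_of_nonneg (by positivity : 0 ≤ ((j : ℝ) + 1) * ((S + r) ^ (j + 2))⁻¹)]
      calc _ ≤ M₁ * 2 ^ (j + 1) + M₀ * ((j + 1) * 2 ^ (j + 2)) := by
            gcongr
            exacts [h1 S, hinv _ S h, h0 S, hinv _ S h]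
        _ ≤ K := by rw [hK]; have : 0 ≤ M₀ * 2 ^ (j + 1) := by positivity
                    linarith
    nlinarith [abs_nonneg (S - r), mul_le_mul_of_nonneg_right hb (abs_nonneg (S - r))]

lemma continuousOn_kS_integrand {c : ℝ → ℝ} (hc : Continuous c) (j : ℕ) (μ : ℝ) :
    ContinuousOn (fun p : ℝ × ℝ => ((p.2 + p.1 : ℝ) : ℂ) *
      ((c p.2 * ((p.2 + p.1) ^ (j + 1))⁻¹ : ℝ) : ℂ) *
      cis (μ * ((p.2 - p.1) ^ 2 * (p.2 + 2 * p.1) / 3))) {p | p.2 + p.1 ≠ 0} := by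
  refine ContinuousOn.mul (ContinuousOn.mul (by fun_prop) ?_) ?_
  · refine Complex.continuous_ofReal.comp_continuousOn ?_
    refine (hc.comp continuous_snd).continuousOn.mul (ContinuousOn.inv₀ (by fun_prop) ?_)
    intro p hp; exact pow_ne_zero _ hp
  · exact (continuous_cis.comp (by fun_prop)).continuousOn

lemma kS_hasDerivAt {c : ℝ → ℝ} (hc : IsCutoff c (1/8) (3/2)) (j : ℕ) (μ : ℝ) {r : ℝ} (hr : 0 < r) :
    HasDerivAt (kS c j μ) (-(j : ℂ) * kS c (j + 1) μ r + 2 * r * (kS (deriv c) (j + 1) μ r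
      - ((j : ℂ) + 1) * kS c (j + 2) μ r)) r := by
  have hcc := hc.1.continuous
  have hcd := hc.deriv.1.continuous
  set g : (ℝ → ℝ) → ℕ → ℝ → ℝ → ℂ := fun c j r S => ((S + r : ℝ) : ℂ) *
      ((c S * ((S + r) ^ (j + 1))⁻¹ : ℝ) : ℂ) * cis (μ * ((S - r) ^ 2 * (S + 2 * r) / 3)) with hg
  set f' : ℝ → ℝ → ℂ := fun r S => -(j : ℂ) * g c (j + 1) r S +
      Complex.I * μ * ((-2 * r * (S - r) : ℝ) : ℂ) * g c j r S with hf'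
  set G' : ℝ → ℂ := fun S => g (deriv c) (j + 1) r S - ((j : ℂ) + 1) * g c (j + 2) r S +
      Complex.I * μ * ((S - r : ℝ) : ℂ) * g c j r S with hG'
  have hcont2 : ∀ (c : ℝ → ℝ), Continuous c → ∀ j, ContinuousOn (fun p : ℝ × ℝ => g c j p.1 p.2)
      {p | p.2 + p.1 ≠ 0} := fun c hc j => continuousOn_kS_integrand hc j μ
  have hcont1 : ∀ (c : ℝ → ℝ), Continuous c → ∀ j, ∀ r > 0, ContinuousOn (g c j r) (Set.Icc (1/8) (3/2)) := by
    intro c hc j r hr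
    refine (hcont2 c hc j).comp (f := fun S => (r, S)) (by fun_prop) ?_
    intro S hS
    have : 0 < S + r := by have := hS.1; linarith
    exact this.ne'
  have hf'c2 : ContinuousOn (fun p : ℝ × ℝ => f' p.1 p.2) {p | p.2 + p.1 ≠ 0} := by
    simp only [hf']
    exact (continuousOn_const.mul (hcont2 c hcc _)).add
      ((by fun_prop : ContinuousOn _ _).mul (hcont2 c hcc _))
  have hf'c1 : ∀ r > 0, ContinuousOn (f' r) (Set.Icc (1/8) (3/2)) := by
    intro r hr
    refine hf'c2.comp (f := fun S => (r, S)) (by fun_prop) ?_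
    intro S hS
    have : 0 < S + r := by have := hS.1; linarith
    exact this.ne'
  obtain ⟨M, hM⟩ := (isCompact_Icc.prod isCompact_Icc).exists_bound_of_continuousOn
    (hf'c2.mono (t := Set.Icc (r / 2) (2 * r) ×ˢ Set.Icc (1/8 : ℝ) (3/2)) (by
      rintro ⟨p, q⟩ ⟨hp, hq⟩
      have : 0 < q + p := by have := hq.1; have := hp.1; simp only at *; linarith
      exact this.ne'))
  have hball : ∀ x ∈ Metric.ball r (r / 2), x ∈ Set.Icc (r / 2) (2 * r) := by
    intro x hx
    rw [Metric.mem_ball, Real.dist_eq, abs_lt] at hx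
    constructor <;> linarith [hx.1, hx.2]
  have main : HasDerivAt (kS c j μ) (∫ S in (1/8 : ℝ)..(3/2), f' r S) r := by
    refine hasDerivAt_integral_param (f := g c j) (δ := r / 2) (M := M) (by norm_num) (by linarith)
      ?_ ?_ ?_ (hf'c1 r hr)
    · intro x hx
      exact hcont1 c hcc j x (by linarith [(hball x hx).1])
    · intro x hx S hS
      have hxp : 0 < x := by linarith [(hball x hx).1]
      have hSx : S + x ≠ 0 := by linarith [hS.1]
      have h1 := ((hasDerivAt_id x).const_add S).ofReal_comp
      have h2 := ((((hasDerivAt_id x).const_add S).pow (j + 1)).inv (pow_ne_zero _ hSx)).const_mul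
        (c S) |>.ofReal_comp
      have h3 : HasDerivAt (fun x => μ * ((S - x) ^ 2 * (S + 2 * x) / 3)) (μ * (-2 * x * (S - x))) x := by
        have := (((((hasDerivAt_id x).const_sub S).pow 2).mul
          (((hasDerivAt_id x).const_mul 2).const_add S)).div_const 3).const_mul μ
        refine this.congr_deriv ?_
        simp only [id, Pi.pow_apply]; push_cast; ring
      have := (h1.mul h2).mul (hasDerivAt_cis h3)
      refine this.congr_deriv ?_
      have hSxC : (S : ℂ) + x ≠ 0 := by exact_mod_cast hSx
      simp only [hf', hg, Pi.mul_apply, Pi.inv_apply, Pi.pow_apply, id]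
      push_cast
      field_simp
      ring
    · intro x hx S hS
      exact hM (x, S) ⟨hball x hx, hS⟩
  refine main.congr_deriv ?_
  have hG : ∫ S in (1/8 : ℝ)..(3/2), G' S = 0 := by
    have hG1 : ContinuousOn G' (Set.Icc (1/8) (3/2)) := by
      simp only [hG']
      exact ((hcont1 _ hcd _ r hr).sub (continuousOn_const.mul (hcont1 c hcc _ r hr))).add
        ((by fun_prop : ContinuousOn _ _).mul (hcont1 c hcc _ r hr))
    have := intervalIntegral.integral_eq_sub_of_hasDerivAt (a := 1/8) (b := 3/2) (f' := G')
      (f := fun S => ((c S * ((S + r) ^ (j + 1))⁻¹ : ℝ) : ℂ) *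
        cis (μ * ((S - r) ^ 2 * (S + 2 * r) / 3))) ?_ (hG1.intervalIntegrable_of_Icc (by norm_num))
    · rw [this]
      simp [hc.2 (3/2) (by simp), hc.2 (1/8) (by simp), -one_div]
    · intro S hS
      rw [Set.uIcc_of_le (by norm_num)] at hS
      have hSx : S + r ≠ 0 := by linarith [hS.1]
      have h2 := ((hc.hasDerivAt S).mul ((((hasDerivAt_id S).add_const r).pow (j + 1)).inv
        (pow_ne_zero _ hSx))).ofReal_comp
      have h3 : HasDerivAt (fun S => μ * ((S - r) ^ 2 * (S + 2 * r) / 3)) (μ * ((S + r) * (S - r))) S := by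
        have := (((((hasDerivAt_id S).sub_const r).pow 2).mul
          (((hasDerivAt_id S).add_const (2 * r)))).div_const 3).const_mul μ
        refine this.congr_deriv ?_
        simp only [id, Pi.pow_apply]; push_cast; ring
      refine (h2.mul (hasDerivAt_cis h3)).congr_deriv ?_
      have hSxC : (S : ℂ) + r ≠ 0 := by exact_mod_cast hSx
      simp only [hG', hg, Pi.mul_apply, Pi.inv_apply, Pi.pow_apply, id]
      push_cast
      field_simp
      ring
  have hi : ∀ c, Continuous c → ∀ j, IntervalIntegrable (g c j r) volume (1/8) (3/2) :=
    fun c hc j => (hcont1 c hc j r hr).intervalIntegrable_of_Icc (by norm_num)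
  have hGi : IntervalIntegrable G' volume (1/8) (3/2) := by
    have hG1 : ContinuousOn G' (Set.Icc (1/8) (3/2)) := by
      simp only [hG']
      exact ((hcont1 _ hcd _ r hr).sub (continuousOn_const.mul (hcont1 c hcc _ r hr))).add
        ((by fun_prop : ContinuousOn _ _).mul (hcont1 c hcc _ r hr))
    exact hG1.intervalIntegrable_of_Icc (by norm_num)
  have e : ∀ S, f' r S = -(j : ℂ) * g c (j + 1) r S + 2 * r * (g (deriv c) (j + 1) r S
      - ((j : ℂ) + 1) * g c (j + 2) r S) - 2 * r * G' S := by
    intro S; simp only [hf', hG']; push_cast; ring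
  simp_rw [e]
  rw [intervalIntegral.integral_sub, intervalIntegral.integral_add,
    intervalIntegral.integral_const_mul, intervalIntegral.integral_const_mul,
    intervalIntegral.integral_sub, intervalIntegral.integral_const_mul,
    intervalIntegral.integral_const_mul, hG]
  · simp only [kS, hg, mul_zero, sub_zero]
  · exact hi _ hcd _
  · exact (hi _ hcc _).const_mul _
  · exact (hi _ hcc _).const_mul _
  · exact ((hi _ hcd _).sub ((hi _ hcc _).const_mul _)).const_mul _
  · exact ((hi _ hcc _).const_mul _).add (((hi _ hcd _).sub ((hi _ hcc _).const_mul _)).const_mul _)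
  · exact hGi.const_mul _

/-- Families that are `O(μ^{-1/2})` uniformly on a set. -/
def IsSqrtSmall (s : Set ℝ) (f : ℝ → ℝ → ℂ) : Prop :=
  ∃ C, 0 ≤ C ∧ ∀ μ r : ℝ, 0 < μ → r ∈ s → ‖f μ r‖ ≤ C / Real.sqrt μ

lemma IsSqrtSmall.add {s : Set ℝ} {f g : ℝ → ℝ → ℂ} (hf : IsSqrtSmall s f) (hg : IsSqrtSmall s g) :
    IsSqrtSmall s (fun μ r => f μ r + g μ r) := by
  obtain ⟨C, hC, h⟩ := hf
  obtain ⟨D, hD, k⟩ := hg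
  refine ⟨C + D, by positivity, fun μ r hμ hr => ?_⟩
  rw [add_div]
  exact (norm_add_le _ _).trans (add_le_add (h μ r hμ hr) (k μ r hμ hr))

lemma IsSqrtSmall.mul {s : Set ℝ} {f : ℝ → ℝ → ℂ} (hf : IsSqrtSmall s f) (b : ℝ → ℂ) (B : ℝ)
    (hb : ∀ r ∈ s, ‖b r‖ ≤ B) : IsSqrtSmall s (fun μ r => b r * f μ r) := by
  obtain ⟨C, hC, h⟩ := hf
  refine ⟨|B| * C, by positivity, fun μ r hμ hr => ?_⟩
  rw [norm_mul, mul_div_assoc]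
  exact mul_le_mul ((hb r hr).trans (le_abs_self B)) (h μ r hμ hr) (norm_nonneg _) (abs_nonneg _)

lemma IsSqrtSmall.congr {s : Set ℝ} {f g : ℝ → ℝ → ℂ} (hf : IsSqrtSmall s f)
    (h : ∀ μ r, g μ r = f μ r) : IsSqrtSmall s g := by
  have : g = f := by funext μ r; exact h μ r
  rwa [this]

lemma kS_derivs {c : ℝ → ℝ} (hc : IsCutoff c (1/8) (3/2)) :
    ∃ K1 K2 : ℝ → ℝ → ℂ, (∀ μ r : ℝ, 0 < r → HasDerivAt (kS c 0 μ) (K1 μ r) r ∧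
      HasDerivAt (K1 μ) (K2 μ r) r) ∧ IsSqrtSmall (Set.Icc (2/5) (3/2)) (kS c 0) ∧
      IsSqrtSmall (Set.Icc (2/5) (3/2)) K1 ∧ IsSqrtSmall (Set.Icc (2/5) (3/2)) K2 := by
  have hc' := hc.deriv
  have hb : ∀ {c : ℝ → ℝ}, IsCutoff c (1/8) (3/2) → ∀ j, IsSqrtSmall (Set.Icc (2/5) (3/2)) (kS c j) :=
    fun hc j => kS_bound hc j
  have h2r : ∀ r ∈ Set.Icc (2/5 : ℝ) (3/2), ‖(2 * r : ℂ)‖ ≤ 3 := by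
    intro r hr
    rw [norm_mul, Complex.norm_real, Complex.norm_ofNat, Real.norm_eq_abs, abs_of_nonneg] <;>
      linarith [hr.1, hr.2]
  have hconst : ∀ z : ℂ, ∀ r ∈ Set.Icc (2/5 : ℝ) (3/2), ‖z‖ ≤ ‖z‖ := fun z r _ => le_rfl
  set K1 : ℝ → ℝ → ℂ := fun μ r => 2 * r * (kS (deriv c) 1 μ r + (-1) * kS c 2 μ r) with hK1
  set dA : ℝ → ℝ → ℂ := fun μ r => (-1) * kS (deriv c) 2 μ r + 2 * r * (kS (deriv (deriv c)) 2 μ r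
      + (-2) * kS (deriv c) 3 μ r) with hdA
  set dB : ℝ → ℝ → ℂ := fun μ r => (-2) * kS c 3 μ r + 2 * r * (kS (deriv c) 3 μ r
      + (-3) * kS c 4 μ r) with hdB
  refine ⟨K1, fun μ r => 2 * (kS (deriv c) 1 μ r + (-1) * kS c 2 μ r) +
    2 * r * (dA μ r + (-1) * dB μ r), ?_, hb hc 0, ?_, ?_⟩
  · intro μ r hr
    constructor
    · refine (kS_hasDerivAt hc 0 μ hr).congr_deriv ?_
      simp only [hK1]; push_cast; ring
    · have h1 := kS_hasDerivAt hc' 1 μ hr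
      have h2 := kS_hasDerivAt hc 2 μ hr
      have h3 := ((hasDerivAt_id r).ofReal_comp.const_mul 2).mul (h1.add (h2.const_mul (-1)))
      refine h3.congr_deriv ?_
      simp only [hdA, hdB, id, Pi.add_apply]; push_cast; ring
  · exact ((hb hc' 1).add ((hb hc 2).mul _ _ (hconst (-1)))).mul _ _ h2r
  · refine IsSqrtSmall.add (((hb hc' 1).add ((hb hc 2).mul _ _ (hconst (-1)))).mul _ _ (hconst 2)) ?_
    refine (IsSqrtSmall.add ?_ (IsSqrtSmall.mul ?_ _ _ (hconst (-1)))).mul _ _ h2r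
    · exact ((hb hc' 2).mul _ _ (hconst (-1))).add
        (((hb hc'.deriv 2).add ((hb hc' 3).mul _ _ (hconst (-2)))).mul _ _ h2r)
    · exact ((hb hc 3).mul _ _ (hconst (-2))).add
        (((hb hc' 3).add ((hb hc 4).mul _ _ (hconst (-3)))).mul _ _ h2r)

/-- The `S`-integral localized near the positive critical point. -/
theorem S_step {c ψ : ℝ → ℝ} (hc : IsCutoff c (1/8) (3/2)) (hψ : IsCutoff ψ (1/2) (3/2)) :
    ∃ C, 0 ≤ C ∧ ∀ μ α : ℝ, 0 < μ → α ∈ Set.Icc (0:ℝ) (1/4) → ∃ F F' F'' : ℝ → ℂ,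
      (∀ A ∈ Set.Icc (9/20 : ℝ) 2, HasDerivAt F (F' A) A ∧ HasDerivAt F' (F'' A) A ∧
        ‖F A‖ ≤ C / Real.sqrt μ ∧ ‖F' A‖ ≤ C / Real.sqrt μ ∧ ‖F'' A‖ ≤ C / Real.sqrt μ) ∧
      (∀ A, A ∉ Set.Ioo (1/2 : ℝ) (3/2) → F A = 0) ∧
      ∀ A ∈ Set.Icc (9/20 : ℝ) 2, (ψ A : ℂ) *
        (∫ S in (1/8 : ℝ)..(3/2), (c S : ℂ) * cis (μ * (S ^ 3 / 3 - S * (A - α)))) =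
        cis (μ * (-(2/3 * ((A - α) * Real.sqrt (A - α))))) * F A := by
  obtain ⟨K1, K2, hK, ⟨C0, hC0, h0⟩, ⟨C1, hC1, h1⟩, ⟨C2, hC2, h2⟩⟩ := kS_derivs hc
  obtain ⟨P0, hP0, p0⟩ := hψ.bounded
  obtain ⟨P1, hP1, p1⟩ := hψ.deriv.bounded
  obtain ⟨P2, hP2, p2⟩ := hψ.deriv.deriv.bounded
  set C := (P0 + P1 + P2) * (C0 + 2 * C1 + 2 * C2 + 8 * C1) * 2 with hC
  refine ⟨C, by positivity, fun μ α hμ hα => ?_⟩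
  set s : ℝ → ℝ := fun A => Real.sqrt (A - α) with hs
  set D1 : ℝ → ℂ := fun A => K1 μ (s A) * ((1 / (2 * s A) : ℝ) : ℂ) with hD1
  set D2 : ℝ → ℂ := fun A => K2 μ (s A) * ((1 / (2 * s A) ^ 2 : ℝ) : ℂ)
    - K1 μ (s A) * ((1 / (4 * s A ^ 3) : ℝ) : ℂ) with hD2
  have hsq : 0 < Real.sqrt μ := Real.sqrt_pos.2 hμ
  have hsA : ∀ A ∈ Set.Icc (9/20 : ℝ) 2, s A ∈ Set.Icc (2/5 : ℝ) (3/2) := by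
    intro A hA
    constructor
    · apply Real.le_sqrt_of_sq_le; norm_num; linarith [hA.1, hα.2]
    · apply Real.sqrt_le_iff.2; constructor; norm_num; norm_num; linarith [hA.2, hα.1]
  have hsd : ∀ A ∈ Set.Icc (9/20 : ℝ) 2, HasDerivAt s (1 / (2 * s A)) A := by
    intro A hA
    have : A - α ≠ 0 := by linarith [hA.1, hα.2]
    simpa using ((hasDerivAt_id A).sub_const α).sqrt this
  have hk1 : ∀ A ∈ Set.Icc (9/20 : ℝ) 2, HasDerivAt (fun A => kS c 0 μ (s A)) (D1 A) A := by
    intro A hA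
    have hs0 : 0 < s A := by linarith [(hsA A hA).1]
    refine ((hK μ (s A) hs0).1.scomp A (hsd A hA)).congr_deriv ?_
    simp only [hD1, Complex.real_smul]; ring
  have hk2 : ∀ A ∈ Set.Icc (9/20 : ℝ) 2, HasDerivAt D1 (D2 A) A := by
    intro A hA
    have hs0 : 0 < s A := by linarith [(hsA A hA).1]
    have e1 := (hK μ (s A) hs0).2.scomp A (hsd A hA)
    have e2 := (((hsd A hA).const_mul 2).inv (by positivity)).ofReal_comp
    have e3 := e1.mul e2
    have hs0' : (s A : ℂ) ≠ 0 := by exact_mod_cast hs0.ne'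
    have : D1 = fun A => (K1 μ ∘ s) A * (((fun y => (2 * s y)) ⁻¹) A : ℝ) := by
      funext y; simp only [hD1, Function.comp, Pi.inv_apply, one_div]
    rw [this]
    refine e3.congr_deriv ?_
    simp only [hD2, Complex.real_smul, Function.comp, Pi.inv_apply]; push_cast
    field_simp
    ring
  have b0 : ∀ A ∈ Set.Icc (9/20 : ℝ) 2, ‖kS c 0 μ (s A)‖ ≤ C0 / Real.sqrt μ :=
    fun A hA => h0 μ _ hμ (hsA A hA)
  have hinv : ∀ A ∈ Set.Icc (9/20 : ℝ) 2, ‖((1 / (2 * s A) : ℝ) : ℂ)‖ ≤ 2 ∧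
      ‖((1 / (2 * s A) ^ 2 : ℝ) : ℂ)‖ ≤ 2 ∧ ‖((1 / (4 * s A ^ 3) : ℝ) : ℂ)‖ ≤ 4 := by
    intro A hA
    have h := (hsA A hA).1
    have hs0 : 0 < s A := by linarith
    simp only [Complex.norm_real, Real.norm_eq_abs]
    rw [abs_of_pos (by positivity), abs_of_pos (by positivity), abs_of_pos (by positivity)]
    refine ⟨?_, ?_, ?_⟩
    · rw [div_le_iff₀ (by positivity)]; linarith
    · rw [div_le_iff₀ (by positivity)]; nlinarith
    · rw [div_le_iff₀ (by positivity)]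
      have : (2/5 : ℝ) ^ 3 ≤ s A ^ 3 := by gcongr
      norm_num at this; linarith
  have b1 : ∀ A ∈ Set.Icc (9/20 : ℝ) 2, ‖D1 A‖ ≤ 2 * C1 / Real.sqrt μ := by
    intro A hA
    rw [hD1, norm_mul, mul_comm 2 C1, mul_div_right_comm]
    exact mul_le_mul (h1 μ _ hμ (hsA A hA)) (hinv A hA).1 (norm_nonneg _) (by positivity)
  have b2 : ∀ A ∈ Set.Icc (9/20 : ℝ) 2, ‖D2 A‖ ≤ (2 * C2 + 4 * C1) / Real.sqrt μ := by
    intro A hA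
    rw [hD2, add_div, mul_comm 2 C2, mul_comm 4 C1, mul_div_right_comm, mul_div_right_comm]
    refine (norm_sub_le _ _).trans ?_
    rw [norm_mul, norm_mul]
    exact add_le_add (mul_le_mul (h2 μ _ hμ (hsA A hA)) (hinv A hA).2.1 (norm_nonneg _) (by positivity))
      (mul_le_mul (h1 μ _ hμ (hsA A hA)) (hinv A hA).2.2 (norm_nonneg _) (by positivity))
  refine ⟨fun A => ψ A * kS c 0 μ (s A), fun A => (deriv ψ A : ℝ) * kS c 0 μ (s A) + ψ A * D1 A,
    fun A => (deriv (deriv ψ) A : ℝ) * kS c 0 μ (s A) + (deriv ψ A : ℝ) * D1 A +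
      ((deriv ψ A : ℝ) * D1 A + ψ A * D2 A), ?_, ?_, ?_⟩
  · intro A hA
    have nP0 : ‖(ψ A : ℂ)‖ ≤ P0 := by rw [Complex.norm_real]; exact p0 A
    have nP1 : ‖((deriv ψ A : ℝ) : ℂ)‖ ≤ P1 := by rw [Complex.norm_real]; exact p1 A
    have nP2 : ‖((deriv (deriv ψ) A : ℝ) : ℂ)‖ ≤ P2 := by rw [Complex.norm_real]; exact p2 A
    have mb : ∀ {x y : ℂ} {p q : ℝ}, 0 ≤ p → ‖x‖ ≤ p → ‖y‖ ≤ q / Real.sqrt μ → ‖x * y‖ ≤ p * q / Real.sqrt μ := by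
      intro x y p q hp hx hy
      rw [norm_mul, mul_div_assoc]
      exact mul_le_mul hx hy (norm_nonneg _) hp
    refine ⟨(hψ.hasDerivAt A).ofReal_comp.mul (hk1 A hA), ?_, ?_, ?_, ?_⟩
    · exact ((hψ.deriv.hasDerivAt A).ofReal_comp.mul (hk1 A hA)).add
        ((hψ.hasDerivAt A).ofReal_comp.mul (hk2 A hA))
    · refine (mb hP0 nP0 (b0 A hA)).trans ?_
      gcongr
      rw [hC]; nlinarith [mul_nonneg hP0 hC0, mul_nonneg hP0 hC1, mul_nonneg hP0 hC2,
        mul_nonneg hP1 hC0, mul_nonneg hP1 hC1, mul_nonneg hP1 hC2,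
        mul_nonneg hP2 hC0, mul_nonneg hP2 hC1, mul_nonneg hP2 hC2]
    · refine (norm_add_le _ _).trans ((add_le_add (mb hP1 nP1 (b0 A hA)) (mb hP0 nP0 (b1 A hA))).trans ?_)
      rw [← add_div]
      gcongr
      rw [hC]; nlinarith [mul_nonneg hP0 hC0, mul_nonneg hP0 hC1, mul_nonneg hP0 hC2,
        mul_nonneg hP1 hC0, mul_nonneg hP1 hC1, mul_nonneg hP1 hC2,
        mul_nonneg hP2 hC0, mul_nonneg hP2 hC1, mul_nonneg hP2 hC2]
    · refine (norm_add_le _ _).trans ((add_le_add ((norm_add_le _ _).trans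
        (add_le_add (mb hP2 nP2 (b0 A hA)) (mb hP1 nP1 (b1 A hA)))) ((norm_add_le _ _).trans
        (add_le_add (mb hP1 nP1 (b1 A hA)) (mb hP0 nP0 (b2 A hA))))).trans ?_)
      rw [← add_div, ← add_div, ← add_div]
      gcongr
      rw [hC]; nlinarith [mul_nonneg hP0 hC0, mul_nonneg hP0 hC1, mul_nonneg hP0 hC2,
        mul_nonneg hP1 hC0, mul_nonneg hP1 hC1, mul_nonneg hP1 hC2,
        mul_nonneg hP2 hC0, mul_nonneg hP2 hC1, mul_nonneg hP2 hC2]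
  · intro A hA; simp [hψ.2 A hA]
  · intro A hA
    have hs0 : 0 < s A := by linarith [(hsA A hA).1]
    have hs2 : s A ^ 2 = A - α := Real.sq_sqrt (by linarith [hA.1, hα.2])
    rw [mul_left_comm]
    congr 1
    rw [kS, ← intervalIntegral.integral_const_mul]
    apply intervalIntegral.integral_congr
    intro S hS
    rw [Set.uIcc_of_le (by norm_num)] at hS
    have hS0 : S + s A ≠ 0 := by linarith [hS.1]
    have e1 : μ * (S ^ 3 / 3 - S * (A - α)) = μ * (-(2/3 * ((A - α) * Real.sqrt (A - α)))) +
        μ * ((S - s A) ^ 2 * (S + 2 * s A) / 3) := by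
      rw [show Real.sqrt (A - α) = s A from rfl, ← hs2]; ring
    have hS0' : (S : ℂ) + s A ≠ 0 := by exact_mod_cast hS0
    simp only [e1, cis_add]
    push_cast
    field_simp

lemma exists_slope {a b : ℝ} {f f' : ℝ → ℝ} (hf : ∀ x ∈ Set.Icc a b, HasDerivAt f (f' x) x)
    {x y : ℝ} (hx : x ∈ Set.Icc a b) (hy : y ∈ Set.Icc a b) :
    ∃ c ∈ Set.Icc a b, |c - y| ≤ |x - y| ∧ f y - f x = f' c * (y - x) := by
  have key : ∀ x y : ℝ, x ∈ Set.Icc a b → y ∈ Set.Icc a b → x < y →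
      ∃ c ∈ Set.Ioo x y, f y - f x = f' c * (y - x) := by
    intro x y hx hy hxy
    have hs : Set.Icc x y ⊆ Set.Icc a b := Set.Icc_subset_Icc hx.1 hy.2
    obtain ⟨c, hc, h⟩ := exists_hasDerivAt_eq_slope f f' hxy
      (fun z hz => (hf z (hs hz)).continuousAt.continuousWithinAt)
      (fun z hz => hf z (hs (Set.Ioo_subset_Icc_self hz)))
    refine ⟨c, hc, ?_⟩
    rw [h]; field_simp [(sub_pos.2 hxy).ne']
  rcases lt_trichotomy x y with h | h | h
  · obtain ⟨c, hc, e⟩ := key x y hx hy h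
    refine ⟨c, ⟨hx.1.trans hc.1.le, hc.2.le.trans hy.2⟩, ?_, e⟩
    rw [abs_of_neg (by linarith [hc.2]), abs_of_neg (by linarith)]; linarith [hc.1]
  · subst h; exact ⟨x, hx, by simp, by simp⟩
  · obtain ⟨c, hc, e⟩ := key y x hy hx h
    refine ⟨c, ⟨hy.1.trans hc.1.le, hc.2.le.trans hx.2⟩, ?_, by linear_combination -e⟩
    rw [abs_of_pos (by linarith [hc.1]), abs_of_pos (by linarith)]; linarith [hc.2]

/-- A function on an interval with derivative of constant sign `s`, bounded below, together with a
primitive and bounds on its derivatives. -/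
structure IsGoodSlope (a b s m B : ℝ) (V₁ V V' V'' : ℝ → ℝ) : Prop where
  hm : 0 < m
  hs : s ^ 2 = 1
  d0 : ∀ x ∈ Set.Icc a b, HasDerivAt V₁ (V x) x
  d1 : ∀ x ∈ Set.Icc a b, HasDerivAt V (V' x) x
  d2 : ∀ x ∈ Set.Icc a b, HasDerivAt V' (V'' x) x
  lower : ∀ x ∈ Set.Icc a b, m ≤ s * V' x
  b1 : ∀ x ∈ Set.Icc a b, |V' x| ≤ B
  b2 : ∀ x ∈ Set.Icc a b, |V'' x| ≤ B

/-- The Bregman divergence of `V₁`. -/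
def bregman (V₁ V : ℝ → ℝ) (x y : ℝ) : ℝ := V₁ y - V₁ x - (y - x) * V x

namespace IsGoodSlope
variable {a b s m B : ℝ} {V₁ V V' V'' : ℝ → ℝ}

lemma abs_s (h : IsGoodSlope a b s m B V₁ V V' V'') : |s| = 1 := by
  have := h.hs
  rw [← sq_abs] at this
  nlinarith [abs_nonneg s]

lemma le_abs (h : IsGoodSlope a b s m B V₁ V V' V'') {x : ℝ} (hx : x ∈ Set.Icc a b) :
    m ≤ |V' x| := by
  have := (h.lower x hx).trans (le_abs_self _)
  rwa [abs_mul, h.abs_s, one_mul] at this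

lemma B_nonneg (h : IsGoodSlope a b s m B V₁ V V' V'') {x : ℝ} (hx : x ∈ Set.Icc a b) : 0 ≤ B :=
  (abs_nonneg _).trans (h.b1 x hx)

lemma sub_lower (h : IsGoodSlope a b s m B V₁ V V' V'') {x y : ℝ} (hx : x ∈ Set.Icc a b)
    (hy : y ∈ Set.Icc a b) : m * |y - x| ≤ |V y - V x| := by
  obtain ⟨c, hc, -, e⟩ := exists_slope h.d1 hx hy
  rw [e, abs_mul]
  exact mul_le_mul_of_nonneg_right (h.le_abs hc) (abs_nonneg _)

lemma taylor (h : IsGoodSlope a b s m B V₁ V V' V'') {x y : ℝ} (hx : x ∈ Set.Icc a b)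
    (hy : y ∈ Set.Icc a b) : |V y - V x - (y - x) * V' y| ≤ B * |y - x| ^ 2 := by
  obtain ⟨c, hc, hcy, e⟩ := exists_slope h.d1 hx hy
  obtain ⟨d, hd, -, e'⟩ := exists_slope h.d2 hc hy
  have : V y - V x - (y - x) * V' y = -(V'' d * (y - c)) * (y - x) := by
    rw [e, ← e']; ring
  rw [this, abs_mul, abs_neg, abs_mul, abs_sub_comm y c]
  rw [abs_sub_comm x y] at hcy
  calc _ ≤ B * |y - x| * |y - x| := by
        gcongr
        · exact h.B_nonneg hx
        · exact h.b2 d hd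
    _ = _ := by ring

lemma hasDerivAt_bregman (h : IsGoodSlope a b s m B V₁ V V' V'') (x : ℝ) {y : ℝ}
    (hy : y ∈ Set.Icc a b) : HasDerivAt (bregman V₁ V x) (V y - V x) y := by
  have := ((h.d0 y hy).sub_const (V₁ x)).sub (((hasDerivAt_id y).sub_const x).mul_const (V x))
  refine this.congr_deriv (by ring)

lemma hasDerivAt_bregman_left (h : IsGoodSlope a b s m B V₁ V V' V'') {x : ℝ} (y : ℝ)
    (hx : x ∈ Set.Icc a b) : HasDerivAt (fun x => bregman V₁ V x y) (-((y - x) * V' x)) x := by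
  have := ((h.d0 x hx).const_sub (V₁ y)).sub (((hasDerivAt_id x).const_sub y).mul (h.d1 x hx))
  refine this.congr_deriv ?_
  simp only [id]; ring

lemma continuousOn_cis (h : IsGoodSlope a b s m B V₁ V V' V'') (μ x : ℝ) :
    ContinuousOn (fun y => cis (μ * bregman V₁ V x y)) (Set.Icc a b) := fun _ hy =>
  (hasDerivAt_cis ((h.hasDerivAt_bregman x hy).const_mul μ)).continuousAt.continuousWithinAt

end IsGoodSlope

/-- The reduced amplitude after the `A`-integration. -/
noncomputable def kA (a b : ℝ) (V₁ V : ℝ → ℝ) (F : ℝ → ℂ) (μ x : ℝ) : ℂ :=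
  ∫ y in a..b, F y * cis (μ * bregman V₁ V x y)

/-- Its first moment. -/
noncomputable def kA' (a b : ℝ) (V₁ V : ℝ → ℝ) (F : ℝ → ℂ) (μ x : ℝ) : ℂ :=
  ∫ y in a..b, F y * (Complex.I * μ * ((y - x : ℝ) : ℂ)) * cis (μ * bregman V₁ V x y)

lemma kA_bound {a b s m B : ℝ} {V₁ V V' V'' : ℝ → ℝ} (h : IsGoodSlope a b s m B V₁ V V' V'')
    (hab : a < b) {F F' : ℝ → ℂ} {K μ x : ℝ} (hμ : 0 < μ)
    (hF : ∀ y ∈ Set.Icc a b, HasDerivAt F (F' y) y)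
    (hK : ∀ y ∈ Set.Icc a b, ‖F y‖ ≤ K) (hK' : ∀ y ∈ Set.Icc a b, ‖F' y‖ ≤ K)
    (hx : x ∈ Set.Icc a b) :
    ‖kA a b V₁ V F μ x‖ ≤ K * (3 * Real.pi + (b - a) / 2 + 1) / Real.sqrt (μ * m) := by
  have hI := fun y (hy : y ∈ Set.Ioo a b) => Set.Ioo_subset_Icc_self hy
  have hs1 := h.abs_s
  have hssC : (s : ℂ) * s = 1 := by exact_mod_cast (sq s ▸ h.hs)
  have hK0 : 0 ≤ K := (norm_nonneg _).trans (hK x hx)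
  have e : kA a b V₁ V F μ x = ∫ y in a..b, ((s : ℝ) : ℂ) * (s * F y) * cis (μ * bregman V₁ V x y) := by
    unfold kA; congr 1; funext y; rw [← mul_assoc, hssC, one_mul]
  rw [e]
  have hFc : ContinuousOn F (Set.Icc a b) := fun y hy => (hF y hy).continuousAt.continuousWithinAt
  have := van_der_corput_integral hab (μ := μ) (τ := m) (K := K) (M := 1) (w := fun y => s * F y)
    (w' := fun y => s * F' y) (P := bregman V₁ V x) (R := fun y => s * (V y - V x))
    (R' := fun y => s * V' y) (v := fun _ => s) hμ h.hm hK0 zero_le_one ?_ ?_ ?_ ?_ ?_ ?_ ?_ ?_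
  · norm_num at this ⊢; exact this
  · exact (continuousOn_const.mul (continuousOn_const.mul hFc)).mul (h.continuousOn_cis μ x)
  · intro y hy
    refine (h.hasDerivAt_bregman x (hI y hy)).congr_deriv ?_
    rw [← mul_assoc, ← sq, h.hs, one_mul]
  · intro y hy; exact (hF y (hI y hy)).const_mul _
  · intro y hy; exact ((h.d1 y (hI y hy)).sub_const _).const_mul _
  · intro y hy; exact h.lower y (hI y hy)
  · intro y hy
    rw [norm_mul, Complex.norm_real, Real.norm_eq_abs, hs1, one_mul]; exact hK y (hI y hy)
  · intro y hy; exact hs1.le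
  · intro y hy
    rw [norm_mul, Complex.norm_real, Real.norm_eq_abs, hs1, one_mul]
    have := h.hm
    exact mul_le_mul (hK' y (hI y hy)) (by linarith) (abs_nonneg _) hK0

lemma kA_hasDerivAt {a b s m B : ℝ} {V₁ V V' V'' : ℝ → ℝ} (h : IsGoodSlope a b s m B V₁ V V' V'')
    {F : ℝ → ℂ} {K μ x : ℝ} (hFc : ContinuousOn F (Set.Icc a b))
    (hK : ∀ y ∈ Set.Icc a b, ‖F y‖ ≤ K) (hx : x ∈ Set.Ioo a b) :
    HasDerivAt (kA a b V₁ V F μ) (-(V' x : ℂ) * kA' a b V₁ V F μ x) x := by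
  have hab : a ≤ b := (hx.1.trans hx.2).le
  have hI := fun y (hy : y ∈ Set.Ioo a b) => Set.Ioo_subset_Icc_self hy
  have hK0 : 0 ≤ K := (norm_nonneg _).trans (hK x (hI x hx))
  have hB := h.B_nonneg (hI x hx)
  obtain ⟨δ, hδ, hball⟩ := Metric.isOpen_iff.1 isOpen_Ioo x hx
  have := hasDerivAt_integral_param (a := a) (b := b) (x₀ := x) (δ := δ)
    (M := K * (|μ| * ((b - a) * B)))
    (f := fun x y => F y * cis (μ * bregman V₁ V x y))
    (f' := fun x y => F y * (Complex.I * ((μ * -((y - x) * V' x) : ℝ) : ℂ) * cis (μ * bregman V₁ V x y)))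
    hab hδ ?_ ?_ ?_ ?_
  · refine this.congr_deriv ?_
    rw [kA', ← intervalIntegral.integral_const_mul]
    congr 1; funext y; push_cast; ring
  · intro z hz; exact hFc.mul (h.continuousOn_cis μ z)
  · intro z hz y hy
    exact (hasDerivAt_cis ((h.hasDerivAt_bregman_left y (hI z (hball hz))).const_mul μ)).const_mul _
  · intro z hz y hy
    have hz := hI z (hball hz)
    simp only [norm_mul, norm_cis, Complex.norm_real, Complex.norm_I, mul_one, one_mul, norm_neg,
      Real.norm_eq_abs]
    gcongr
    · exact hK y hy
    · rw [abs_le]; constructor <;> linarith [hy.1, hy.2, hz.1, hz.2]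
    · exact h.b1 z hz
  · exact hFc.mul ((by fun_prop : ContinuousOn _ _).mul (h.continuousOn_cis μ x))

lemma kA'_bound {a b s m B : ℝ} {V₁ V V' V'' : ℝ → ℝ} (h : IsGoodSlope a b s m B V₁ V V' V'')
    {F F' F'' : ℝ → ℂ} {K μ x : ℝ} (hμ : 0 < μ)
    (hF : ∀ y ∈ Set.Icc a b, HasDerivAt F (F' y) y)
    (hF' : ∀ y ∈ Set.Icc a b, HasDerivAt F' (F'' y) y)
    (hK : ∀ y ∈ Set.Icc a b, ‖F y‖ ≤ K) (hK' : ∀ y ∈ Set.Icc a b, ‖F' y‖ ≤ K)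
    (hK'' : ∀ y ∈ Set.Icc a b, ‖F'' y‖ ≤ K)
    (ha : F a = 0) (hb : F b = 0) (hx : x ∈ Set.Ioo a b) :
    ‖kA' a b V₁ V F μ x‖ ≤ 2 * (K * (1 / m + 2 * B / m ^ 2 + (B / m + 2 * B * B / m ^ 2) / m) *
      (3 * Real.pi + (b - a) / 2 + 1) / Real.sqrt (μ * m)) := by
  have hab : a < b := hx.1.trans hx.2
  have hxI := Set.Ioo_subset_Icc_self hx
  have hK0 : 0 ≤ K := (norm_nonneg _).trans (hK x hxI)
  have hB := h.B_nonneg hxI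
  have hm := h.hm
  have hs1 := h.abs_s
  have hssC : (s : ℂ) * s = 1 := by exact_mod_cast (sq s ▸ h.hs)
  set K₁ := K * (1 / m + 2 * B / m ^ 2 + (B / m + 2 * B * B / m ^ 2) / m) with hK₁
  have hK₁0 : 0 ≤ K₁ := by positivity
  have hFc : ContinuousOn F (Set.Icc a b) := fun y hy => (hF y hy).continuousAt.continuousWithinAt
  have hVc : ContinuousOn V (Set.Icc a b) := fun y hy => (h.d1 y hy).continuousAt.continuousWithinAt
  set p : ℝ → ℝ := fun y => V y - V x with hp
  have hpl : ∀ y ∈ Set.Icc a b, m * |y - x| ≤ |p y| := fun y hy => h.sub_lower hxI hy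
  have hp0 : ∀ y ∈ Set.Icc a b, y ≠ x → p y ≠ 0 := fun y hy hyx =>
    abs_pos.1 ((mul_pos hm (abs_pos.2 (sub_ne_zero.2 hyx))).trans_le (hpl y hy))
  set ds : ℝ → ℝ := dslope V x with hds
  have hds0 : ∀ y ∈ Set.Icc a b, ds y ≠ 0 := by
    intro y hy
    by_cases hyx : y = x
    · rw [hyx, hds, dslope_same, (h.d1 x hxI).deriv]
      exact abs_pos.1 (hm.trans_le (h.le_abs hxI))
    · rw [hds, dslope_of_ne _ hyx, slope_def_field]
      exact div_ne_zero (hp0 y hy hyx) (sub_ne_zero.2 hyx)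
  have hdsc : ContinuousOn ds (Set.Icc a b) :=
    (continuousOn_dslope (Icc_mem_nhds hx.1 hx.2)).2 ⟨hVc, (h.d1 x hxI).differentiableAt⟩
  have hdsp : ∀ y, ds y * (y - x) = p y := by
    intro y
    have := sub_smul_dslope V x y
    simp only [smul_eq_mul] at this
    rw [hds, mul_comm]; exact this
  -- the quotient and its derivatives away from `x`
  set q : ℝ → ℝ := fun y => (ds y)⁻¹ with hq
  set q' : ℝ → ℝ := fun y => (p y - (y - x) * V' y) / p y ^ 2 with hq'
  set q'' : ℝ → ℝ := fun y => -((y - x) * V'' y) / p y ^ 2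
    - 2 * V' y * (p y - (y - x) * V' y) / p y ^ 3 with hq''
  have hqe : ∀ y, y ≠ x → q y = (y - x) / p y := by
    intro y hyx
    simp only [hq, hds]
    rw [dslope_of_ne _ hyx, slope_def_field, inv_div]
  have hqd : ∀ y ∈ Set.Icc a b, y ≠ x → HasDerivAt q (q' y) y := by
    intro y hy hyx
    have h1 : q =ᶠ[nhds y] fun y => (y - x) / p y := by
      filter_upwards [isOpen_ne.mem_nhds hyx] with z hz using hqe z hz
    refine HasDerivAt.congr_of_eventuallyEq ?_ h1
    have := ((hasDerivAt_id y).sub_const x).div ((h.d1 y hy).sub_const (V x)) (hp0 y hy hyx)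
    refine this.congr_deriv ?_
    simp only [hq', hp, id]; ring
  have hqd' : ∀ y ∈ Set.Icc a b, y ≠ x → HasDerivAt q' (q'' y) y := by
    intro y hy hyx
    have hpd := (h.d1 y hy).sub_const (V x)
    have hpy := hp0 y hy hyx
    have := (hpd.sub (((hasDerivAt_id y).sub_const x).mul (h.d2 y hy))).div (hpd.pow 2)
      (pow_ne_zero 2 hpy)
    refine this.congr_deriv ?_
    have hpe : V y - V x = p y := rfl
    simp only [hq'', id, Pi.pow_apply, Pi.sub_apply, Pi.mul_apply, hpe]
    field_simp; push_cast; ring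
  have hqb : ∀ y ∈ Set.Icc a b, y ≠ x → |q y| ≤ 1 / m := by
    intro y hy hyx
    rw [hqe y hyx, abs_div, div_le_div_iff₀ (abs_pos.2 (hp0 y hy hyx)) hm]
    linarith [hpl y hy]
  have hqb' : ∀ y ∈ Set.Icc a b, y ≠ x → |q' y| ≤ B / m ^ 2 := by
    intro y hy hyx
    have hpp := abs_pos.2 (hp0 y hy hyx)
    have ht := h.taylor hxI hy
    rw [hq', abs_div, abs_pow, div_le_div_iff₀ (by positivity) (by positivity)]
    calc _ ≤ B * |y - x| ^ 2 * m ^ 2 := by gcongr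
      _ = B * (m * |y - x|) ^ 2 := by ring
      _ ≤ _ := by gcongr; exact hpl y hy
  have hqb'' : ∀ y ∈ Set.Icc a b, y ≠ x → |q'' y| * |p y| ≤ B / m + 2 * B * B / m ^ 2 := by
    intro y hy hyx
    have hpy := hp0 y hy hyx
    have hpp := abs_pos.2 hpy
    have e : q'' y * p y = -(V'' y * ((y - x) / p y)) - 2 * V' y * q' y := by
      simp only [hq'', hq']; field_simp
    rw [← abs_mul, e]
    have i1 : |V'' y * ((y - x) / p y)| ≤ B / m := by
      rw [abs_mul, ← hqe y hyx, div_eq_mul_one_div B]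
      exact mul_le_mul (h.b2 y hy) (hqb y hy hyx) (abs_nonneg _) hB
    have i2 : |2 * V' y * q' y| ≤ 2 * B * B / m ^ 2 := by
      rw [abs_mul, abs_mul, abs_two, mul_div_assoc]
      exact mul_le_mul (by linarith [h.b1 y hy]) (hqb' y hy hyx) (abs_nonneg _) (by positivity)
    refine (abs_sub _ _).trans ?_
    rw [abs_neg]; exact add_le_add i1 i2
  -- the boundary term
  set W : ℝ → ℂ := fun y => F y * (q y : ℂ) with hW
  set W' : ℝ → ℂ := fun y => F' y * (q y : ℂ) + F y * (q' y : ℂ) with hW'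
  set W'' : ℝ → ℂ := fun y => F'' y * (q y : ℂ) + F' y * (q' y : ℂ) +
    (F' y * (q' y : ℂ) + F y * (q'' y : ℂ)) with hW''
  set g : ℝ → ℂ := fun y => F y * (Complex.I * μ * ((y - x : ℝ) : ℂ)) * cis (μ * bregman V₁ V x y)
    with hg
  have hgc : ContinuousOn g (Set.Icc a b) :=
    (hFc.mul (by fun_prop)).mul (h.continuousOn_cis μ x)
  set H : ℝ → ℂ := fun t => (∫ y in a..t, g y) - W t * cis (μ * bregman V₁ V x t) with hH
  have hHc : ContinuousOn H (Set.Icc a b) := by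
    refine (continuousOn_primitive hab.le hgc).sub (ContinuousOn.mul (hFc.mul ?_) (h.continuousOn_cis μ x))
    exact Complex.continuous_ofReal.comp_continuousOn (hdsc.inv₀ hds0)
  have hHd : ∀ y ∈ Set.Ioo a b, y ≠ x →
      HasDerivAt H ((s : ℝ) * (-(s * W' y)) * cis (μ * bregman V₁ V x y)) y := by
    intro y hy hyx
    have hyI := Set.Ioo_subset_Icc_self hy
    have h1 := (hasDerivAt_primitive hgc hy).sub (((hF y hyI).mul (hqd y hyI hyx).ofReal_comp).mul
      (hasDerivAt_cis ((h.hasDerivAt_bregman x hyI).const_mul μ)))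
    refine h1.congr_deriv ?_
    have hpy : (p y : ℂ) ≠ 0 := by exact_mod_cast hp0 y hyI hyx
    have e1 : (V y - V x : ℝ) = p y := rfl
    have e2 : (q y : ℂ) * p y = y - x := by
      rw [hqe y hyx]; push_cast; field_simp
    simp only [hg, hW', Pi.mul_apply, e1]
    push_cast
    linear_combination (-F y * Complex.I * μ * cis (μ * bregman V₁ V x y)) * e2 +
      (F' y * q y + F y * q' y) * cis (μ * bregman V₁ V x y) * hssC
  have hHab : H b - H a = kA' a b V₁ V F μ x := by
    simp only [hH, hW, ha, hb, intervalIntegral.integral_same, kA', hg]; ring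
  have hWb : ∀ y ∈ Set.Icc a b, y ≠ x → ‖W' y‖ ≤ K₁ := by
    intro y hy hyx
    have : ‖W' y‖ ≤ K * (1 / m) + K * (B / m ^ 2) := by
      refine (norm_add_le _ _).trans ?_
      rw [norm_mul, norm_mul, Complex.norm_real, Complex.norm_real]
      exact add_le_add (mul_le_mul (hK' y hy) (hqb y hy hyx) (norm_nonneg _) hK0)
        (mul_le_mul (hK y hy) (hqb' y hy hyx) (norm_nonneg _) hK0)
    have e : K₁ = K * (1 / m) + K * (B / m ^ 2) + K * (B / m ^ 2 + (B / m + 2 * B * B / m ^ 2) / m) := by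
      rw [hK₁]; ring
    have : 0 ≤ K * (B / m ^ 2 + (B / m + 2 * B * B / m ^ 2) / m) := by positivity
    linarith
  have hWb' : ∀ y ∈ Set.Icc a b, y ≠ x → ‖W'' y‖ * |p y| ≤ K₁ * (|p y| + m) := by
    intro y hy hyx
    have h1 : ‖W'' y‖ ≤ K * (1 / m) + 2 * (K * (B / m ^ 2)) + K * |q'' y| := by
      have e1 : ‖F' y * (q' y : ℂ)‖ ≤ K * (B / m ^ 2) := by
        rw [norm_mul, Complex.norm_real]
        exact mul_le_mul (hK' y hy) (hqb' y hy hyx) (norm_nonneg _) hK0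
      have e2 : ‖F'' y * (q y : ℂ)‖ ≤ K * (1 / m) := by
        rw [norm_mul, Complex.norm_real]
        exact mul_le_mul (hK'' y hy) (hqb y hy hyx) (norm_nonneg _) hK0
      have e3 : ‖F y * (q'' y : ℂ)‖ ≤ K * |q'' y| := by
        rw [norm_mul, Complex.norm_real]
        exact mul_le_mul (hK y hy) le_rfl (norm_nonneg _) hK0
      refine (norm_add_le _ _).trans ((add_le_add (norm_add_le _ _) (norm_add_le _ _)).trans ?_)
      linarith
    calc ‖W'' y‖ * |p y| ≤ (K * (1 / m) + 2 * (K * (B / m ^ 2)) + K * |q'' y|) * |p y| := by gcongr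
      _ = K * (1 / m + 2 * B / m ^ 2) * |p y| + K * (|q'' y| * |p y|) := by ring
      _ ≤ K * (1 / m + 2 * B / m ^ 2) * |p y| + K * (B / m + 2 * B * B / m ^ 2) := by
          gcongr; exact hqb'' y hy hyx
      _ ≤ K₁ * |p y| + K₁ * m := by
          have e : K₁ * m = K * (1 / m + 2 * B / m ^ 2) * m + K * (B / m + 2 * B * B / m ^ 2) := by
            rw [hK₁]; field_simp
          have e' : K₁ * |p y| = K * (1 / m + 2 * B / m ^ 2) * |p y| +
            K * ((B / m + 2 * B * B / m ^ 2) / m) * |p y| := by rw [hK₁]; ring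
          have h2 : 0 ≤ K * (1 / m + 2 * B / m ^ 2) * m := by positivity
          have h3 : 0 ≤ K * ((B / m + 2 * B * B / m ^ 2) / m) * |p y| := by positivity
          linarith
      _ = _ := by ring
  have piece : ∀ c d, a ≤ c → c < d → d ≤ b → x ∉ Set.Ioo c d → ‖H d - H c‖ ≤
      K₁ * (3 * Real.pi + (b - a) / 2 + 1) / Real.sqrt (μ * m) := by
    intro c d hac hcd hdb hxcd
    have hI : Set.Ioo c d ⊆ Set.Ioo a b := Set.Ioo_subset_Ioo hac hdb
    have hne : ∀ y ∈ Set.Ioo c d, y ≠ x := fun y hy e => hxcd (e ▸ hy)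
    have hII := fun y (hy : y ∈ Set.Ioo c d) => Set.Ioo_subset_Icc_self (hI hy)
    have := van_der_corput hcd (μ := μ) (τ := m) (K := K₁) (M := 1) (w := fun y => -(s * W' y))
      (w' := fun y => -(s * W'' y)) (P := bregman V₁ V x) (R := fun y => s * p y)
      (R' := fun y => s * V' y) (v := fun _ => s) hμ hm hK₁0 zero_le_one
      (hHc.mono (Set.Icc_subset_Icc hac hdb)) (fun y hy => hHd y (hI hy) (hne y hy)) ?_ ?_ ?_ ?_ ?_ ?_ ?_
    · refine this.trans ?_
      gcongr
      norm_num
    · intro y hy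
      refine (h.hasDerivAt_bregman x (hII y hy)).congr_deriv ?_
      rw [← mul_assoc, ← sq, h.hs, one_mul]
    · intro y hy
      exact ((((hF' y (hII y hy)).mul (hqd y (hII y hy) (hne y hy)).ofReal_comp).add
        ((hF y (hII y hy)).mul (hqd' y (hII y hy) (hne y hy)).ofReal_comp)).const_mul _).neg
    · intro y hy; exact ((h.d1 y (hII y hy)).sub_const _).const_mul _
    · intro y hy; exact h.lower y (hII y hy)
    · intro y hy
      rw [norm_neg, norm_mul, Complex.norm_real, Real.norm_eq_abs, hs1, one_mul]
      exact hWb y (hII y hy) (hne y hy)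
    · intro y hy; exact hs1.le
    · intro y hy
      rw [norm_neg, norm_mul, Complex.norm_real, Real.norm_eq_abs, hs1, one_mul, abs_mul, hs1, one_mul]
      exact hWb' y (hII y hy) (hne y hy)
  rw [← hHab, show H b - H a = (H b - H x) + (H x - H a) by ring, two_mul]
  refine (norm_add_le _ _).trans (add_le_add ?_ ?_)
  · exact piece x b hx.1.le hx.2 le_rfl (by simp)
  · exact piece a x le_rfl hx.1 hx.2.le (by simp)

/-- An amplitude on `[9/20, 2]`, vanishing outside `(1/2, 3/2)`, with two derivatives bounded
by `K`. -/
structure IsAmplitude (K : ℝ) (F F' F'' : ℝ → ℂ) : Prop where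
  d1 : ∀ A ∈ Set.Icc (9/20 : ℝ) 2, HasDerivAt F (F' A) A
  d2 : ∀ A ∈ Set.Icc (9/20 : ℝ) 2, HasDerivAt F' (F'' A) A
  b0 : ∀ A ∈ Set.Icc (9/20 : ℝ) 2, ‖F A‖ ≤ K
  b1 : ∀ A ∈ Set.Icc (9/20 : ℝ) 2, ‖F' A‖ ≤ K
  b2 : ∀ A ∈ Set.Icc (9/20 : ℝ) 2, ‖F'' A‖ ≤ K
  supp : ∀ A, A ∉ Set.Ioo (1/2 : ℝ) (3/2) → F A = 0

/-- The `A`-integral at a fixed frequency `Υ`. -/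
noncomputable def innerA (V₁ : ℝ → ℝ) (F : ℝ → ℂ) (μ Υ : ℝ) : ℂ :=
  ∫ A in (9/20 : ℝ)..2, F A * cis (μ * (V₁ A - A * Υ))

namespace IsAmplitude
variable {K s m B : ℝ} {F F' F'' : ℝ → ℂ} {V₁ V V' V'' : ℝ → ℝ}

lemma nonneg (hF : IsAmplitude K F F' F'') : 0 ≤ K :=
  (norm_nonneg _).trans (hF.b0 1 (by norm_num))

lemma continuousOn_integrand (hF : IsAmplitude K F F' F'')
    (h : IsGoodSlope (9/20) 2 s m B V₁ V V' V'') (μ Υ : ℝ) :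
    ContinuousOn (fun A => F A * cis (μ * (V₁ A - A * Υ))) (Set.Icc (9/20) 2) := fun A hA =>
  ((hF.d1 A hA).mul (hasDerivAt_cis (((h.d0 A hA).sub
    ((hasDerivAt_id A).mul_const Υ)).const_mul μ))).continuousAt.continuousWithinAt

lemma continuous_innerA (hF : IsAmplitude K F F' F'')
    (h : IsGoodSlope (9/20) 2 s m B V₁ V V' V'') (μ : ℝ) : Continuous (innerA V₁ F μ) := by
  refine intervalIntegral.continuous_of_dominated_interval (bound := fun _ => K) ?_ ?_ ?_ ?_
  · intro Υ
    rw [Set.uIoc_of_le (by norm_num)]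
    exact ((hF.continuousOn_integrand h μ Υ).mono Set.Ioc_subset_Icc_self).aestronglyMeasurable
      measurableSet_Ioc
  · intro Υ
    refine Filter.Eventually.of_forall fun A hA => ?_
    rw [Set.uIoc_of_le (by norm_num)] at hA
    rw [norm_mul, norm_cis, mul_one]
    exact hF.b0 A (Set.Ioc_subset_Icc_self hA)
  · exact intervalIntegrable_const
  · refine Filter.Eventually.of_forall fun A _ => ?_
    exact continuous_const.mul (continuous_cis.comp (by fun_prop))

/-- Nonstationary bound away from the range of the slope. -/
lemma innerA_bound (hF : IsAmplitude K F F' F'')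
    (h : IsGoodSlope (9/20) 2 s m B V₁ V V' V'') {μ Υ : ℝ} (hμ : 0 < μ)
    (hΥ : ∀ A ∈ Set.Icc (1/2 : ℝ) (3/2), m / 20 ≤ |V A - Υ|) :
    ‖innerA V₁ F μ Υ‖ ≤ K * (20 * (3 + 20 * B / m) / m) / μ := by
  have hm := h.hm
  have hB := h.B_nonneg (x := 1) (by norm_num)
  have hsub : Set.Icc (1/2 : ℝ) (3/2) ⊆ Set.Icc (9/20) 2 := Set.Icc_subset_Icc (by norm_num) (by norm_num)
  have hc := hF.continuousOn_integrand h μ Υ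
  have e : innerA V₁ F μ Υ = ∫ A in (1/2 : ℝ)..(3/2), ((1 : ℝ) : ℂ) * F A * cis (μ * (V₁ A - A * Υ)) := by
    have i1 : IntervalIntegrable (fun A => F A * cis (μ * (V₁ A - A * Υ))) volume (9/20) (1/2) :=
      (hc.mono (Set.Icc_subset_Icc_right (by norm_num))).intervalIntegrable_of_Icc (by norm_num)
    have i2 : IntervalIntegrable (fun A => F A * cis (μ * (V₁ A - A * Υ))) volume (1/2) (3/2) :=
      (hc.mono hsub).intervalIntegrable_of_Icc (by norm_num)
    have i3 : IntervalIntegrable (fun A => F A * cis (μ * (V₁ A - A * Υ))) volume (3/2) 2 :=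
      (hc.mono (Set.Icc_subset_Icc_left (by norm_num))).intervalIntegrable_of_Icc (by norm_num)
    have z1 : ∫ A in (9/20 : ℝ)..(1/2), F A * cis (μ * (V₁ A - A * Υ)) = 0 := by
      rw [intervalIntegral.integral_congr (g := fun _ => (0 : ℂ))]
      · simp
      · intro A hA
        rw [Set.uIcc_of_le (by norm_num)] at hA
        simp only [hF.supp A fun h => absurd h.1 (not_lt.2 hA.2), zero_mul]
    have z3 : ∫ A in (3/2 : ℝ)..2, F A * cis (μ * (V₁ A - A * Υ)) = 0 := by
      rw [intervalIntegral.integral_congr (g := fun _ => (0 : ℂ))]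
      · simp
      · intro A hA
        rw [Set.uIcc_of_le (by norm_num)] at hA
        simp only [hF.supp A fun h => absurd h.2 (not_lt.2 hA.1), zero_mul]
    rw [innerA, ← intervalIntegral.integral_add_adjacent_intervals i1 (i2.trans i3),
      ← intervalIntegral.integral_add_adjacent_intervals i2 i3, z1, z3, zero_add, add_zero]
    simp
  rw [e]
  have hI := fun y (hy : y ∈ Set.Ioo (1/2 : ℝ) (3/2)) => Set.Ioo_subset_Icc_self hy
  have := nonstationary_once_integral (a := 1/2) (b := 3/2) (by norm_num) (μ := μ) (ρ := m / 20)
    (K := K) (C := 20 * B / m) (w := F) (w' := F') (P := fun A => V₁ A - A * Υ)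
    (R := fun A => V A - Υ) (R' := V') (v := fun _ => 1) hμ (by positivity) hF.nonneg (by positivity)
    ?_ ?_ ?_ ?_ ?_ ?_ ?_ ?_
  · refine this.trans (le_of_eq ?_)
    field_simp; ring
  · simpa using hc.mono hsub
  · intro A hA
    refine ((h.d0 A (hsub (hI A hA))).sub ((hasDerivAt_id A).mul_const Υ)).congr_deriv (by ring)
  · intro A hA; exact hF.d1 A (hsub (hI A hA))
  · intro A hA; exact (h.d1 A (hsub (hI A hA))).sub_const _
  · intro A hA; exact hΥ A (hI A hA)
  · intro A hA
    calc |V' A| ≤ B := h.b1 A (hsub (hI A hA))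
      _ = 20 * B / m * (m / 20) := by field_simp
      _ ≤ _ := by gcongr; exact hΥ A (hI A hA)
  · intro A hA; exact hF.b0 A (hsub (hI A hA))
  · intro A hA; exact hF.b1 A (hsub (hI A hA))

end IsAmplitude

/-- Reduction of the `A`-integral on the range of the slope. -/
lemma innerA_comp (V₁ V : ℝ → ℝ) (F : ℝ → ℂ) (μ x : ℝ) :
    innerA V₁ F μ (V x) = cis (μ * (V₁ x - x * V x)) * kA (9/20) 2 V₁ V F μ x := by
  rw [innerA, kA, ← intervalIntegral.integral_const_mul]
  congr 1; funext A
  rw [mul_left_comm, ← cis_add]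
  congr 2; rw [bregman]; ring

/-- The hypothesis of the final one-dimensional stationary phase estimate: the phase derivative
`V² + X - x` either has a derivative bounded below, or is itself bounded below. -/
def IsPhaseGood (B X θ : ℝ) (V V' : ℝ → ℝ) : Prop :=
  (∃ s₁ : ℝ, s₁ ^ 2 = 1 ∧ ∀ x ∈ Set.Ioo (9/20 : ℝ) 2, θ ≤ s₁ * (2 * V x * V' x - 1)) ∨
  ∀ x ∈ Set.Ioo (9/20 : ℝ) 2, θ ≤ |V x ^ 2 + X - x| ∧ |2 * V x * V' x - 1| ≤ B * |V x ^ 2 + X - x|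

lemma kA_amplitude (m B CF : ℝ) (hm : 0 < m) (hB : 0 ≤ B) (hCF : 0 ≤ CF) : ∃ D, 0 ≤ D ∧ ∀ (μ s : ℝ) (V₁ V V' V'' : ℝ → ℝ)
    (F F' F'' : ℝ → ℂ), 0 < μ → IsGoodSlope (9/20) 2 s m B V₁ V V' V'' →
    IsAmplitude (CF / √μ) F F' F'' →
    ∀ x ∈ Set.Ioo (9/20 : ℝ) 2, ‖kA (9/20) 2 V₁ V F μ x‖ ≤ D / μ ∧ ‖kA' (9/20) 2 V₁ V F μ x‖ ≤ D / μ := by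
  set c1 : ℝ := 3 * Real.pi + (2 - 9/20) / 2 + 1
  set c2 : ℝ := 1 / m + 2 * B / m ^ 2 + (B / m + 2 * B * B / m ^ 2) / m
  have hc1 : 0 ≤ c1 := by positivity
  have hc2 : 0 ≤ c2 := by positivity
  refine ⟨CF * c1 / √m + 2 * (CF * c2 * c1 / √m), by positivity, ?_⟩
  intro μ s V₁ V V' V'' F F' F'' hμ h hF x hx
  have hxI := Set.Ioo_subset_Icc_self hx
  have hsm : √(μ * m) = √μ * √m := Real.sqrt_mul hμ.le m
  have hs2 : √μ * √μ = μ := Real.mul_self_sqrt hμ.le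
  have hsμ : 0 < √μ := Real.sqrt_pos.2 hμ
  have hsm0 : 0 < √m := Real.sqrt_pos.2 hm
  have e1 := kA_bound h (by norm_num) hμ hF.d1 hF.b0 hF.b1 hxI
  have e2 := kA'_bound h hμ hF.d1 hF.d2 hF.b0 hF.b1 hF.b2 (hF.supp _ (by norm_num))
    (hF.supp _ (by norm_num)) hx
  rw [hsm] at e1 e2
  have r1 : CF / √μ * c1 / (√μ * √m) = CF * c1 / √m / μ := by
    nth_rw 3 [← hs2]; generalize √μ = r at *; field_simp
  have r2 : 2 * (CF / √μ * c2 * c1 / (√μ * √m)) = 2 * (CF * c2 * c1 / √m) / μ := by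
    nth_rw 3 [← hs2]; generalize √μ = r at *; field_simp
  constructor
  · refine (e1.trans_eq r1).trans ?_
    gcongr; simp; positivity
  · refine (e2.trans_eq r2).trans ?_
    gcongr; simp; positivity

/-- The integrand of the `Υ`-integral. -/
noncomputable def outerG (χ V₁ : ℝ → ℝ) (F : ℝ → ℂ) (μ X Υ : ℝ) : ℂ :=
  (χ Υ : ℂ) * cis (μ * (Υ ^ 3 / 3 + Υ * X)) * innerA V₁ F μ Υ

lemma interior_bound {χ : ℝ → ℝ} (hχ : IsCutoff χ (-(3/2)) (3/2)) (m B CF : ℝ) (hm : 0 < m)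
    (hB : 0 ≤ B) (hCF : 0 ≤ CF) :
    ∃ D, 0 ≤ D ∧ ∀ (μ X s : ℝ) (V₁ V V' V'' : ℝ → ℝ)
    (F F' F'' : ℝ → ℂ), 1 ≤ μ → IsGoodSlope (9/20) 2 s m B V₁ V V' V'' →
    IsAmplitude (CF / √μ) F F' F'' →
    ‖∫ x in (9/20 : ℝ)..2, (V' x : ℂ) * outerG χ V₁ F μ X (V x)‖ ≤ D / μ ∧
    ∀ θ ∈ Set.Ioc (0 : ℝ) 1, IsPhaseGood B X θ V V' →
      ‖∫ x in (9/20 : ℝ)..2, (V' x : ℂ) * outerG χ V₁ F μ X (V x)‖ ≤ D / μ / √(μ * θ) := by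
  obtain ⟨D, hD, hkA⟩ := kA_amplitude m B CF hm hB hCF
  obtain ⟨M₀, hM₀, hχM⟩ := hχ.bounded
  obtain ⟨M₁, hM₁, hχM'⟩ := hχ.deriv.bounded
  set E := M₀ * D + (M₁ * B * D + M₀ * B * D) with hE
  have hE0 : 0 ≤ E := by positivity
  obtain ⟨c1, hc1⟩ : ∃ c : ℝ, c = (B + 2) * Real.pi + (2 - 9/20) / 2 + 1 := ⟨_, rfl⟩
  obtain ⟨c2, hc2⟩ : ∃ c : ℝ, c = (1 + B) * (2 - 9/20) + 2 := ⟨_, rfl⟩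
  have hc10 : 0 ≤ c1 := by rw [hc1]; positivity
  have hc20 : 0 ≤ c2 := by rw [hc2]; linarith
  refine ⟨2 * B * E + E * c1 + E * c2, by positivity, ?_⟩
  intro μ X s V₁ V V' V'' F F' F'' hμ1 h hF
  have hμ : 0 < μ := by linarith
  have hI : ∀ x ∈ Set.Ioo (9/20 : ℝ) 2, x ∈ Set.Icc (9/20 : ℝ) 2 :=
    fun x hx => Set.Ioo_subset_Icc_self hx
  have hFc : ContinuousOn F (Set.Icc (9/20) 2) := fun y hy =>
    (hF.d1 y hy).continuousAt.continuousWithinAt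
  set w : ℝ → ℂ := fun x => (χ (V x) : ℂ) * kA (9/20) 2 V₁ V F μ x with hw
  set w' : ℝ → ℂ := fun x => ((deriv χ (V x) * V' x : ℝ) : ℂ) * kA (9/20) 2 V₁ V F μ x +
    (χ (V x) : ℂ) * (-(V' x : ℂ) * kA' (9/20) 2 V₁ V F μ x) with hw'
  set P : ℝ → ℝ := fun x => V x ^ 3 / 3 + V x * X + (V₁ x - x * V x) with hP
  have hwd : ∀ x ∈ Set.Ioo (9/20 : ℝ) 2, HasDerivAt w (w' x) x := fun x hx => by
    have := ((hχ.hasDerivAt (V x)).comp x (h.d1 x (hI x hx))).ofReal_comp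
    exact this.mul (kA_hasDerivAt h hFc hF.b0 hx)
  have hPd : ∀ x ∈ Set.Ioo (9/20 : ℝ) 2, HasDerivAt P (V' x * (V x ^ 2 + X - x)) x := fun x hx => by
    have hV := h.d1 x (hI x hx)
    refine ((((hV.pow 3).div_const 3).add (hV.mul_const X)).add
      ((h.d0 x (hI x hx)).sub ((hasDerivAt_id x).mul hV))).congr_deriv ?_
    simp only [id]; push_cast; ring
  have hwb : ∀ x ∈ Set.Ioo (9/20 : ℝ) 2, ‖w x‖ ≤ E / μ := fun x hx => by
    have := (hkA μ s V₁ V V' V'' F F' F'' hμ h hF x hx).1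
    rw [hw, norm_mul, Complex.norm_real, Real.norm_eq_abs]
    calc _ ≤ M₀ * (D / μ) := mul_le_mul (hχM _) this (norm_nonneg _) hM₀
      _ = M₀ * D / μ := by ring
      _ ≤ E / μ := by gcongr; rw [hE]; simp; positivity
  have hw'b : ∀ x ∈ Set.Ioo (9/20 : ℝ) 2, ‖w' x‖ ≤ E / μ := fun x hx => by
    have k1 := (hkA μ s V₁ V V' V'' F F' F'' hμ h hF x hx).1
    have k2 := (hkA μ s V₁ V V' V'' F F' F'' hμ h hF x hx).2
    have hb := h.b1 x (hI x hx)
    calc ‖w' x‖ ≤ _ := norm_add_le _ _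
      _ ≤ M₁ * B * (D / μ) + M₀ * (B * (D / μ)) := by
        rw [norm_mul, norm_mul, norm_mul, norm_neg, Complex.norm_real, Complex.norm_real,
          Complex.norm_real, Real.norm_eq_abs, Real.norm_eq_abs, Real.norm_eq_abs, abs_mul]
        gcongr
        · exact hχM' _
        · exact hχM _
      _ = (M₁ * B * D + M₀ * B * D) / μ := by ring
      _ ≤ E / μ := by gcongr; rw [hE]; simp; positivity
  have hg : ∀ x, outerG χ V₁ F μ X (V x) = w x * cis (μ * P x) := fun x => by
    simp only [outerG, innerA_comp, hw, hP]
    rw [show μ * (V x ^ 3 / 3 + V x * X + (V₁ x - x * V x)) =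
      μ * (V x ^ 3 / 3 + V x * X) + μ * (V₁ x - x * V x) by ring, cis_add]
    ring
  have hVc : ContinuousOn V (Set.Icc (9/20) 2) := fun y hy =>
    (h.d1 y hy).continuousAt.continuousWithinAt
  have hV'c : ContinuousOn V' (Set.Icc (9/20) 2) := fun y hy =>
    (h.d2 y hy).continuousAt.continuousWithinAt
  have hgc : Continuous (outerG χ V₁ F μ X) := by
    unfold outerG
    exact ((Complex.continuous_ofReal.comp hχ.1.continuous).mul
      (continuous_cis.comp (by fun_prop))).mul (hF.continuous_innerA h μ)
  have hc : ContinuousOn (fun x => (V' x : ℂ) * outerG χ V₁ F μ X (V x)) (Set.Icc (9/20) 2) :=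
    (Complex.continuous_ofReal.comp_continuousOn hV'c).mul (hgc.comp_continuousOn hVc)
  have triv : ‖∫ x in (9/20 : ℝ)..2, (V' x : ℂ) * outerG χ V₁ F μ X (V x)‖ ≤ 2 * B * E / μ := by
    refine (intervalIntegral.norm_integral_le_of_norm_le_const_ae (C := B * (E / μ))
      ?_).trans ?_
    · have : ∀ᵐ x : ℝ, x ≠ 2 := by simp [ae_iff]
      filter_upwards [this] with x hx2 hx
      rw [Set.uIoc_of_le (by norm_num)] at hx
      have hx' : x ∈ Set.Ioo (9/20 : ℝ) 2 := ⟨hx.1, lt_of_le_of_ne hx.2 hx2⟩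
      rw [norm_mul, hg, norm_mul, norm_cis, mul_one, Complex.norm_real]
      exact mul_le_mul (h.b1 x (hI x hx')) (hwb x hx') (norm_nonneg _) hB
    · have : 0 ≤ B * (E / μ) := by positivity
      rw [abs_of_nonneg (by norm_num)]
      calc _ ≤ B * (E / μ) * 2 := by nlinarith
        _ = _ := by ring
  refine ⟨triv.trans ?_, ?_⟩
  · gcongr
    have : 0 ≤ E * c1 := by positivity
    have : 0 ≤ E * c2 := by positivity
    linarith
  rintro θ ⟨hθ, hθ1⟩ (⟨s₁, hs₁, H⟩ | H)
  · have hs₁a : |s₁| = 1 := by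
      rw [← sq_abs] at hs₁; nlinarith [abs_nonneg s₁]
    have hssC : (s₁ : ℂ) * s₁ = 1 := by exact_mod_cast (sq s₁ ▸ hs₁)
    have hE' : ∀ x, (V' x : ℂ) * outerG χ V₁ F μ X (V x) =
        ((s₁ * V' x : ℝ) : ℂ) * (s₁ * w x) * cis (μ * P x) := fun x => by
      rw [hg]; push_cast; linear_combination (-(V' x : ℂ) * w x * cis (μ * P x)) * hssC
    have := van_der_corput_integral (a := 9/20) (b := 2) (by norm_num) (w := fun x => s₁ * w x)
      (w' := fun x => s₁ * w' x) (P := P) (R := fun x => s₁ * (V x ^ 2 + X - x))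
      (R' := fun x => s₁ * (2 * V x * V' x - 1)) (v := fun x => s₁ * V' x) (K := E / μ) (M := B)
      hμ hθ (by positivity) hB (by simpa only [hE'] using hc) ?_ ?_ ?_ H ?_ ?_ ?_
    · rw [← hc1] at this
      simp only [hE']
      refine this.trans ?_
      gcongr ?_ / _
      rw [div_mul_eq_mul_div]
      gcongr
      have : 0 ≤ B * E := by positivity
      have : 0 ≤ E * c2 := by positivity
      linarith
    · intro x hx
      refine (hPd x hx).congr_deriv ?_
      linear_combination (-(V' x * (V x ^ 2 + X - x))) * hs₁
    · intro x hx; exact (hwd x hx).const_mul _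
    · intro x hx
      have hV := h.d1 x (hI x hx)
      refine ((((hV.pow 2).add_const X).sub (hasDerivAt_id x)).const_mul s₁).congr_deriv ?_
      push_cast; ring
    · intro x hx
      rw [norm_mul, Complex.norm_real, Real.norm_eq_abs, hs₁a, one_mul]; exact hwb x hx
    · intro x hx
      rw [abs_mul, hs₁a, one_mul]; exact h.b1 x (hI x hx)
    · intro x hx
      rw [norm_mul, Complex.norm_real, Real.norm_eq_abs, hs₁a, one_mul]
      exact mul_le_mul (hw'b x hx) (by linarith) (abs_nonneg _) (by positivity)
  · have hE' : ∀ x, (V' x : ℂ) * outerG χ V₁ F μ X (V x) =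
        (V' x : ℂ) * w x * cis (μ * P x) := fun x => by
      rw [hg]; ring
    have := nonstationary_once_integral (a := 9/20) (b := 2) (by norm_num) (w := w)
      (w' := w') (P := P) (R := fun x => V x ^ 2 + X - x)
      (R' := fun x => 2 * V x * V' x - 1) (v := V') (K := E / μ) (C := B)
      hμ hθ (by positivity) hB (by simpa only [hE'] using hc) hPd hwd ?_
      (fun x hx => (H x hx).1) (fun x hx => (H x hx).2) hwb hw'b
    · have hμθ : 0 < μ * θ := by positivity
      have hsp : 0 < √(μ * θ) := Real.sqrt_pos.2 hμθ
      have hss : √(μ * θ) * √(μ * θ) = μ * θ := Real.mul_self_sqrt hμθ.le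
      rcases le_or_gt (√(μ * θ)) 1 with h1 | h1
      · refine triv.trans ?_
        rw [le_div_iff₀ hsp]
        refine (mul_le_of_le_one_right (by positivity) h1).trans ?_
        gcongr
        have : 0 ≤ E * c1 := by positivity
        have : 0 ≤ E * c2 := by positivity
        linarith
      · rw [← hc2] at this
        simp only [hE']
        refine this.trans ?_
        have : √(μ * θ) ≤ μ * θ := by nlinarith
        rw [div_mul_eq_mul_div]
        gcongr
        have : 0 ≤ B * E := by positivity
        have : 0 ≤ E * c1 := by positivity
        linarith
    · intro x hx
      have hV := h.d1 x (hI x hx)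
      refine (((hV.pow 2).add_const X).sub (hasDerivAt_id x)).congr_deriv ?_
      push_cast; ring

lemma IsGoodSlope.mono_lower {a b s m B : ℝ} {V₁ V V' V'' : ℝ → ℝ}
    (h : IsGoodSlope a b s m B V₁ V V' V'') {x y : ℝ} (hx : x ∈ Set.Icc a b)
    (hy : y ∈ Set.Icc a b) (hxy : x ≤ y) : m * (y - x) ≤ s * (V y - V x) := by
  obtain ⟨c, hc, -, e⟩ := exists_slope h.d1 hx hy
  rw [e, ← mul_assoc]
  exact mul_le_mul_of_nonneg_right (h.lower c hc) (by linarith)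

lemma norm_integral_le_of_split {g : ℝ → ℂ} (hg : Continuous g) {R ε lo hi : ℝ}
    (hlo : -R ≤ lo) (hhi : hi ≤ R) (hlR : lo ≤ R) (hhR : -R ≤ hi) (hε : 0 ≤ ε)
    (h1 : ∀ y ≤ lo, ‖g y‖ ≤ ε) (h2 : ∀ y, hi ≤ y → ‖g y‖ ≤ ε) :
    ‖∫ y in (-R)..R, g y‖ ≤ ‖∫ y in lo..hi, g y‖ + 4 * R * ε := by
  have ii := fun a b : ℝ => hg.intervalIntegrable (μ := volume) a b
  rw [← intervalIntegral.integral_add_adjacent_intervals (ii (-R) lo) (ii lo R),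
    ← intervalIntegral.integral_add_adjacent_intervals (ii lo hi) (ii hi R)]
  have e1 : ‖∫ y in (-R)..lo, g y‖ ≤ ε * |lo - -R| :=
    intervalIntegral.norm_integral_le_of_norm_le_const fun y hy => by
      rw [Set.uIoc_of_le hlo] at hy; exact h1 y hy.2
  have e2 : ‖∫ y in hi..R, g y‖ ≤ ε * |R - hi| :=
    intervalIntegral.norm_integral_le_of_norm_le_const fun y hy => by
      rw [Set.uIoc_of_le hhi] at hy; exact h2 y hy.1.le
  rw [abs_of_nonneg (by linarith)] at e1 e2
  have e3 : ε * (lo - -R) ≤ ε * (2 * R) := by gcongr; linarith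
  have e4 : ε * (R - hi) ≤ ε * (2 * R) := by gcongr; linarith
  calc _ ≤ _ := norm_add_le _ _
    _ ≤ ε * (lo - -R) + (‖∫ y in lo..hi, g y‖ + ε * (R - hi)) :=
        add_le_add e1 ((norm_add_le _ _).trans (by gcongr))
    _ ≤ _ := by linarith

theorem outer_integral_bound {χ : ℝ → ℝ} (hχ : IsCutoff χ (-(3/2)) (3/2)) (m B CF : ℝ) (hm : 0 < m)
    (hB : 0 ≤ B) (hCF : 0 ≤ CF) :
    ∃ D, 0 ≤ D ∧ ∀ (μ X s : ℝ) (V₁ V V' V'' : ℝ → ℝ)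
    (F F' F'' : ℝ → ℂ), 1 ≤ μ → IsGoodSlope (9/20) 2 s m B V₁ V V' V'' →
    (∀ x ∈ Set.Icc (9/20 : ℝ) 2, |V x| ≤ B) → IsAmplitude (CF / √μ) F F' F'' →
    ‖∫ Υ in (-(3/2) : ℝ)..(3/2), outerG χ V₁ F μ X Υ‖ ≤ D / μ ∧
    ∀ θ ∈ Set.Ioc (0 : ℝ) 1, IsPhaseGood B X θ V V' →
      ‖∫ Υ in (-(3/2) : ℝ)..(3/2), outerG χ V₁ F μ X Υ‖ ≤ D / μ / √(μ * θ) := by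
  obtain ⟨D, hD, hInt⟩ := interior_bound hχ m B CF hm hB hCF
  obtain ⟨M₀, hM₀, hχM⟩ := hχ.bounded
  obtain ⟨c, hc⟩ : ∃ c, c = 20 * (3 + 20 * B / m) / m := ⟨_, rfl⟩
  have hc0 : 0 ≤ c := by rw [hc]; positivity
  refine ⟨D + 4 * (B + 3/2) * (M₀ * (CF * c)), by positivity, ?_⟩
  intro μ X s V₁ V V' V'' F F' F'' hμ1 h hVB hF
  have hμ : 0 < μ := by linarith
  have hsμ : 0 < √μ := Real.sqrt_pos.2 hμ
  have hsμ1 : 1 ≤ √μ := Real.one_le_sqrt.2 hμ1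
  obtain ⟨R, hRe⟩ : ∃ R, R = B + 3/2 := ⟨_, rfl⟩
  rw [← hRe]
  have hR : 0 ≤ R := by linarith
  have hgc : Continuous (outerG χ V₁ F μ X) := by
    unfold outerG
    exact ((Complex.continuous_ofReal.comp hχ.1.continuous).mul
      (continuous_cis.comp (by fun_prop))).mul (hF.continuous_innerA h μ)
  have hsupp : Function.support (outerG χ V₁ F μ X) ⊆ Set.Ioo (-(3/2)) (3/2) := by
    intro y hy
    by_contra hn
    exact hy (by simp [outerG, hχ.2 y hn])
  have hext : ∫ Υ in (-(3/2) : ℝ)..(3/2), outerG χ V₁ F μ X Υ = ∫ Υ in (-R)..R, outerG χ V₁ F μ X Υ := by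
    rw [intervalIntegral.integral_eq_integral_of_support_subset
        (hsupp.trans Set.Ioo_subset_Ioc_self),
      intervalIntegral.integral_eq_integral_of_support_subset
        (hsupp.trans (Set.Ioo_subset_Ioc_self.trans (Set.Ioc_subset_Ioc _ _)))]
    · linarith
    · linarith
  have hsub : Set.Icc (1/2 : ℝ) (3/2) ⊆ Set.Icc (9/20) 2 :=
    Set.Icc_subset_Icc (by norm_num) (by norm_num)
  have l9 : (9/20 : ℝ) ∈ Set.Icc (9/20 : ℝ) 2 := by norm_num
  have l2 : (2 : ℝ) ∈ Set.Icc (9/20 : ℝ) 2 := by norm_num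
  obtain ⟨ε, hε⟩ : ∃ ε, ε = M₀ * (CF * c) / μ / √μ := ⟨_, rfl⟩
  have hε0 : 0 ≤ ε := by rw [hε]; positivity
  have hext_bound : ∀ Υ, (∀ A ∈ Set.Icc (1/2 : ℝ) (3/2), m / 20 ≤ |V A - Υ|) →
      ‖outerG χ V₁ F μ X Υ‖ ≤ ε := by
    intro Υ hΥ
    have := hF.innerA_bound h hμ hΥ
    rw [← hc] at this
    rw [outerG, norm_mul, norm_mul, norm_cis, mul_one, Complex.norm_real, Real.norm_eq_abs]
    calc _ ≤ M₀ * (CF / √μ * c / μ) := mul_le_mul (hχM _) this (norm_nonneg _) hM₀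
      _ = ε := by rw [hε]; field_simp
  have hsubst : ∫ x in (9/20 : ℝ)..2, (V' x : ℂ) * outerG χ V₁ F μ X (V x) =
      ∫ y in (V (9/20))..(V 2), outerG χ V₁ F μ X y := by
    have := intervalIntegral.integral_deriv_smul_comp (a := 9/20) (b := 2) (f := V) (f' := V')
      (g := outerG χ V₁ F μ X) (fun x hx => h.d1 x (by rwa [Set.uIcc_of_le (by norm_num)] at hx))
      (by
        rw [Set.uIcc_of_le (by norm_num)]
        exact fun y hy => (h.d2 y hy).continuousAt.continuousWithinAt) hgc
    rw [← this]
    simp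
  have key : ‖∫ Υ in (-(3/2) : ℝ)..(3/2), outerG χ V₁ F μ X Υ‖ ≤
      ‖∫ x in (9/20 : ℝ)..2, (V' x : ℂ) * outerG χ V₁ F μ X (V x)‖ + 4 * R * ε := by
    rw [hext, hsubst]
    have b9 := abs_le.1 (hVB _ l9)
    have b2 := abs_le.1 (hVB _ l2)
    have hs : s = 1 ∨ s = -1 := by simpa using h.hs
    rcases hs with rfl | rfl
    · refine norm_integral_le_of_split hgc (by linarith) (by linarith)
        (by linarith) (by linarith) hε0 ?_ ?_
      · intro y hy
        refine hext_bound y fun A hA => ?_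
        have := h.mono_lower l9 (hsub hA) (hsub hA).1
        have hA1 := hA.1
        refine le_trans ?_ (le_abs_self _)
        nlinarith
      · intro y hy
        refine hext_bound y fun A hA => ?_
        have := h.mono_lower (hsub hA) l2 (hsub hA).2
        have hA1 := hA.2
        refine le_trans ?_ (neg_le_abs _)
        nlinarith
    · rw [intervalIntegral.integral_symm (V 2) (V (9/20)), norm_neg]
      refine norm_integral_le_of_split hgc (by linarith) (by linarith)
        (by linarith) (by linarith) hε0 ?_ ?_
      · intro y hy
        refine hext_bound y fun A hA => ?_
        have := h.mono_lower (hsub hA) l2 (hsub hA).2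
        have hA1 := hA.2
        refine le_trans ?_ (le_abs_self _)
        nlinarith
      · intro y hy
        refine hext_bound y fun A hA => ?_
        have := h.mono_lower l9 (hsub hA) (hsub hA).1
        have hA1 := hA.1
        refine le_trans ?_ (neg_le_abs _)
        nlinarith
  obtain ⟨i1, i2⟩ := hInt μ X s V₁ V V' V'' F F' F'' hμ1 h hF
  constructor
  · refine key.trans ?_
    rw [add_div]
    refine add_le_add i1 ?_
    rw [hε, mul_div_assoc', mul_div_assoc']
    exact div_le_self (by positivity) hsμ1
  · intro θ hθ hgood
    refine key.trans ?_
    rw [add_div, add_div]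
    refine add_le_add (i2 θ hθ hgood) ?_
    rw [hε, mul_div_assoc', mul_div_assoc']
    have : 0 < √(μ * θ) := Real.sqrt_pos.2 (mul_pos hμ hθ.1)
    gcongr
    nlinarith [hθ.2]

/-- The moments `∫₀^∞ t^s e^{-At - κt³} dt`. -/
noncomputable def airyMoment (s κ A : ℝ) : ℝ :=
  ∫ t in Set.Ioi (0 : ℝ), t ^ s * Real.exp (-(A * t) - κ * t ^ 3)

namespace airyMoment

lemma exists_exponent_bound {κ A : ℝ} (hκ : 0 ≤ κ) (h : 0 < A ∨ 0 < κ) :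
    ∃ c δ ε : ℝ, 0 < δ ∧ 0 < ε ∧ ∀ A', A - δ < A' → ∀ t : ℝ, 0 ≤ t →
      -(A' * t) - κ * t ^ 3 ≤ c - ε * t := by
  rcases h with hA | hκ'
  · refine ⟨0, A / 2, A / 2, by positivity, by positivity, fun A' hA' t ht => ?_⟩
    have : 0 ≤ κ * t ^ 3 := by positivity
    nlinarith
  · refine ⟨|A - 2| * √(|A - 2| / κ), 1, 1, one_pos, one_pos, fun A' hA' t ht => ?_⟩
    have h1 : -(|A - 2| * t) ≤ (A' - 1) * t := by
      have := neg_abs_le (A - 2)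
      nlinarith
    rcases le_or_gt t (√(|A - 2| / κ)) with h2 | h2
    · have : |A - 2| * t ≤ |A - 2| * √(|A - 2| / κ) := by gcongr
      have : 0 ≤ κ * t ^ 3 := by positivity
      nlinarith
    · have h3 : |A - 2| / κ ≤ t ^ 2 := (Real.sqrt_le_left ht).1 h2.le
      rw [div_le_iff₀ hκ'] at h3
      have : |A - 2| * t ≤ t ^ 2 * κ * t := by gcongr
      have : 0 ≤ |A - 2| * √(|A - 2| / κ) := by positivity
      nlinarith

lemma integrableOn_rpow_exp {s ε : ℝ} (hs : -1 < s) (hε : 0 < ε) :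
    IntegrableOn (fun t : ℝ => t ^ s * Real.exp (-(ε * t))) (Set.Ioi 0) := by
  have := integrableOn_rpow_mul_exp_neg_mul_rpow hs one_pos hε
  simpa using this

lemma continuousOn_integrand (s κ A : ℝ) :
    ContinuousOn (fun t : ℝ => t ^ s * Real.exp (-(A * t) - κ * t ^ 3)) (Set.Ioi 0) := by
  refine ContinuousOn.mul (fun t ht => ?_) (by fun_prop)
  exact (Real.continuousAt_rpow_const t s (Or.inl (ne_of_gt ht))).continuousWithinAt

lemma integrableOn {s κ A : ℝ} (hs : -1 < s) (hκ : 0 ≤ κ) (h : 0 < A ∨ 0 < κ) :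
    IntegrableOn (fun t : ℝ => t ^ s * Real.exp (-(A * t) - κ * t ^ 3)) (Set.Ioi 0) := by
  obtain ⟨c, δ, ε, hδ, hε, H⟩ := exists_exponent_bound hκ h
  refine ((integrableOn_rpow_exp hs hε).const_mul (Real.exp c)).mono'
    ((continuousOn_integrand s κ A).aestronglyMeasurable measurableSet_Ioi) ?_
  filter_upwards [ae_restrict_mem measurableSet_Ioi] with t ht
  have ht0 : 0 < t := ht
  have hts : 0 ≤ t ^ s := by positivity
  rw [Real.norm_of_nonneg (by positivity), mul_left_comm, ← Real.exp_add]
  gcongr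
  linarith [H A (by linarith) t ht0.le]

lemma hasDerivAt {s κ A : ℝ} (hs : -1 < s) (hκ : 0 ≤ κ) (h : 0 < A ∨ 0 < κ) :
    HasDerivAt (airyMoment s κ) (-airyMoment (s + 1) κ A) A := by
  obtain ⟨c, δ, ε, hδ, hε, H⟩ := exists_exponent_bound hκ h
  have key := hasDerivAt_integral_of_dominated_loc_of_deriv_le
    (μ := volume.restrict (Set.Ioi (0 : ℝ))) (x₀ := A) (s := Metric.ball A δ)
    (F := fun A t => t ^ s * Real.exp (-(A * t) - κ * t ^ 3))
    (F' := fun A t => -(t ^ (s + 1) * Real.exp (-(A * t) - κ * t ^ 3)))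
    (bound := fun t => Real.exp c * (t ^ (s + 1) * Real.exp (-(ε * t))))
    (Metric.ball_mem_nhds A hδ) (.of_forall fun A' =>
      (continuousOn_integrand s κ A').aestronglyMeasurable measurableSet_Ioi)
    (integrableOn hs hκ h)
    ((continuousOn_integrand (s + 1) κ A).aestronglyMeasurable measurableSet_Ioi).neg ?_
    ((integrableOn_rpow_exp (by linarith) hε).const_mul (Real.exp c)) ?_
  · refine key.2.congr_deriv ?_
    rw [airyMoment, integral_neg]
  · filter_upwards [ae_restrict_mem measurableSet_Ioi] with t ht A' hA'
    have ht0 : 0 < t := ht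
    have hts : 0 ≤ t ^ (s + 1) := by positivity
    rw [norm_neg, Real.norm_of_nonneg (by positivity), mul_left_comm, ← Real.exp_add]
    gcongr
    rw [Metric.mem_ball, Real.dist_eq] at hA'
    linarith [H A' (by linarith [neg_abs_le (A' - A)]) t ht0.le]
  · filter_upwards [ae_restrict_mem measurableSet_Ioi] with t ht A' _
    have ht0 : 0 < t := ht
    have := (((hasDerivAt_id A').mul_const t).neg.sub_const (κ * t ^ 3)).exp.const_mul (t ^ s)
    refine this.congr_deriv ?_
    simp only [id, Real.rpow_add ht0, Real.rpow_one, Pi.neg_apply]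
    ring_nf

lemma at_zero {s κ : ℝ} (hs : -1 < s) (hκ : 0 < κ) :
    airyMoment s κ 0 = κ ^ (-((s + 1) / 3)) * (1 / 3) * Real.Gamma ((s + 1) / 3) := by
  have := integral_rpow_mul_exp_neg_mul_rpow (p := 3) (by norm_num) hs hκ
  rw [neg_div] at this
  rw [← this, airyMoment]
  refine setIntegral_congr_fun measurableSet_Ioi fun t _ => ?_
  have : t ^ (3 : ℝ) = t ^ (3 : ℕ) := by exact_mod_cast Real.rpow_natCast t 3
  simp [this]

lemma kappa_zero {s A : ℝ} (hs : -1 < s) (hA : 0 < A) :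
    airyMoment s 0 A = A ^ (-(s + 1)) * Real.Gamma (s + 1) := by
  have := integral_rpow_mul_exp_neg_mul_rpow (p := 1) (by norm_num) hs hA
  simp only [div_one, mul_one] at this
  rw [← this, airyMoment]
  refine setIntegral_congr_fun measurableSet_Ioi fun t _ => ?_
  simp

lemma nonneg (s κ A : ℝ) : 0 ≤ airyMoment s κ A :=
  setIntegral_nonneg measurableSet_Ioi fun t ht => by
    have ht0 : 0 < t := ht
    positivity

lemma le_kappa_zero {s κ A : ℝ} (hs : -1 < s) (hκ : 0 ≤ κ) (hA : 0 < A) :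
    airyMoment s κ A ≤ airyMoment s 0 A := by
  refine setIntegral_mono_on (integrableOn hs hκ (.inl hA)) (integrableOn hs le_rfl (.inl hA))
    measurableSet_Ioi fun t ht => ?_
  have ht0 : 0 < t := ht
  have : 0 ≤ κ * t ^ 3 := by positivity
  gcongr

lemma kappa_zero_sub_le {s κ A : ℝ} (hs : -1 < s) (hκ : 0 ≤ κ) (hA : 0 < A) :
    airyMoment s 0 A - airyMoment s κ A ≤ κ * airyMoment (s + 3) 0 A := by
  rw [airyMoment, airyMoment, airyMoment, ← integral_sub (integrableOn hs le_rfl (.inl hA))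
    (integrableOn hs hκ (.inl hA)), ← integral_const_mul]
  refine setIntegral_mono_on ((integrableOn hs le_rfl (.inl hA)).sub
    (integrableOn hs hκ (.inl hA))) ((integrableOn (by linarith) le_rfl (.inl hA)).const_mul κ)
    measurableSet_Ioi fun t ht => ?_
  have ht0 : 0 < t := ht
  have h1 : -(κ * t ^ 3) + 1 ≤ Real.exp (-(κ * t ^ 3)) := Real.add_one_le_exp _
  have h2 : t ^ (s + 3) = t ^ s * t ^ 3 := by
    rw [Real.rpow_add ht0]; congr 1; exact_mod_cast Real.rpow_natCast t 3
  rw [h2, sub_eq_add_neg (-(A * t)) (κ * t ^ 3), Real.exp_add]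
  simp only [zero_mul, sub_zero]
  have : 0 ≤ t ^ s * Real.exp (-(A * t)) := by positivity
  nlinarith

/-- The third-order equation satisfied by the moment of order `-1/2`. -/
lemma ode {A : ℝ} : 2 * airyMoment (-1/2) (1/12) A - 4 * A * airyMoment (1/2) (1/12) A
    - airyMoment (5/2) (1/12) A = 0 := by
  have hk : (0 : ℝ) ≤ 1/12 := by norm_num
  have hk' : 0 < A ∨ (0 : ℝ) < 1/12 := .inr (by norm_num)
  have i0 := integrableOn (s := -1/2) (by norm_num) hk hk'
  have i1 := integrableOn (s := 1/2) (by norm_num) hk hk'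
  have i3 := integrableOn (s := 5/2) (by norm_num) hk hk'
  have hi : IntegrableOn (fun t : ℝ => 2 * (t ^ (-1/2 : ℝ) * Real.exp (-(A * t) - 1/12 * t ^ 3)) -
      4 * A * (t ^ (1/2 : ℝ) * Real.exp (-(A * t) - 1/12 * t ^ 3)) -
      t ^ (5/2 : ℝ) * Real.exp (-(A * t) - 1/12 * t ^ 3)) (Set.Ioi 0) :=
    ((i0.const_mul 2).sub (i1.const_mul (4 * A))).sub i3
  obtain ⟨c, δ, ε, hδ, hε, H⟩ := exists_exponent_bound hk hk'
  have := integral_Ioi_of_hasDerivAt_of_tendsto (a := 0) (m := 0)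
    (f := fun t : ℝ => 4 * (t ^ (1/2 : ℝ) * Real.exp (-(A * t) - 1/12 * t ^ 3))) ?_ ?_ hi ?_
  · have e := integral_sub ((i0.const_mul 2).sub (i1.const_mul (4 * A))) i3
    simp only [Pi.sub_apply] at e
    rw [e, integral_sub (i0.const_mul 2) (i1.const_mul (4 * A)), integral_const_mul,
      integral_const_mul] at this
    simpa [airyMoment] using this
  · refine ContinuousAt.continuousWithinAt ?_
    exact continuousAt_const.mul ((Real.continuousAt_rpow_const 0 (1/2)
      (.inr (by norm_num))).mul (by fun_prop))
  · intro t ht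
    have ht0 : 0 < t := ht
    have := ((Real.hasDerivAt_rpow_const (p := 1/2) (Or.inl ht0.ne')).mul
      ((((hasDerivAt_id t).const_mul A).neg.sub
        (((hasDerivAt_id t).pow 3).const_mul (1/12))).exp)).const_mul 4
    refine this.congr_deriv ?_
    have e1 : t ^ (1/2 : ℝ) = t ^ (-1/2 : ℝ) * t := by
      rw [← Real.rpow_add_one ht0.ne']; norm_num
    have e2 : t ^ (5/2 : ℝ) = t ^ (-1/2 : ℝ) * t ^ 3 := by
      rw [show (5/2 : ℝ) = -1/2 + 3 by norm_num, Real.rpow_add ht0]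
      congr 1; exact_mod_cast Real.rpow_natCast t 3
    simp only [id, Pi.neg_apply, Pi.sub_apply, Pi.pow_apply]
    rw [e2, e1, show (1/2 - 1 : ℝ) = -1/2 by norm_num]
    push_cast; ring
  · have h0 := (tendsto_rpow_mul_exp_neg_mul_atTop_nhds_zero (1/2) ε hε).const_mul (4 * Real.exp c)
    rw [mul_zero] at h0
    refine squeeze_zero' ?_ ?_ h0
    · filter_upwards [eventually_gt_atTop 0] with t ht
      positivity
    · filter_upwards [eventually_gt_atTop 0] with t ht
      rw [mul_assoc, mul_left_comm (Real.exp c), ← Real.exp_add]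
      gcongr
      linarith [H A (by linarith) t ht.le]

lemma scaling {μ A : ℝ} (hμ : 0 < μ) :
    airyMoment (-1/2) (1/12) (μ ^ (2/3 : ℝ) * A) =
      μ ^ (-1/3 : ℝ) * airyMoment (-1/2) (1 / (12 * μ ^ 2)) A := by
  have hr : 0 < μ ^ (2/3 : ℝ) := by positivity
  have := integral_comp_mul_left_Ioi
    (fun t : ℝ => t ^ (-1/2 : ℝ) * Real.exp (-(A * t) - 1 / (12 * μ ^ 2) * t ^ 3)) 0 hr
  rw [mul_zero] at this
  have e3 : (μ ^ (2/3 : ℝ)) ^ 3 = μ ^ 2 := by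
    rw [← Real.rpow_natCast, ← Real.rpow_mul hμ.le, ← Real.rpow_natCast]; norm_num
  have e4 : μ ^ (-1/3 : ℝ) * (μ ^ (2/3 : ℝ)) ^ (-1/2 : ℝ) = (μ ^ (2/3 : ℝ))⁻¹ := by
    rw [← Real.rpow_mul hμ.le, ← Real.rpow_add hμ, ← Real.rpow_neg hμ.le]; norm_num
  have e5 : μ ^ (-1/3 : ℝ) * μ ^ (2/3 : ℝ) * (μ ^ (2/3 : ℝ)) ^ (-1/2 : ℝ) = 1 := by
    rw [mul_right_comm, e4, inv_mul_cancel₀ hr.ne']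
  have e6 : μ ^ (-1/3 : ℝ) * ∫ t in Set.Ioi (0 : ℝ),
      t ^ (-1/2 : ℝ) * Real.exp (-(A * t) - 1 / (12 * μ ^ 2) * t ^ 3) =
      μ ^ (-1/3 : ℝ) * μ ^ (2/3 : ℝ) * ((μ ^ (2/3 : ℝ))⁻¹ • ∫ t in Set.Ioi (0 : ℝ),
      t ^ (-1/2 : ℝ) * Real.exp (-(A * t) - 1 / (12 * μ ^ 2) * t ^ 3)) := by
    rw [smul_eq_mul]; field_simp
  rw [airyMoment, airyMoment, e6, ← this, ← integral_const_mul]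
  refine setIntegral_congr_fun measurableSet_Ioi fun t ht => ?_
  have ht0 : 0 < t := ht
  rw [Real.mul_rpow hr.le ht0.le, mul_pow, e3]
  have : -(μ ^ (2/3 : ℝ) * A * t) - 1/12 * t ^ 3 =
    -(A * (μ ^ (2/3 : ℝ) * t)) - 1 / (12 * μ ^ 2) * (μ ^ 2 * t ^ 3) := by
    field_simp
  rw [this]
  linear_combination (-(t ^ (-1/2 : ℝ) * Real.exp (-(A * (μ ^ (2/3 : ℝ) * t)) -
    1 / (12 * μ ^ 2) * (μ ^ 2 * t ^ 3)))) * e5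

end airyMoment

lemma rotated_airy_derivs {Ai : ℂ → ℂ} (hd : Differentiable ℂ Ai)
    (hd' : Differentiable ℂ (deriv Ai)) (hode : ∀ z : ℂ, deriv (deriv Ai) z = z * Ai z)
    {c : ℂ} (hc : c ^ 3 = -1) (x : ℝ) :
    HasDerivAt (fun x : ℝ => c * Ai (c * x)) (c ^ 2 * deriv Ai (c * x)) x ∧
    HasDerivAt (fun x : ℝ => c ^ 2 * deriv Ai (c * x)) (-x * (c * Ai (c * x))) x := by
  have hx : HasDerivAt (fun z : ℂ => c * z) c (x : ℂ) := by
    simpa using (hasDerivAt_id (x : ℂ)).const_mul c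
  constructor
  · refine ((((hd (c * x)).hasDerivAt.comp (x : ℂ) hx).const_mul c).comp_ofReal).congr_deriv ?_
    ring
  · refine ((((hd' (c * x)).hasDerivAt.comp (x : ℂ) hx).const_mul (c ^ 2)).comp_ofReal).congr_deriv ?_
    rw [hode]
    linear_combination (c * x * Ai (c * x)) * hc

lemma exp_third_pow_three : Complex.exp ((Real.pi / 3 : ℂ) * Complex.I) ^ 3 = -1 := by
  rw [← Complex.exp_nat_mul, ← Complex.exp_pi_mul_I]; congr 1; push_cast; ring

lemma exp_neg_third_pow_three : Complex.exp (-(Real.pi / 3 : ℂ) * Complex.I) ^ 3 = -1 := by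
  rw [← Complex.exp_nat_mul, ← inv_inj, ← Complex.exp_neg, inv_neg, inv_one,
    ← Complex.exp_pi_mul_I]
  congr 1; push_cast; ring

lemma exp_third_mul : Complex.exp (-(Real.pi / 3 : ℂ) * Complex.I) *
    Complex.exp ((Real.pi / 3 : ℂ) * Complex.I) = 1 := by
  rw [← Complex.exp_add]; simp

lemma exp_third : Complex.exp ((Real.pi / 3 : ℂ) * Complex.I) = 1/2 + (√3 / 2 : ℝ) * Complex.I := by
  rw [Complex.exp_mul_I, show (Real.pi / 3 : ℂ) = ((Real.pi / 3 : ℝ) : ℂ) by push_cast; rfl,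
    ← Complex.ofReal_cos, ← Complex.ofReal_sin, Real.cos_pi_div_three, Real.sin_pi_div_three]
  push_cast; ring

lemma exp_neg_third : Complex.exp (-(Real.pi / 3 : ℂ) * Complex.I) = 1/2 - (√3 / 2 : ℝ) * Complex.I := by
  rw [Complex.exp_mul_I, show (-(Real.pi / 3 : ℂ)) = ((-(Real.pi / 3) : ℝ) : ℂ) by push_cast; rfl,
    ← Complex.ofReal_cos, ← Complex.ofReal_sin, Real.cos_neg, Real.sin_neg, Real.cos_pi_div_three,
    Real.sin_pi_div_three]
  push_cast; ring

lemma gamma_third_mul : Real.Gamma (1/3) * Real.Gamma (2/3) = 2 * Real.pi / √3 := by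
  have := Real.Gamma_mul_Gamma_one_sub (1/3)
  rw [show Real.pi * (1/3) = Real.pi / 3 by ring, Real.sin_pi_div_three] at this
  rw [show (2/3 : ℝ) = 1 - 1/3 by norm_num, this]
  field_simp

lemma gamma_sixth : Real.Gamma (1/6) * Real.Gamma (2/3) ^ 2 =
    2 * Real.pi / √3 * 2 ^ (2/3 : ℝ) * √Real.pi := by
  have := Real.Gamma_mul_Gamma_add_half (1/6)
  norm_num at this
  rw [← gamma_third_mul, pow_two, ← mul_assoc, this]
  ring

lemma gamma_five_sixth : Real.Gamma (5/6) * Real.Gamma (1/3) ^ 2 =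
    2 * Real.pi / √3 * 2 ^ (1/3 : ℝ) * √Real.pi := by
  have := Real.Gamma_mul_Gamma_add_half (1/3)
  norm_num at this
  rw [← gamma_third_mul, pow_two, ← mul_assoc, mul_comm (Real.Gamma (5/6)), this]
  ring

lemma moment_zero : (3 : ℝ) ^ (-2/3 : ℝ) / Real.Gamma (2/3) * ((3 : ℝ) ^ (-2/3 : ℝ) / Real.Gamma (2/3)) =
    1 / (4 * (Real.pi * √Real.pi)) * airyMoment (-1/2) (1/12) 0 := by
  rw [airyMoment.at_zero (by norm_num) (by norm_num)]
  have hg : 0 < Real.Gamma (2/3) := Real.Gamma_pos_of_pos (by norm_num)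
  have hg6 := gamma_sixth
  rw [show ((-1/2 + 1) / 3 : ℝ) = 1/6 by norm_num]
  rw [← eq_div_iff (by positivity)] at hg6
  rw [hg6]
  have h12 : (1/12 : ℝ) ^ (-(1/6) : ℝ) = 2 ^ (1/3 : ℝ) * 3 ^ (1/6 : ℝ) := by
    rw [one_div, Real.inv_rpow (by norm_num), ← Real.rpow_neg (by norm_num), neg_neg,
      show (12 : ℝ) = 2 ^ (2 : ℝ) * 3 by norm_num, Real.mul_rpow (by positivity) (by norm_num),
      ← Real.rpow_mul (by norm_num)]
    norm_num
  have h2 : (2 : ℝ) ^ (1/3 : ℝ) * 2 ^ (2/3 : ℝ) = 2 := by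
    rw [← Real.rpow_add (by norm_num)]; norm_num
  have h3 : (3 : ℝ) ^ (-2/3 : ℝ) * 3 ^ (-2/3 : ℝ) * √3 * 6 = 2 * 3 ^ (1/6 : ℝ) := by
    rw [Real.sqrt_eq_rpow, ← Real.rpow_add (by norm_num), ← Real.rpow_add (by norm_num),
      show (1/6 : ℝ) = (-2/3 + -2/3 + 1/2) + 1 by norm_num, Real.rpow_add_one (by norm_num)]
    ring
  rw [h12]
  have hπ : 0 < √Real.pi := by positivity
  have hs3 : 0 < √(3 : ℝ) := by positivity
  generalize (3 : ℝ) ^ (-2/3 : ℝ) = p at *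
  field_simp
  linear_combination (2:ℝ) * h3 - (2 : ℝ) * (3 : ℝ) ^ (1/6 : ℝ) * h2

lemma moment_one : -((3 : ℝ) ^ (-2/3 : ℝ) / Real.Gamma (2/3) * ((3 : ℝ) ^ (-1/3 : ℝ) / Real.Gamma (1/3))) =
    1 / (4 * (Real.pi * √Real.pi)) * -airyMoment (1/2) (1/12) 0 := by
  rw [airyMoment.at_zero (by norm_num) (by norm_num)]
  have hg : 0 < Real.Gamma (2/3) := Real.Gamma_pos_of_pos (by norm_num)
  have hg1 : 0 < Real.Gamma (1/3) := Real.Gamma_pos_of_pos (by norm_num)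
  have hg3 := gamma_third_mul
  rw [show ((1/2 + 1) / 3 : ℝ) = 1/2 by norm_num, Real.Gamma_one_half_eq]
  have h12 : (1/12 : ℝ) ^ (-(1/2) : ℝ) = 2 * √3 := by
    rw [one_div, Real.inv_rpow (by norm_num), ← Real.rpow_neg (by norm_num), neg_neg,
      ← Real.sqrt_eq_rpow, show (12 : ℝ) = 2 ^ 2 * 3 by norm_num, Real.sqrt_mul (by norm_num),
      Real.sqrt_sq (by norm_num)]
  have h3 : (3 : ℝ) ^ (-2/3 : ℝ) * 3 ^ (-1/3 : ℝ) = 1/3 := by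
    rw [← Real.rpow_add (by norm_num), show (-2/3 + -1/3 : ℝ) = -1 by norm_num, Real.rpow_neg_one]
    norm_num
  have hπ : 0 < √Real.pi := by positivity
  have hs3 : 0 < √(3 : ℝ) := by positivity
  rw [h12, div_mul_div_comm, h3, mul_comm (Real.Gamma (2/3)), hg3]
  field_simp
  ring

lemma moment_two : 2 * ((3 : ℝ) ^ (-1/3 : ℝ) / Real.Gamma (1/3)) ^ 2 =
    1 / (4 * (Real.pi * √Real.pi)) * airyMoment (3/2) (1/12) 0 := by
  rw [airyMoment.at_zero (by norm_num) (by norm_num)]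
  have hg : 0 < Real.Gamma (1/3) := Real.Gamma_pos_of_pos (by norm_num)
  have hg6 := gamma_five_sixth
  rw [show ((3/2 + 1) / 3 : ℝ) = 5/6 by norm_num]
  rw [← eq_div_iff (by positivity)] at hg6
  rw [hg6]
  have h12 : (1/12 : ℝ) ^ (-(5/6) : ℝ) = 2 ^ (5/3 : ℝ) * 3 ^ (5/6 : ℝ) := by
    rw [one_div, Real.inv_rpow (by norm_num), ← Real.rpow_neg (by norm_num), neg_neg,
      show (12 : ℝ) = 2 ^ (2 : ℝ) * 3 by norm_num, Real.mul_rpow (by positivity) (by norm_num),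
      ← Real.rpow_mul (by norm_num)]
    norm_num
  have h2 : (2 : ℝ) ^ (5/3 : ℝ) * 2 ^ (1/3 : ℝ) = 4 := by
    rw [← Real.rpow_add (by norm_num)]; norm_num
  have h3 : (3 : ℝ) ^ (-1/3 : ℝ) * 3 ^ (-1/3 : ℝ) * √3 * 3 = 3 ^ (5/6 : ℝ) := by
    rw [Real.sqrt_eq_rpow, ← Real.rpow_add (by norm_num), ← Real.rpow_add (by norm_num),
      show (5/6 : ℝ) = (-1/3 + -1/3 + 1/2) + 1 by norm_num, Real.rpow_add_one (by norm_num)]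
  rw [h12]
  have hπ : 0 < √Real.pi := by positivity
  have hs3 : 0 < √(3 : ℝ) := by positivity
  generalize (3 : ℝ) ^ (-1/3 : ℝ) = p at *
  field_simp
  linear_combination (4:ℝ) * h3 - (3 : ℝ) ^ (5/6 : ℝ) * h2

section
variable {Ai : ℂ → ℂ}

lemma Aplus_derivs (hd : Differentiable ℂ Ai)
    (hd' : Differentiable ℂ (deriv Ai)) (hode : ∀ z : ℂ, deriv (deriv Ai) z = z * Ai z) :
    ∃ P' M' : ℝ → ℂ, (∀ x : ℝ, HasDerivAt (fun x : ℝ => Aplus Ai x) (P' x) x ∧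
      HasDerivAt P' (-x * Aplus Ai x) x ∧ HasDerivAt (fun x : ℝ => Aminus Ai x) (M' x) x ∧
      HasDerivAt M' (-x * Aminus Ai x) x) ∧
      P' 0 = Complex.exp (-(Real.pi / 3 : ℂ) * Complex.I) ^ 2 * deriv Ai 0 ∧
      M' 0 = Complex.exp ((Real.pi / 3 : ℂ) * Complex.I) ^ 2 * deriv Ai 0 := by
  refine ⟨_, _, fun x => ⟨(rotated_airy_derivs hd hd' hode exp_neg_third_pow_three x).1,
    (rotated_airy_derivs hd hd' hode exp_neg_third_pow_three x).2,
    (rotated_airy_derivs hd hd' hode exp_third_pow_three x).1,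
    (rotated_airy_derivs hd hd' hode exp_third_pow_three x).2⟩, ?_, ?_⟩ <;> simp

/-- The product `A₊A₋` is a moment. -/
lemma Aplus_mul_Aminus (hd : Differentiable ℂ Ai)
    (hd' : Differentiable ℂ (deriv Ai)) (hode : ∀ z : ℂ, deriv (deriv Ai) z = z * Ai z)
    (h0 : Ai 0 = ((3 ^ (-2/3 : ℝ) / Real.Gamma (2/3) : ℝ) : ℂ))
    (h0' : deriv Ai 0 = ((-(3 ^ (-1/3 : ℝ) / Real.Gamma (1/3)) : ℝ) : ℂ)) {x : ℝ} (hx : 0 ≤ x) :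
    Aplus Ai x * Aminus Ai x =
      ((1 / (4 * (Real.pi * √Real.pi)) * airyMoment (-1/2) (1/12) x : ℝ) : ℂ) := by
  obtain ⟨P', M', hder, hP0, hM0⟩ := Aplus_derivs hd hd' hode
  set k : ℝ := 1 / (4 * (Real.pi * √Real.pi)) with hk
  have h12 : (0 : ℝ) < 1/12 := by norm_num
  let f : ℝ → ℂ × ℂ × ℂ := fun x =>
    (Aplus Ai x * Aminus Ai x - ((k * airyMoment (-1/2) (1/12) x : ℝ) : ℂ),
     P' x * Aminus Ai x + Aplus Ai x * M' x - ((k * -airyMoment (1/2) (1/12) x : ℝ) : ℂ),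
     -2 * x * (Aplus Ai x * Aminus Ai x) + 2 * (P' x * M' x) -
      ((k * airyMoment (3/2) (1/12) x : ℝ) : ℂ))
  let f' : ℝ → ℂ × ℂ × ℂ := fun x =>
    ((f x).2.1, (f x).2.2, -4 * x * (f x).2.1 - 2 * (f x).1)
  have hf : ∀ x, HasDerivAt f (f' x) x := by
    intro x
    obtain ⟨d1, d2, d3, d4⟩ := hder x
    have m0 := ((airyMoment.hasDerivAt (s := -1/2) (by norm_num) h12.le (.inr h12) (A := x)).const_mul k).ofReal_comp
    have m1 := ((airyMoment.hasDerivAt (s := 1/2) (by norm_num) h12.le (.inr h12) (A := x)).neg.const_mul k).ofReal_comp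
    have m2 := ((airyMoment.hasDerivAt (s := 3/2) (by norm_num) h12.le (.inr h12) (A := x)).const_mul k).ofReal_comp
    refine HasDerivAt.prodMk ?_ (HasDerivAt.prodMk ?_ ?_)
    · refine ((d1.mul d3).sub m0).congr_deriv ?_
      simp only [f]
      norm_num
    · refine (((d2.mul d3).add (d1.mul d4)).sub m1).congr_deriv ?_
      simp only [f]
      norm_num
      ring
    · have hx2 : HasDerivAt (fun x : ℝ => -2 * (x : ℂ)) (-2) x := by
        simpa using (Complex.ofRealCLM.hasDerivAt (x := x)).const_mul (-2)
      refine (((hx2.mul (d1.mul d3)).add ((d2.mul d4).const_mul 2)).sub m2).congr_deriv ?_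
      have := airyMoment.ode (A := x)
      have e : (airyMoment (5/2) (1/12) x : ℂ) = 2 * airyMoment (-1/2) (1/12) x -
          4 * x * airyMoment (1/2) (1/12) x := by
        have : airyMoment (5/2) (1/12) x = 2 * airyMoment (-1/2) (1/12) x -
          4 * x * airyMoment (1/2) (1/12) x := by linarith
        rw [this]; push_cast; ring
      simp only [f, Pi.mul_apply]
      rw [show (3/2 + 1 : ℝ) = 5/2 by norm_num]
      push_cast
      rw [e]
      ring
  have hg := norm_le_gronwallBound_of_norm_deriv_right_le (f := f) (f' := f') (δ := 0)
    (K := 4 * x + 3) (ε := 0) (a := 0) (b := x) (fun y _ => (hf y).continuousAt.continuousWithinAt)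
    (fun y _ => (hf y).hasDerivWithinAt) ?_ ?_ x ⟨hx, le_rfl⟩
  · rw [gronwallBound_ε0_δ0] at hg
    have : f x = 0 := by simpa using hg
    have h1 : (f x).1 = 0 := by rw [this]; rfl
    exact sub_eq_zero.1 h1
  · have e1 : (f 0).1 = 0 := by
      have := congrArg (fun r : ℝ => (r : ℂ)) moment_zero
      simp only [f, Aplus, Aminus, Complex.ofReal_zero, mul_zero]
      rw [← hk] at this
      rw [← this, h0, mul_mul_mul_comm, exp_third_mul]
      push_cast; ring
    have e2 : (f 0).2.1 = 0 := by
      have := congrArg (fun r : ℝ => (r : ℂ)) moment_one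
      simp only [f, Aplus, Aminus, Complex.ofReal_zero, mul_zero]
      rw [← hk] at this
      rw [← this, hP0, hM0, h0, h0', exp_third, exp_neg_third]
      have hI := Complex.I_sq
      have hs3 : ((√3 : ℝ) : ℂ) ^ 2 = 3 := by
        exact_mod_cast Real.sq_sqrt (show (0:ℝ) ≤ 3 by norm_num)
      push_cast
      ring_nf
      simp only [hI, hs3]
      ring
    have e3 : (f 0).2.2 = 0 := by
      have := congrArg (fun r : ℝ => (r : ℂ)) moment_two
      simp only [f, Complex.ofReal_zero, mul_zero, zero_mul]
      rw [← hk] at this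
      rw [← this, hP0, hM0, h0', mul_mul_mul_comm, ← mul_pow, exp_third_mul]
      push_cast; ring
    have : f 0 = 0 := Prod.ext e1 (Prod.ext e2 e3)
    rw [this, norm_zero]
  · intro y hy
    have n1 : ‖(f y).1‖ ≤ ‖f y‖ := norm_fst_le _
    have n2 : ‖(f y).2.1‖ ≤ ‖f y‖ := (norm_fst_le _).trans (norm_snd_le _)
    have n3 : ‖(f y).2.2‖ ≤ ‖f y‖ := (norm_snd_le _).trans (norm_snd_le _)
    have n0 := norm_nonneg (f y)
    have hxn : 0 ≤ x * ‖f y‖ := mul_nonneg hx n0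
    rw [add_zero]
    refine norm_prod_le_iff.2 ⟨by simp only [f']; nlinarith, norm_prod_le_iff.2 ⟨by simp only [f']; nlinarith, ?_⟩⟩
    calc ‖-4 * (y : ℂ) * (f y).2.1 - 2 * (f y).1‖ ≤ ‖-4 * (y : ℂ) * (f y).2.1‖ + ‖2 * (f y).1‖ :=
          norm_sub_le _ _
      _ = 4 * y * ‖(f y).2.1‖ + 2 * ‖(f y).1‖ := by
          simp [abs_of_nonneg hy.1]
      _ ≤ 4 * x * ‖f y‖ + 2 * ‖f y‖ := by
          have := hy.1
          have := hy.2.le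
          gcongr
      _ ≤ _ := by linarith

/-- The Wronskian of `A₊` and `A₋`, together with the derivative of their quotient. -/
lemma hasDerivAt_Aminus_div_Aplus (hd : Differentiable ℂ Ai)
    (hd' : Differentiable ℂ (deriv Ai)) (hode : ∀ z : ℂ, deriv (deriv Ai) z = z * Ai z)
    (h0 : Ai 0 = ((3 ^ (-2/3 : ℝ) / Real.Gamma (2/3) : ℝ) : ℂ))
    (h0' : deriv Ai 0 = ((-(3 ^ (-1/3 : ℝ) / Real.Gamma (1/3)) : ℝ) : ℂ))
    (hne : ∀ w : ℝ, Aplus Ai w ≠ 0) (x : ℝ) :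
    HasDerivAt (fun x : ℝ => -Aminus Ai x / Aplus Ai x)
      (Complex.I / (2 * Real.pi) / Aplus Ai x ^ 2) x := by
  obtain ⟨P', M', hder, hP0, hM0⟩ := Aplus_derivs hd hd' hode
  have hW : ∀ x : ℝ, M' x * Aplus Ai x - Aminus Ai x * P' x = -Complex.I / (2 * Real.pi) := by
    intro x
    have hc := is_const_of_deriv_eq_zero (f := fun x : ℝ => M' x * Aplus Ai x - Aminus Ai x * P' x)
      (fun x => (((hder x).2.2.2.mul (hder x).1).sub
        ((hder x).2.2.1.mul (hder x).2.1)).differentiableAt)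
      (fun x => by
        refine (((hder x).2.2.2.mul (hder x).1).sub
          ((hder x).2.2.1.mul (hder x).2.1)).deriv.trans ?_
        ring) x 0
    refine hc.trans ?_
    have h3 : (3 : ℝ) ^ (-2/3 : ℝ) * 3 ^ (-1/3 : ℝ) = 1/3 := by
      rw [← Real.rpow_add (by norm_num), show (-2/3 + -1/3 : ℝ) = -1 by norm_num,
        Real.rpow_neg_one]
      norm_num
    have hprod : (3 : ℝ) ^ (-2/3 : ℝ) / Real.Gamma (2/3) * -((3 : ℝ) ^ (-1/3 : ℝ) / Real.Gamma (1/3))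
        * √3 = -(1 / (2 * Real.pi)) := by
      have hss : √(3 : ℝ) * √3 = 3 := Real.mul_self_sqrt (by norm_num)
      rw [mul_neg, div_mul_div_comm, h3, mul_comm (Real.Gamma (2/3)), gamma_third_mul]
      field_simp
      linear_combination (-1 : ℝ) * hss
    have hprodC := congrArg (fun r : ℝ => (r : ℂ)) hprod
    simp only [Complex.ofReal_mul] at hprodC
    rw [← h0, ← h0'] at hprodC
    simp only [hP0, hM0, Aplus, Aminus, Complex.ofReal_zero, mul_zero]
    have e1 := exp_third_mul
    have e2 := exp_third
    have e3 := exp_neg_third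
    generalize Complex.exp ((Real.pi / 3 : ℂ) * Complex.I) = u at *
    generalize Complex.exp (-(Real.pi / 3 : ℂ) * Complex.I) = v at *
    have : u ^ 2 * deriv Ai 0 * (v * Ai 0) - u * Ai 0 * (v ^ 2 * deriv Ai 0) =
        Ai 0 * deriv Ai 0 * (u - v) := by linear_combination (Ai 0 * deriv Ai 0 * (u - v)) * e1
    rw [this, e2, e3]
    push_cast at hprodC ⊢
    linear_combination Complex.I * hprodC
  refine ((hder x).2.2.1.neg.div (hder x).1 (hne x)).congr_deriv ?_
  have := hW x
  congr 1
  simp only [Pi.neg_apply]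
  linear_combination (-1 : ℂ) * this

end

lemma hasDerivAt_of_exp {L : ℝ → ℝ} (hL : Continuous L) {E : ℝ → ℂ} {e : ℂ} {x : ℝ}
    (hE : ∀ y, Complex.exp (-(L y : ℂ) * Complex.I) = E y) (hd : HasDerivAt E e x) :
    HasDerivAt L (Complex.I * (e / E x)).re x := by
  have hx0 : E x ≠ 0 := by rw [← hE]; exact Complex.exp_ne_zero _
  have h1 : HasDerivAt (fun y => Complex.log (E y / E x)) (e / E x / (E x / E x)) x :=
    (hd.div_const (E x)).clog_real (by rw [div_self hx0]; exact Complex.one_mem_slitPlane)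
  rw [div_self hx0, div_one] at h1
  have h2 := (Complex.reCLM.hasFDerivAt.comp_hasDerivAt x (h1.const_mul Complex.I)).const_add (L x)
  refine h2.congr_of_eventuallyEq ?_
  have : ∀ᶠ y in nhds x, |L y - L x| < Real.pi := by
    have := (hL.tendsto x).eventually (Metric.ball_mem_nhds (L x) Real.pi_pos)
    filter_upwards [this] with y hy
    rwa [← Real.dist_eq]
  filter_upwards [this] with y hy
  have hy' := abs_lt.1 hy
  have : E y / E x = Complex.exp (((-(L y - L x) : ℝ) : ℂ) * Complex.I) := by
    rw [← hE, ← hE, ← Complex.exp_sub]; congr 1; push_cast; ring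
  simp only [Function.comp_apply]
  rw [this, Complex.log_exp]
  · have : Complex.I * (((-(L y - L x) : ℝ) : ℂ) * Complex.I) = ((L y - L x : ℝ) : ℂ) := by
      push_cast; linear_combination (-(L y - L x : ℂ)) * Complex.I_sq
    rw [this, Complex.reCLM_apply, Complex.ofReal_re]; ring
  · simp; linarith
  · simp; linarith

/-- The derivative of the rescaled phase `L`, as a moment. -/
noncomputable def airySlope (κ A : ℝ) : ℝ := 2 * √Real.pi / airyMoment (-1/2) κ A

lemma hasDerivAt_airyPhase {Ai : ℂ → ℂ} (hd : Differentiable ℂ Ai)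
    (hd' : Differentiable ℂ (deriv Ai)) (hode : ∀ z : ℂ, deriv (deriv Ai) z = z * Ai z)
    (h0 : Ai 0 = (3 : ℂ) ^ (-(2 : ℂ)/3) / Complex.Gamma (2/3))
    (h0' : deriv Ai 0 = -((3 : ℂ) ^ (-(1 : ℂ)/3)) / Complex.Gamma (1/3))
    (hne : ∀ w : ℝ, Aplus Ai w ≠ 0) {L : ℝ → ℝ} (hL : Continuous L)
    (hL_char : ∀ w : ℝ, Complex.exp (-(L w : ℂ) * Complex.I) = -(Aminus Ai w) / (Aplus Ai w))
    {μ A : ℝ} (hμ : 0 < μ) (hA : 0 ≤ A) :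
    HasDerivAt (fun A => L (μ ^ (2/3 : ℝ) * A) / μ) (airySlope (1 / (12 * μ ^ 2)) A) A := by
  have g0 : Ai 0 = ((3 ^ (-2/3 : ℝ) / Real.Gamma (2/3) : ℝ) : ℂ) := by
    rw [h0, Complex.ofReal_div, ← Complex.Gamma_ofReal, Complex.ofReal_cpow (by norm_num)]
    push_cast; rfl
  have g0' : deriv Ai 0 = ((-(3 ^ (-1/3 : ℝ) / Real.Gamma (1/3)) : ℝ) : ℂ) := by
    rw [h0', Complex.ofReal_neg, Complex.ofReal_div, ← Complex.Gamma_ofReal,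
      Complex.ofReal_cpow (by norm_num), neg_div]
    push_cast; rfl
  have hω : ∀ ω : ℝ, 0 ≤ ω → HasDerivAt L (2 * √Real.pi / airyMoment (-1/2) (1/12) ω) ω := by
    intro ω hω
    have h := hasDerivAt_of_exp hL hL_char (hasDerivAt_Aminus_div_Aplus hd hd' hode g0 g0' hne ω)
    refine h.congr_deriv ?_
    have hm := Aplus_mul_Aminus hd hd' hode g0 g0' hω
    have hAm : Aminus Ai ω ≠ 0 := fun h => by
      have := hL_char ω
      rw [h] at this
      simp at this
    have hAp := hne ω
    have e : Complex.I * (Complex.I / (2 * Real.pi) / Aplus Ai ω ^ 2 / (-Aminus Ai ω / Aplus Ai ω)) =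
        1 / (2 * Real.pi * (Aplus Ai ω * Aminus Ai ω)) := by
      have hpi : (Real.pi : ℂ) ≠ 0 := by exact_mod_cast Real.pi_ne_zero
      field_simp
      linear_combination (-1 : ℂ) * Complex.I_sq
    rw [e, hm]
    have hss : √Real.pi * √Real.pi = Real.pi := Real.mul_self_sqrt Real.pi_pos.le
    have hsp : 0 < √Real.pi := Real.sqrt_pos.2 Real.pi_pos
    rw [show (1 / (2 * (Real.pi : ℂ) * ((1 / (4 * (Real.pi * √Real.pi)) *
      airyMoment (-1/2) (1/12) ω : ℝ) : ℂ))) = ((1 / (2 * Real.pi * (1 / (4 * (Real.pi * √Real.pi)) *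
      airyMoment (-1/2) (1/12) ω)) : ℝ) : ℂ) by push_cast; rfl, Complex.ofReal_re]
    field_simp
    norm_num
  have hr : 0 < μ ^ (2/3 : ℝ) := by positivity
  have h := ((hω (μ ^ (2/3 : ℝ) * A) (by positivity)).comp A
    ((hasDerivAt_id A).const_mul (μ ^ (2/3 : ℝ)))).div_const μ
  refine h.congr_deriv ?_
  rw [airySlope, airyMoment.scaling hμ]
  have e : μ ^ (2/3 : ℝ) = μ * μ ^ (-1/3 : ℝ) := by
    rw [mul_comm, ← Real.rpow_add_one hμ.ne']; norm_num
  have : 0 < μ ^ (-1/3 : ℝ) := by positivity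
  rw [e]
  field_simp

/-- The derivative of `airySlope`. -/
noncomputable def airySlope' (κ A : ℝ) : ℝ :=
  2 * √Real.pi * (airyMoment (1/2) κ A / airyMoment (-1/2) κ A ^ 2)

/-- The second derivative of `airySlope`. -/
noncomputable def airySlope'' (κ A : ℝ) : ℝ :=
  2 * √Real.pi * (2 * airyMoment (1/2) κ A ^ 2 / airyMoment (-1/2) κ A ^ 3 -
    airyMoment (3/2) κ A / airyMoment (-1/2) κ A ^ 2)

lemma airyMoment_zero_bound {s : ℝ} (hs : -1 < s) : ∃ C, 0 ≤ C ∧ ∀ A ∈ Set.Icc (9/20 : ℝ) 2,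
    airyMoment s 0 A ≤ C := by
  refine ⟨(9/20) ^ (-(s + 1)) * Real.Gamma (s + 1), ?_, fun A hA => ?_⟩
  · have := Real.Gamma_pos_of_pos (show 0 < s + 1 by linarith)
    positivity
  · have hA0 : 0 < A := by linarith [hA.1]
    have := Real.Gamma_pos_of_pos (show 0 < s + 1 by linarith)
    rw [airyMoment.kappa_zero hs hA0]
    exact mul_le_mul_of_nonneg_right
      (Real.rpow_le_rpow_of_nonpos (by norm_num) hA.1 (by linarith)) this.le

theorem airySlope_bounds : ∃ κ₀ C : ℝ, 0 < κ₀ ∧ 0 ≤ C ∧ ∀ κ ∈ Set.Icc (0 : ℝ) κ₀,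
    ∀ A ∈ Set.Icc (9/20 : ℝ) 2,
      HasDerivAt (airySlope κ) (airySlope' κ A) A ∧ HasDerivAt (airySlope' κ) (airySlope'' κ A) A ∧
      |airySlope κ A - 2 * √A| ≤ C * κ ∧ |airySlope' κ A - 1 / √A| ≤ C * κ ∧
      |airySlope'' κ A| ≤ C := by
  obtain ⟨C1, hC1, h1⟩ := airyMoment_zero_bound (s := 1/2) (by norm_num)
  obtain ⟨C2, hC2, h2⟩ := airyMoment_zero_bound (s := 3/2) (by norm_num)
  obtain ⟨C3, hC3, h3⟩ := airyMoment_zero_bound (s := -1/2 + 3) (by norm_num)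
  obtain ⟨C4, hC4, h4⟩ := airyMoment_zero_bound (s := 1/2 + 3) (by norm_num)
  obtain ⟨C0, hC0, h0⟩ := airyMoment_zero_bound (s := -1/2) (by norm_num)
  have hpi : 0 ≤ √Real.pi := Real.sqrt_nonneg _
  have hss : √Real.pi * √Real.pi = Real.pi := Real.mul_self_sqrt Real.pi_pos.le
  refine ⟨1 / (2 * (C3 + 1)), 2 * √Real.pi * (2 * C3) + 2 * √Real.pi * (4 * C4 + C1 * (C3 * (2 * C0)) * 4) +
    2 * √Real.pi * (2 * C1 ^ 2 * 8 + C2 * 4), by positivity, by positivity, ?_⟩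
  intro κ hκ A hA
  have hA0 : 0 < A := by linarith [hA.1]
  have hκ0 := hκ.1
  obtain ⟨p, hp⟩ : ∃ p, p = airyMoment (-1/2) κ A := ⟨_, rfl⟩
  obtain ⟨q, hq⟩ : ∃ q, q = airyMoment (1/2) κ A := ⟨_, rfl⟩
  obtain ⟨r, hr⟩ : ∃ r, r = airyMoment (3/2) κ A := ⟨_, rfl⟩
  obtain ⟨p0, hp0⟩ : ∃ p, p = airyMoment (-1/2) 0 A := ⟨_, rfl⟩
  obtain ⟨q0, hq0⟩ : ∃ q, q = airyMoment (1/2) 0 A := ⟨_, rfl⟩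
  have hq00 : 0 ≤ q0 := hq0 ▸ airyMoment.nonneg _ _ _
  have hqn : 0 ≤ q := hq ▸ airyMoment.nonneg _ _ _
  have hrn : 0 ≤ r := hr ▸ airyMoment.nonneg _ _ _
  have hqC : q0 ≤ C1 := hq0 ▸ h1 A hA
  have hqC' : q ≤ C1 := (hq ▸ airyMoment.le_kappa_zero (by norm_num) hκ0 hA0).trans (h1 A hA)
  have hrC' : r ≤ C2 := (hr ▸ airyMoment.le_kappa_zero (by norm_num) hκ0 hA0).trans (h2 A hA)
  have hpp : p ≤ p0 := by rw [hp, hp0]; exact airyMoment.le_kappa_zero (by norm_num) hκ0 hA0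
  have hqq : q ≤ q0 := by rw [hq, hq0]; exact airyMoment.le_kappa_zero (by norm_num) hκ0 hA0
  have hp0C : p0 ≤ C0 := hp0 ▸ h0 A hA
  have dp : p0 - p ≤ κ * C3 := by
    rw [hp, hp0]
    exact (airyMoment.kappa_zero_sub_le (by norm_num) hκ0 hA0).trans (by gcongr; exact h3 A hA)
  have dq : q0 - q ≤ κ * C4 := by
    rw [hq, hq0]
    exact (airyMoment.kappa_zero_sub_le (by norm_num) hκ0 hA0).trans (by gcongr; exact h4 A hA)
  have hsA : 0 < √A := Real.sqrt_pos.2 hA0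
  have hsAA : √A * √A = A := Real.mul_self_sqrt hA0.le
  have ep0 : p0 = √Real.pi / √A := by
    rw [hp0, airyMoment.kappa_zero (by norm_num) hA0, show (-1/2 + 1 : ℝ) = 1/2 by norm_num,
      Real.Gamma_one_half_eq, Real.rpow_neg hA0.le, ← Real.sqrt_eq_rpow]
    field_simp
  have eq0 : q0 = √Real.pi / (2 * (A * √A)) := by
    rw [hq0, airyMoment.kappa_zero (by norm_num) hA0, Real.Gamma_add_one (by norm_num),
      Real.Gamma_one_half_eq, Real.rpow_neg hA0.le, Real.rpow_add_one hA0.ne', ← Real.sqrt_eq_rpow]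
    field_simp
  have hp01 : 1 ≤ p0 := by
    rw [ep0, one_le_div hsA]
    exact Real.sqrt_le_sqrt (by linarith [Real.pi_gt_three, hA.2])
  have hκC : κ * C3 ≤ 1/2 := by
    have : κ * (2 * (C3 + 1)) ≤ 1 := by
      rw [← le_div_iff₀ (by positivity)]; exact hκ.2
    nlinarith
  have hp12 : 1/2 ≤ p := by linarith
  have hppos : 0 < p := by linarith
  have ip : 1 / p ≤ 2 := by rw [div_le_iff₀ hppos]; linarith
  have ip0 : 1 / p0 ≤ 1 := by rw [div_le_one (by linarith)]; exact hp01
  have d0 := airyMoment.hasDerivAt (s := -1/2) (by norm_num) hκ0 (.inl hA0)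
  have d1 := airyMoment.hasDerivAt (s := 1/2) (by norm_num) hκ0 (.inl hA0)
  rw [show (-1/2 + 1 : ℝ) = 1/2 by norm_num] at d0
  rw [show (1/2 + 1 : ℝ) = 3/2 by norm_num] at d1
  have hne : airyMoment (-1/2) κ A ≠ 0 := hp ▸ hppos.ne'
  refine ⟨?_, ?_, ?_, ?_, ?_⟩
  · refine ((hasDerivAt_const A (2 * √Real.pi)).div d0 hne).congr_deriv ?_
    rw [airySlope']; field_simp; ring
  · refine ((d1.div (d0.pow 2) (pow_ne_zero 2 hne)).const_mul (2 * √Real.pi)).congr_deriv ?_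
    rw [airySlope'']; simp only [Pi.pow_apply]; push_cast; field_simp; ring
  · rw [airySlope, ← hp]
    have e : 2 * √Real.pi / p - 2 * √A = 2 * √Real.pi * ((p0 - p) * (1 / p) * (1 / p0)) := by
      have : √A = √Real.pi / p0 := by rw [ep0]; field_simp
      rw [this]; field_simp
    rw [e, abs_of_nonneg (by have : 0 ≤ p0 - p := by linarith
                             positivity)]
    have : (p0 - p) * (1 / p) * (1 / p0) ≤ κ * C3 * 2 * 1 := by gcongr
    calc _ ≤ 2 * √Real.pi * (κ * C3 * 2 * 1) := by gcongr
      _ = 2 * √Real.pi * (2 * C3) * κ := by ring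
      _ ≤ _ := by
        gcongr
        rw [add_assoc]
        exact le_add_of_nonneg_right (by positivity)
  · rw [airySlope', ← hp, ← hq]
    have e : 2 * √Real.pi * (q / p ^ 2) - 1 / √A = 2 * √Real.pi * (-((q0 - q) * (1 / p) ^ 2) +
        q0 * ((p0 - p) * (p0 + p)) * ((1 / p) ^ 2 * (1 / p0) ^ 2)) := by
      have : 1 / √A = 2 * √Real.pi * (q0 / p0 ^ 2) := by
        rw [ep0, eq0]; field_simp
        linarith
      rw [this]; field_simp; ring
    rw [e, abs_mul, abs_of_nonneg (a := 2 * √Real.pi) (by positivity)]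
    have a1 : (q0 - q) * (1 / p) ^ 2 ≤ κ * C4 * 2 ^ 2 := by gcongr
    have a1' : 0 ≤ (q0 - q) * (1 / p) ^ 2 := by
      have : 0 ≤ q0 - q := by linarith
      positivity
    have n0 : 0 ≤ p0 - p := by linarith
    have a2 : q0 * ((p0 - p) * (p0 + p)) * ((1 / p) ^ 2 * (1 / p0) ^ 2) ≤
        C1 * ((κ * C3) * (C0 + C0)) * (2 ^ 2 * 1 ^ 2) := by gcongr; linarith
    have a2' : 0 ≤ q0 * ((p0 - p) * (p0 + p)) * ((1 / p) ^ 2 * (1 / p0) ^ 2) := by positivity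
    calc _ ≤ 2 * √Real.pi * (κ * C4 * 2 ^ 2 + C1 * ((κ * C3) * (C0 + C0)) * (2 ^ 2 * 1 ^ 2)) := by
          gcongr
          rw [abs_le]; constructor <;> linarith
      _ = 2 * √Real.pi * (4 * C4 + C1 * (C3 * (2 * C0)) * 4) * κ := by ring
      _ ≤ _ := by
        gcongr
        rw [add_assoc, add_left_comm]
        exact le_add_of_nonneg_right (by positivity)
  · rw [airySlope'', ← hp, ← hq, ← hr]
    have e : 2 * √Real.pi * (2 * q ^ 2 / p ^ 3 - r / p ^ 2) =
        2 * √Real.pi * (2 * q ^ 2 * (1 / p) ^ 3 - r * (1 / p) ^ 2) := by field_simp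
    rw [e, abs_mul, abs_of_nonneg (a := 2 * √Real.pi) (by positivity)]
    have a1 : 2 * q ^ 2 * (1 / p) ^ 3 ≤ 2 * C1 ^ 2 * 2 ^ 3 := by gcongr
    have a2 : r * (1 / p) ^ 2 ≤ C2 * 2 ^ 2 := by gcongr
    have a1' : 0 ≤ 2 * q ^ 2 * (1 / p) ^ 3 := by positivity
    have a2' : 0 ≤ r * (1 / p) ^ 2 := by positivity
    calc _ ≤ 2 * √Real.pi * (2 * C1 ^ 2 * 8 + C2 * 4) := by
          gcongr
          rw [abs_le]; constructor <;> linarith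
      _ ≤ _ := le_add_of_nonneg_left (by positivity)

/-- Pointwise values at `x` entering the slope `V` and its derivative: `z = √x`, `s = √(x - α)`,
their inverses, the derivatives `f₁, f₂` of the half-wave phase and the errors `e, e'` in the
asymptotics of the Airy slope. -/
structure SlopePoint (α x z s iz is f₁ f₂ e e' δ : ℝ) : Prop where
  α0 : 0 ≤ α
  α1 : α ≤ 1/4
  x0 : 9/20 ≤ x
  x1 : x ≤ 2
  z0 : 0 < z
  s0 : 0 < s
  zz : z * z = x
  ss : s * s = x - α
  hiz : z * iz = 1
  his : s * is = 1
  f1 : 49/100 ≤ f₁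
  f1' : f₁ ≤ 1/2
  f2 : |f₂| ≤ 1/1000
  he : |e| ≤ δ
  he' : |e'| ≤ δ
  hδ : δ ≤ 1/1000

namespace SlopePoint
variable {α x z s iz is f₁ f₂ e e' δ : ℝ}

lemma basic (h : SlopePoint α x z s iz is f₁ f₂ e e' δ) :
    67/100 ≤ z ∧ z ≤ 1415/1000 ∧ 44/100 ≤ s ∧ s ≤ z ∧ 2/3 * z ≤ s ∧
    7/10 ≤ iz ∧ iz ≤ 3/2 ∧ 7/10 ≤ is ∧ is ≤ 12/5 ∧ is ≤ 3/2 * iz := by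
  have := h.z0; have := h.s0; have := h.zz; have := h.ss; have := h.x0; have := h.x1
  have := h.α0; have := h.α1; have := h.hiz; have := h.his
  have hz1 : 67/100 ≤ z := by nlinarith
  have hz2 : z ≤ 1415/1000 := by nlinarith
  have hs1 : 44/100 ≤ s := by nlinarith
  have hs2 : s ≤ z := by nlinarith
  have hs3 : 2/3 * z ≤ s := by nlinarith
  have hiz0 : 0 < iz := by
    by_contra hn
    push Not at hn
    nlinarith
  have his0 : 0 < is := by
    by_contra hn
    push Not at hn
    nlinarith
  refine ⟨hz1, hz2, hs1, hs2, hs3, by nlinarith, by nlinarith, by nlinarith, by nlinarith, ?_⟩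
  have h1 : 2/3 * z * is ≤ s * is := by gcongr
  have h2 : 2/3 * z * is * iz ≤ s * is * iz := by gcongr
  have h3 : z * is * iz = is := by linear_combination is * h.hiz
  nlinarith

lemma slope_lower (h : SlopePoint α x z s iz is f₁ f₂ e e' δ) {T : ℝ} (hT : |T| ≤ 1) {N : ℤ}
    (hN : |N| ≤ 2) :
    (0 ≤ N → 3/20 ≤ -(T * f₂ - N * (iz + e') - is / 2)) ∧
    (N ≤ -1 → 3/20 ≤ T * f₂ - N * (iz + e') - is / 2) := by
  obtain ⟨b1, b2, b3, b4, b5, b6, b7, b8, b9, b10⟩ := h.basic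
  have hT2 : |T * f₂| ≤ 1/1000 := by
    rw [abs_mul]; nlinarith [h.f2, abs_nonneg T, abs_nonneg f₂]
  have h1 := abs_le.1 hT2
  have h2 := abs_le.1 (h.he'.trans h.hδ)
  have hN' := abs_le.1 hN
  obtain ⟨hN1, hN2⟩ := hN'
  constructor <;> intro h0
  · interval_cases N <;> push_cast <;> linarith
  · interval_cases N <;> push_cast <;> linarith

lemma slope_abs (h : SlopePoint α x z s iz is f₁ f₂ e e' δ) {T : ℝ} (hT : |T| ≤ 1) {N : ℤ}
    (hN : |N| ≤ 2) : |T * f₁ - N * (2 * z + e) - s| ≤ 10 ∧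
      |T * f₂ - N * (iz + e') - is / 2| ≤ 10 := by
  obtain ⟨b1, b2, b3, b4, b5, b6, b7, b8, b9, b10⟩ := h.basic
  have hT1 : |T * f₁| ≤ 1/2 := by
    rw [abs_mul, abs_of_nonneg (by linarith [h.f1] : 0 ≤ f₁)]
    nlinarith [h.f1, h.f1', abs_nonneg T]
  have hT2 : |T * f₂| ≤ 1/1000 := by
    rw [abs_mul]; nlinarith [h.f2, abs_nonneg T, abs_nonneg f₂]
  have h1 := abs_le.1 hT2
  have h0 := abs_le.1 hT1
  have h2 := abs_le.1 (h.he'.trans h.hδ)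
  have h3 := abs_le.1 (h.he.trans h.hδ)
  obtain ⟨hN1, hN2⟩ := abs_le.1 hN
  rw [abs_le, abs_le]
  interval_cases N <;> push_cast <;> refine ⟨⟨?_, ?_⟩, ?_, ?_⟩ <;> linarith

/-- The slope is uniformly far from the square root when `N ∉ {0, -1}`. -/
lemma far (h : SlopePoint α x z s iz is f₁ f₂ e e' δ) {T X : ℝ} (hT : |T| ≤ 1) (hX : 0 ≤ X) {N : ℤ}
    (hN : |N| ≤ 2) (hN0 : N ≠ 0) (hN1 : N ≠ -1) :
    1/4 ≤ (T * f₁ - N * (2 * z + e) - s) ^ 2 + X - x := by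
  obtain ⟨b1, b2, b3, b4, b5, b6, b7, b8, b9, b10⟩ := h.basic
  have hT1 : |T * f₁| ≤ 1/2 := by
    rw [abs_mul, abs_of_nonneg (by linarith [h.f1] : 0 ≤ f₁)]
    nlinarith [h.f1, h.f1', abs_nonneg T]
  have h0 := abs_le.1 hT1
  have h3 := abs_le.1 (h.he.trans h.hδ)
  have hzz := h.zz
  have key : z + 1/2 ≤ |T * f₁ - N * (2 * z + e) - s| := by
    obtain ⟨hNl, hNu⟩ := abs_le.1 hN
    rw [le_abs]
    interval_cases N
    · left; push_cast; linarith
    · exact absurd rfl hN1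
    · exact absurd rfl hN0
    · right; push_cast; linarith
    · right; push_cast; linarith
  have : (z + 1/2) ^ 2 ≤ (T * f₁ - N * (2 * z + e) - s) ^ 2 := by
    rw [← sq_abs (T * f₁ - N * (2 * z + e) - s)]
    gcongr
  nlinarith

lemma zero_case (h : SlopePoint α x z s iz is f₁ f₂ e e' δ) {T : ℝ} (hT : |T| ≤ 1) :
    2 * (T * f₁ - s) * (T * f₂ - is / 2) - 1 = -T * (f₁ * is - 2 * T * f₁ * f₂ + 2 * s * f₂) ∧
    1/10 ≤ f₁ * is - 2 * T * f₁ * f₂ + 2 * s * f₂ := by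
  obtain ⟨b1, b2, b3, b4, b5, b6, b7, b8, b9, b10⟩ := h.basic
  have h1 := abs_le.1 h.f2
  have hf := h.f1
  have hf' := h.f1'
  have hTf : |T * f₁ - s| ≤ 2 := by
    have hT1 : |T * f₁| ≤ 1/2 := by
      rw [abs_mul, abs_of_nonneg (by linarith [h.f1] : 0 ≤ f₁)]
      nlinarith [h.f1, h.f1', abs_nonneg T]
    have h0 := abs_le.1 hT1
    rw [abs_le]; constructor <;> linarith
  refine ⟨by linear_combination h.his, ?_⟩
  have h3 : |(T * f₁ - s) * f₂| ≤ 2 * (1/1000) := by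
    rw [abs_mul]; exact mul_le_mul hTf h.f2 (abs_nonneg _) (by norm_num)
  have h4 := abs_le.1 h3
  nlinarith

lemma derivative_identity (h : SlopePoint α x z s iz is f₁ f₂ e e' δ) :
    2 * (2 * z - s) * (iz - is / 2) - 1 = -2 * (z - s) ^ 2 * (iz * is) := by
  linear_combination (4 + 2 * z * is - 4 * s * is) * h.hiz + (1 + 2 * s * iz - 4) * h.his

lemma neg_one_case (h : SlopePoint α x z s iz is f₁ f₂ e e' δ) {T X : ℝ} (hT : |T| ≤ 1)
    (hX : 0 ≤ X) (hδT : δ ≤ |T| / 1000) :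
    (T < 0 → |T| / 10 ≤ -1 * (2 * (T * f₁ + (2 * z + e) - s) * (T * f₂ + (iz + e') - is / 2) - 1)) ∧
    (0 < T → |T| / 10 ≤ (T * f₁ + (2 * z + e) - s) ^ 2 + X - x ∧
      |2 * (T * f₁ + (2 * z + e) - s) * (T * f₂ + (iz + e') - is / 2) - 1| ≤
        4 * ((T * f₁ + (2 * z + e) - s) ^ 2 + X - x)) := by
  obtain ⟨b1, b2, b3, b4, b5, b6, b7, b8, b9, b10⟩ := h.basic
  have hD := h.derivative_identity
  obtain ⟨ρ, hρ⟩ : ∃ ρ, ρ = 2 * z - s := ⟨_, rfl⟩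
  obtain ⟨σ, hσ⟩ : ∃ σ, σ = iz - is / 2 := ⟨_, rfl⟩
  have hα : (z - s) * (z + s) = α := by linear_combination h.zz - h.ss
  have hα0 := h.α0
  have hR : α ≤ ρ ^ 2 - x := by
    have : ρ ^ 2 - x = (z - s) * (3 * z - s) := by rw [hρ, ← h.zz]; ring
    nlinarith
  have hzs : z - s ≤ α := by nlinarith
  have hp : 0 ≤ iz * is ∧ iz * is ≤ 18/5 := ⟨by nlinarith, by nlinarith⟩
  have hq : 0 ≤ (z - s) ^ 2 ∧ (z - s) ^ 2 ≤ 12/25 * α := ⟨sq_nonneg _, by nlinarith⟩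
  rw [← hρ, ← hσ] at hD
  have hD0 : 2 * ρ * σ - 1 ≤ 0 := by nlinarith [mul_nonneg hq.1 hp.1]
  have hD1 : -(7/2 * α) ≤ 2 * ρ * σ - 1 := by
    have : (z - s) ^ 2 * (iz * is) ≤ 12/25 * α * (18/5) :=
      mul_le_mul hq.2 hp.2 hp.1 (by positivity)
    nlinarith
  have r1 : 67/100 ≤ ρ := by linarith
  have r2 : ρ ≤ 189/100 := by linarith
  have s1 : 7/40 ≤ σ := by linarith
  have s2 : σ ≤ 3/2 := by linarith
  have hg : |T * f₂ + e'| ≤ |T| / 500 := by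
    have : |T * f₂| ≤ |T| * (1/1000) := by
      rw [abs_mul]; exact mul_le_mul_of_nonneg_left h.f2 (abs_nonneg _)
    have := abs_add_le (T * f₂) e'
    have := h.he'
    linarith
  obtain ⟨g, hg'⟩ : ∃ g, g = T * f₂ + e' := ⟨_, rfl⟩
  obtain ⟨q, hq'⟩ : ∃ q, q = T * f₁ + e := ⟨_, rfl⟩
  have e1 : T * f₁ + (2 * z + e) - s = q + ρ := by rw [hq', hρ]; ring
  have e2 : T * f₂ + (iz + e') - is / 2 = g + σ := by rw [hg', hσ]; ring
  rw [e1, e2]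
  rw [← hg'] at hg
  have hga := abs_le.1 hg
  have hea := abs_le.1 (h.he.trans hδT)
  have hexp : 2 * (q + ρ) * (g + σ) - 1 = (2 * ρ * σ - 1) + 2 * ρ * g + 2 * q * (g + σ) := by ring
  have hf := h.f1
  have hf' := h.f1'
  rw [hexp]
  refine ⟨fun hT0 ↦ ?_, fun hT0 ↦ ?_⟩
  · rw [abs_of_neg hT0] at *
    have hqu : q ≤ 489/1000 * T := by
      have : T * f₁ ≤ T * (49/100) := mul_le_mul_of_nonpos_left hf hT0.le
      rw [hq']; linarith
    have : q * (g + σ) ≤ 489/1000 * T * (g + σ) := by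
      apply mul_le_mul_of_nonneg_right hqu; linarith
    have h3 : 489/1000 * T * (g + σ) ≤ 489/1000 * T * (173/1000) := by
      apply mul_le_mul_of_nonpos_left <;> linarith
    have h4 : ρ * g ≤ 189/100 * (-T/500) :=
      (mul_le_mul_of_nonneg_left hga.2 (by linarith)).trans
        (mul_le_mul_of_nonneg_right r2 (by linarith))
    linarith
  · rw [abs_of_pos hT0] at *
    have hql : 489/1000 * T ≤ q := by
      have : T * (49/100) ≤ T * f₁ := mul_le_mul_of_nonneg_left hf hT0.le
      rw [hq']; linarith
    have hqu : q ≤ 501/1000 * T := by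
      have : T * f₁ ≤ T * (1/2) := mul_le_mul_of_nonneg_left hf' hT0.le
      rw [hq']; linarith
    have hRl : α + 13/20 * T ≤ (q + ρ) ^ 2 + X - x := by
      have : 489/1000 * T * (67/100) ≤ q * ρ :=
        mul_le_mul hql r1 (by norm_num) (by linarith)
      linarith [sq_nonneg q, (by ring : (q + ρ) ^ 2 = q ^ 2 + 2 * (q * ρ) + ρ ^ 2)]
    refine ⟨by linarith, ?_⟩
    have h4 : |ρ * g| ≤ 189/100 * (T/500) := by
      rw [abs_mul, abs_of_pos (by linarith : 0 < ρ)]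
      exact mul_le_mul r2 hg (abs_nonneg _) (by norm_num)
    have h5 := abs_le.1 h4
    have h6 : 0 ≤ q * (g + σ) := by apply mul_nonneg <;> linarith
    have h7 : q * (g + σ) ≤ 501/1000 * T * (1502/1000) := by
      apply mul_le_mul hqu _ _ (by linarith) <;> linarith
    rw [abs_le]; constructor <;> linarith

end SlopePoint

/-- The half-wave travel phase `(A - 1) / (√(1 + γA) + √(1 + γ))`, in rationalised form. -/
noncomputable def travel (γ A : ℝ) : ℝ := (√(1 + γ * A) - √(1 + γ)) / γ

lemma travel_eq {γ A : ℝ} (hγ : 0 < γ) (hA : 0 ≤ A) :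
    (A - 1) / (√(1 + γ * A) + √(1 + γ)) = travel γ A := by
  have h1 : 0 < 1 + γ * A := by positivity
  have h2 : 0 < 1 + γ := by positivity
  have h3 := Real.sqrt_pos.2 h1
  have h4 := Real.sqrt_pos.2 h2
  rw [travel, div_eq_div_iff (by positivity) hγ.ne']
  linear_combination Real.mul_self_sqrt h2.le - Real.mul_self_sqrt h1.le

lemma hasDerivAt_travel {γ A : ℝ} (hγ : 0 < γ) (hA : 0 ≤ A) :
    HasDerivAt (travel γ) (1 / (2 * √(1 + γ * A))) A ∧
    HasDerivAt (fun x ↦ 1 / (2 * √(1 + γ * x))) (-γ / (4 * √(1 + γ * A) ^ 3)) A ∧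
    HasDerivAt (fun x ↦ -γ / (4 * √(1 + γ * x) ^ 3)) (3 * γ ^ 2 / (8 * √(1 + γ * A) ^ 5)) A := by
  have h1 : 0 < 1 + γ * A := by positivity
  have h3 := Real.sqrt_pos.2 h1
  have hd : HasDerivAt (fun x ↦ √(1 + γ * x)) (γ / (2 * √(1 + γ * A))) A := by
    have : HasDerivAt (fun x ↦ 1 + γ * x) γ A := by
      simpa using ((hasDerivAt_id A).const_mul γ).const_add 1
    exact this.sqrt h1.ne'
  refine ⟨?_, ?_, ?_⟩
  · refine ((hd.sub_const (√(1 + γ))).div_const γ).congr_deriv ?_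
    field_simp
  · have := (hd.const_mul 2).inv (by positivity)
    simp only [one_div]
    refine this.congr_deriv ?_
    field_simp
    ring
  · have := (((hd.pow 3).const_mul 4).inv (by simp only [Pi.pow_apply]; positivity)).const_mul (-γ)
    simp only [div_eq_mul_inv]
    refine this.congr_deriv ?_
    simp only [Pi.pow_apply]
    push_cast
    field_simp
    ring

lemma travel_bounds {γ A : ℝ} (hγ : 0 < γ) (hγ' : γ ≤ 1 / 1000) (hA : 0 ≤ A) (hA' : A ≤ 2) :
    49 / 100 ≤ 1 / (2 * √(1 + γ * A)) ∧ 1 / (2 * √(1 + γ * A)) ≤ 1 / 2 ∧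
    |-γ / (4 * √(1 + γ * A) ^ 3)| ≤ 1 / 1000 ∧ |3 * γ ^ 2 / (8 * √(1 + γ * A) ^ 5)| ≤ 1 := by
  have h1 : 1 ≤ √(1 + γ * A) := by
    rw [Real.one_le_sqrt]
    nlinarith [mul_nonneg hγ.le hA]
  have h2 : √(1 + γ * A) ≤ 101 / 100 := by
    rw [Real.sqrt_le_left (by norm_num)]
    nlinarith
  generalize √(1 + γ * A) = r at *
  have h3 : 1 ≤ r ^ 3 := one_le_pow₀ h1
  have h5 : 1 ≤ r ^ 5 := one_le_pow₀ h1
  refine ⟨?_, ?_, ?_, ?_⟩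
  · rw [le_div_iff₀ (by positivity)]; linarith
  · rw [div_le_iff₀ (by positivity)]; linarith
  · rw [abs_div, abs_neg, abs_of_pos hγ, abs_of_pos (by positivity), div_le_iff₀ (by positivity)]
    linarith
  · rw [abs_of_nonneg (by positivity), div_le_iff₀ (by positivity)]
    nlinarith

lemma hasDerivAt_sqrt_shift {α A : ℝ} (hA : 0 < A - α) :
    HasDerivAt (fun x ↦ 2 / 3 * ((x - α) * √(x - α))) (√(A - α)) A ∧
    HasDerivAt (fun x ↦ √(x - α)) ((√(A - α))⁻¹ / 2) A ∧
    HasDerivAt (fun x ↦ (√(x - α))⁻¹ / 2) (-(1 / (4 * √(A - α) ^ 3))) A := by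
  have h3 := Real.sqrt_pos.2 hA
  have hi : HasDerivAt (fun x ↦ x - α) 1 A := (hasDerivAt_id A).sub_const α
  have hd : HasDerivAt (fun x ↦ √(x - α)) ((√(A - α))⁻¹ / 2) A := by
    refine (hi.sqrt hA.ne').congr_deriv ?_
    field_simp
  refine ⟨?_, hd, ?_⟩
  · refine ((hi.mul hd).const_mul (2 / 3)).congr_deriv ?_
    have := Real.sq_sqrt hA.le
    field_simp
    linear_combination -this
  · refine ((hd.inv h3.ne').div_const 2).congr_deriv ?_
    field_simp
    ring

/-- The phase in `A` left after integrating out `S`. -/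
noncomputable def slopePhase (γ α T : ℝ) (N : ℤ) (Φ : ℝ → ℝ) (A : ℝ) : ℝ :=
  T * travel γ A - N * Φ A - 2 / 3 * ((A - α) * √(A - α))

theorem slopePhase_good : ∃ κ₁ C B : ℝ, 0 < κ₁ ∧ 0 ≤ C ∧ 0 ≤ B ∧ ∀ κ γ α T : ℝ, ∀ N : ℤ, ∀ Φ : ℝ → ℝ,
    κ ∈ Set.Icc 0 κ₁ → 0 < γ → γ ≤ 1 / 1000 → α ∈ Set.Icc (0 : ℝ) (1 / 4) → |T| ≤ 1 → |N| ≤ 2 →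
    (∀ A ∈ Set.Icc (9 / 20 : ℝ) 2, HasDerivAt Φ (airySlope κ A) A) →
    ∃ (s : ℝ) (V V' V'' : ℝ → ℝ),
      IsGoodSlope (9 / 20) 2 s (3 / 20) B (slopePhase γ α T N Φ) V V' V'' ∧
      (∀ x ∈ Set.Icc (9 / 20 : ℝ) 2, |V x| ≤ B) ∧
      ∀ X, 0 ≤ X → T ≠ 0 → C * κ ≤ |T| → IsPhaseGood B X (|T| / 10) V V' := by
  obtain ⟨κ₀, C, hκ₀, hC, hb⟩ := airySlope_bounds
  refine ⟨min κ₀ (1 / (1000 * (C + 1))), 1000 * C, 1000 + 2 * C, by positivity, by positivity,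
    by positivity, ?_⟩
  intro κ γ α T N Φ hκ hγ hγ' hα hT hN hΦ
  have hκ0 := hκ.1
  have hκ1 : κ ≤ κ₀ := hκ.2.trans (min_le_left _ _)
  have hκC : C * κ ≤ 1 / 1000 := by
    have h1 : κ ≤ 1 / (1000 * (C + 1)) := hκ.2.trans (min_le_right _ _)
    rw [le_div_iff₀ (by positivity)] at h1
    nlinarith
  have hα0 := hα.1
  have hα1 := hα.2
  have hN2 : |(N : ℝ)| ≤ 2 := by exact_mod_cast hN
  have hsp : ∀ x ∈ Set.Icc (9 / 20 : ℝ) 2, SlopePoint α x (√x) (√(x - α)) (1 / √x) (√(x - α))⁻¹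
      (1 / (2 * √(1 + γ * x))) (-γ / (4 * √(1 + γ * x) ^ 3)) (airySlope κ x - 2 * √x)
      (airySlope' κ x - 1 / √x) (C * κ) := by
    intro x hx
    obtain ⟨hx0, hx1⟩ := hx
    have := hb κ ⟨hκ0, hκ1⟩ x ⟨hx0, hx1⟩
    have ht := travel_bounds hγ hγ' (by linarith : 0 ≤ x) hx1
    have h1 : 0 < √x := Real.sqrt_pos.2 (by linarith)
    have h2 : 0 < √(x - α) := Real.sqrt_pos.2 (by linarith)
    exact
      { α0 := hα0, α1 := hα1, x0 := hx0, x1 := hx1, z0 := h1, s0 := h2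
        zz := Real.mul_self_sqrt (by linarith)
        ss := Real.mul_self_sqrt (by linarith)
        hiz := by field_simp
        his := by field_simp
        f1 := ht.1, f1' := ht.2.1, f2 := ht.2.2.1
        he := this.2.2.1, he' := this.2.2.2.1, hδ := hκC }
  obtain ⟨V, hV⟩ : ∃ V : ℝ → ℝ, V = fun x ↦
    T * (1 / (2 * √(1 + γ * x))) - N * airySlope κ x - √(x - α) := ⟨_, rfl⟩
  obtain ⟨V', hV'⟩ : ∃ V' : ℝ → ℝ, V' = fun x ↦
    T * (-γ / (4 * √(1 + γ * x) ^ 3)) - N * airySlope' κ x - (√(x - α))⁻¹ / 2 := ⟨_, rfl⟩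
  obtain ⟨V'', hV''⟩ : ∃ V'' : ℝ → ℝ, V'' = fun x ↦
    T * (3 * γ ^ 2 / (8 * √(1 + γ * x) ^ 5)) - N * airySlope'' κ x -
      -(1 / (4 * √(x - α) ^ 3)) := ⟨_, rfl⟩
  have eV : ∀ x, V x = T * (1 / (2 * √(1 + γ * x))) - N * (2 * √x + (airySlope κ x - 2 * √x))
      - √(x - α) := fun x ↦ by rw [hV]; ring
  have eV' : ∀ x, V' x = T * (-γ / (4 * √(1 + γ * x) ^ 3))
      - N * (1 / √x + (airySlope' κ x - 1 / √x)) - (√(x - α))⁻¹ / 2 := fun x ↦ by rw [hV']; ring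
  refine ⟨if 0 ≤ N then -1 else 1, V, V', V'', ?_, ?_, ?_⟩
  · refine ⟨by norm_num, by split_ifs <;> norm_num, ?_, ?_, ?_, ?_, ?_, ?_⟩
    · intro x hx
      have ht := hasDerivAt_travel hγ (by linarith [hx.1] : 0 ≤ x)
      have hs := hasDerivAt_sqrt_shift (by linarith [hx.1] : 0 < x - α)
      rw [hV]
      exact ((ht.1.const_mul T).sub ((hΦ x hx).const_mul (N : ℝ))).sub hs.1
    · intro x hx
      have ht := hasDerivAt_travel hγ (by linarith [hx.1] : 0 ≤ x)
      have hs := hasDerivAt_sqrt_shift (by linarith [hx.1] : 0 < x - α)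
      rw [hV, hV']
      exact ((ht.2.1.const_mul T).sub ((hb κ ⟨hκ0, hκ1⟩ x hx).1.const_mul (N : ℝ))).sub hs.2.1
    · intro x hx
      have ht := hasDerivAt_travel hγ (by linarith [hx.1] : 0 ≤ x)
      have hs := hasDerivAt_sqrt_shift (by linarith [hx.1] : 0 < x - α)
      rw [hV', hV'']
      exact ((ht.2.2.const_mul T).sub ((hb κ ⟨hκ0, hκ1⟩ x hx).2.1.const_mul (N : ℝ))).sub hs.2.2
    · intro x hx
      have := (hsp x hx).slope_lower hT hN
      rw [eV' x]
      split_ifs with h0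
      · linarith [this.1 h0]
      · linarith [this.2 (by omega)]
    · intro x hx
      rw [eV' x]
      exact ((hsp x hx).slope_abs hT hN).2.trans (by linarith)
    · intro x hx
      have hx0 : 0 ≤ x := by linarith [hx.1]
      have b1 := (travel_bounds hγ hγ' hx0 hx.2).2.2.2
      have b2 := (hb κ ⟨hκ0, hκ1⟩ x hx).2.2.2.2
      have b3 := (hsp x hx).basic.2.2.1
      have b4 : (1 / (4 * √(x - α) ^ 3)) ≤ 100 := by
        have : (44 / 100) ^ 3 ≤ √(x - α) ^ 3 := by gcongr
        rw [div_le_iff₀ (by positivity)]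
        linarith
      have b5 : 0 ≤ (1 / (4 * √(x - α) ^ 3)) := by positivity
      rw [hV'']
      have a1 : |T * (3 * γ ^ 2 / (8 * √(1 + γ * x) ^ 5))| ≤ 1 * 1 := by
        rw [abs_mul]; exact mul_le_mul hT b1 (abs_nonneg _) (by norm_num)
      have a2 : |N * airySlope'' κ x| ≤ 2 * C := by
        rw [abs_mul]; exact mul_le_mul hN2 b2 (abs_nonneg _) (by norm_num)
      have a1' := abs_le.1 a1
      have a2' := abs_le.1 a2
      rw [abs_le]
      constructor <;> linarith
  · intro x hx
    rw [eV x]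
    exact ((hsp x hx).slope_abs hT hN).1.trans (by linarith)
  · intro X hX hT0 hCT
    have hTp : 0 < |T| := abs_pos.2 hT0
    have hIoo : ∀ x ∈ Set.Ioo (9 / 20 : ℝ) 2, x ∈ Set.Icc (9 / 20 : ℝ) 2 :=
      fun x hx ↦ Set.Ioo_subset_Icc_self hx
    by_cases hN0 : N = 0
    · left
      subst hN0
      refine ⟨if T < 0 then 1 else -1, by split_ifs <;> norm_num, fun x hx ↦ ?_⟩
      have := (hsp x (hIoo x hx)).zero_case hT
      rw [eV x, eV' x, Int.cast_zero, zero_mul, zero_mul, sub_zero, sub_zero, this.1]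
      split_ifs with h
      · rw [abs_of_neg h]; nlinarith [this.2]
      · rw [abs_of_nonneg (not_lt.1 h)]; nlinarith [this.2]
    by_cases hN1 : N = -1
    · subst hN1
      have hx1 : ∀ x ∈ Set.Ioo (9 / 20 : ℝ) 2, _ := fun x hx ↦
        (hsp x (hIoo x hx)).neg_one_case hT hX (by linarith)
      have eV1 : ∀ x, V x = T * (1 / (2 * √(1 + γ * x))) + (2 * √x + (airySlope κ x - 2 * √x))
          - √(x - α) := fun x ↦ by rw [eV x]; push_cast; ring
      have eV1' : ∀ x, V' x = T * (-γ / (4 * √(1 + γ * x) ^ 3))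
          + (1 / √x + (airySlope' κ x - 1 / √x)) - (√(x - α))⁻¹ / 2 := fun x ↦ by
        rw [eV' x]; push_cast; ring
      rcases lt_or_gt_of_ne hT0 with h | h
      · left
        refine ⟨-1, by norm_num, fun x hx ↦ ?_⟩
        rw [eV1, eV1']
        exact (hx1 x hx).1 h
      · right
        intro x hx
        have := (hx1 x hx).2 h
        rw [eV1, eV1']
        have h0 := le_abs_self ((T * (1 / (2 * √(1 + γ * x))) + (2 * √x + (airySlope κ x - 2 * √x))
          - √(x - α)) ^ 2 + X - x)
        refine ⟨this.1.trans h0, this.2.trans ?_⟩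
        exact mul_le_mul (by linarith) h0 (by linarith [this.1]) (by positivity)
    · right
      intro x hx
      have h1 := (hsp x (hIoo x hx)).far hT hX hN hN0 hN1
      have h2 := (hsp x (hIoo x hx)).slope_abs hT hN
      rw [← eV x] at h1 h2
      rw [← eV' x] at h2
      have h0 := le_abs_self (V x ^ 2 + X - x)
      refine ⟨by linarith, ?_⟩
      have h3 : |2 * V x * V' x - 1| ≤ 201 := by
        have : |V x * V' x| ≤ 10 * 10 := by
          rw [abs_mul]; exact mul_le_mul h2.1 h2.2 (abs_nonneg _) (by norm_num)
        have := abs_le.1 this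
        rw [abs_le]; constructor <;> linarith
      nlinarith

/-- Localised Airy integral `∫ c(S) e^{iμ(S³/3 - S(A - α))} dS`. -/
noncomputable def airyInt (c : ℝ → ℝ) (μ α A : ℝ) : ℂ :=
  ∫ S in (-(3/2) : ℝ)..(3/2), (c S : ℂ) * cis (μ * (S ^ 3 / 3 - S * (A - α)))

/-- The integral in `(A, Υ, S)` at fixed frequency `η`, with `μ = λη`. -/
noncomputable def transInt (χ c ψ U : ℝ → ℝ) (μ X α : ℝ) : ℂ :=
  ∫ A in (9/20 : ℝ)..2, (ψ A : ℂ) * cis (μ * U A) * (airyInt χ μ X A * airyInt c μ α A)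

lemma cis_conj (θ : ℝ) : (starRingEnd ℂ) (cis θ) = cis (-θ) := by
  rw [cis, cis, ← Complex.exp_conj]
  simp

lemma intervalIntegral_conj (f : ℝ → ℂ) (a b : ℝ) :
    ∫ x in a..b, (starRingEnd ℂ) (f x) = (starRingEnd ℂ) (∫ x in a..b, f x) := by
  simp only [intervalIntegral, integral_conj, map_sub]

lemma continuous_airyInt {c : ℝ → ℝ} (hc : Continuous c) (μ α : ℝ) :
    Continuous (airyInt c μ α) := by
  apply intervalIntegral.continuous_parametric_intervalIntegral_of_continuous'
  exact (Complex.continuous_ofReal.comp (hc.comp continuous_snd)).mul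
    (continuous_cis.comp (by fun_prop))

lemma airyInt_conj (c : ℝ → ℝ) (μ α A : ℝ) :
    (starRingEnd ℂ) (airyInt c μ α A) = airyInt (fun x ↦ c (-x)) μ α A := by
  rw [airyInt, airyInt, ← intervalIntegral_conj]
  have := intervalIntegral.integral_comp_neg (a := -(3/2 : ℝ)) (b := 3/2)
    (fun S : ℝ ↦ (starRingEnd ℂ) ((c S : ℂ) * cis (μ * (S ^ 3 / 3 - S * (A - α)))))
  rw [neg_neg] at this
  rw [← this]
  congr 1
  ext S
  rw [map_mul, cis_conj, Complex.conj_ofReal]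
  congr 2
  ring

lemma transInt_conj (χ c ψ U : ℝ → ℝ) (μ X α : ℝ) :
    (starRingEnd ℂ) (transInt χ c ψ U μ X α) =
      transInt (fun x ↦ χ (-x)) (fun x ↦ c (-x)) ψ (fun A ↦ -U A) μ X α := by
  rw [transInt, transInt, ← intervalIntegral_conj]
  congr 1
  ext A
  rw [map_mul, map_mul, map_mul, cis_conj, Complex.conj_ofReal, airyInt_conj, airyInt_conj, mul_neg]

lemma airyInt_norm_le {c : ℝ → ℝ} {M : ℝ} (hM : ∀ x, |c x| ≤ M) (μ α A : ℝ) :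
    ‖airyInt c μ α A‖ ≤ 3 * M := by
  refine (intervalIntegral.norm_integral_le_of_norm_le_const (C := M) fun x _ ↦ ?_).trans ?_
  · rw [norm_mul, norm_cis, mul_one, Complex.norm_real]; exact hM x
  · rw [abs_of_pos (by norm_num)]; linarith

lemma airyInt_add {c d : ℝ → ℝ} (hc : Continuous c) (hd : Continuous d) (μ α A : ℝ) :
    airyInt (fun x ↦ c x + d x) μ α A = airyInt c μ α A + airyInt d μ α A := by
  rw [airyInt, airyInt, airyInt, ← intervalIntegral.integral_add]
  · simp only [Complex.ofReal_add, add_mul]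
  · exact ((Complex.continuous_ofReal.comp hc).mul
      (continuous_cis.comp (by fun_prop))).intervalIntegrable _ _
  · exact ((Complex.continuous_ofReal.comp hd).mul
      (continuous_cis.comp (by fun_prop))).intervalIntegrable _ _

lemma transInt_add {χ c d ψ U : ℝ → ℝ} (hχ : Continuous χ) (hc : Continuous c) (hd : Continuous d)
    (hψ : Continuous ψ) (hU : Continuous U) (μ X α : ℝ) :
    transInt χ (fun x ↦ c x + d x) ψ U μ X α = transInt χ c ψ U μ X α + transInt χ d ψ U μ X α := by
  have h : ∀ e : ℝ → ℝ, Continuous e → IntervalIntegrable (fun A ↦ (ψ A : ℂ) * cis (μ * U A) *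
      (airyInt χ μ X A * airyInt e μ α A)) volume (9/20 : ℝ) 2 := fun e he ↦
    ((((Complex.continuous_ofReal.comp hψ).mul (continuous_cis.comp (continuous_const.mul hU))).mul
      ((continuous_airyInt hχ μ X).mul (continuous_airyInt he μ α))).intervalIntegrable
      _ _)
  rw [transInt, transInt, transInt, ← intervalIntegral.integral_add (h c hc) (h d hd)]
  simp only [airyInt_add hc hd, mul_add]

lemma IsCutoff.norm_integral_le_of_nonstationary {c : ℝ → ℝ} {a b : ℝ} (hab : a ≤ b)
    (hc : IsCutoff c a b) {P p p' p'' : ℝ → ℝ} {μ m K C : ℝ} (hμ : 0 < μ) (hm : 0 < m)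
    (hC : 0 ≤ C) (hPc : Continuous P)
    (hP : ∀ x ∈ Set.Icc a b, HasDerivAt P (p x) x)
    (hp : ∀ x ∈ Set.Icc a b, HasDerivAt p (p' x) x)
    (hp' : ∀ x ∈ Set.Icc a b, HasDerivAt p' (p'' x) x)
    (hpm : ∀ x ∈ Set.Icc a b, m ≤ |p x|)
    (hp'C : ∀ x ∈ Set.Icc a b, |p' x| ≤ C * |p x|)
    (hp''C : ∀ x ∈ Set.Icc a b, |p'' x| ≤ C * |p x|)
    (b0 : ∀ x, |c x| ≤ K) (b1 : ∀ x, |_root_.deriv c x| ≤ K)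
    (b2 : ∀ x, |_root_.deriv (_root_.deriv c) x| ≤ K) :
    ‖∫ x in a..b, (c x : ℂ) * cis (μ * P x)‖ ≤
      K * (1 + 4 * C + 3 * C ^ 2) * (b - a) / (μ * m) ^ 2 := by
  have hcont : Continuous (fun x ↦ (c x : ℂ) * cis (μ * P x)) :=
    (Complex.continuous_ofReal.comp hc.1.continuous).mul
      (continuous_cis.comp (continuous_const.mul hPc))
  have key := nonstationary_twice hab hμ hm ((abs_nonneg _).trans (b0 0)) hC
    (H := fun y ↦ ∫ x in a..y, (c x : ℂ) * cis (μ * P x))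
    (w := fun x ↦ (c x : ℂ)) (w' := fun x ↦ ((_root_.deriv c x : ℝ) : ℂ))
    (w'' := fun x ↦ ((_root_.deriv (_root_.deriv c) x : ℝ) : ℂ))
    (fun x _ ↦ (intervalIntegral.integral_hasDerivAt_right (hcont.intervalIntegrable _ _)
      hcont.aestronglyMeasurable.stronglyMeasurableAtFilter hcont.continuousAt))
    hP hp hp' (fun x _ ↦ (hc.hasDerivAt x).ofReal_comp)
    (fun x _ ↦ (hc.deriv.hasDerivAt x).ofReal_comp) hpm hp'C hp''C
    (fun x _ ↦ by rw [Complex.norm_real]; exact b0 x)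
    (fun x _ ↦ by rw [Complex.norm_real]; exact b1 x)
    (fun x _ ↦ by rw [Complex.norm_real]; exact b2 x)
    (by simp [hc.2 a]) (by simp [hc.deriv.2 a]) (by simp [hc.2 b]) (by simp [hc.deriv.2 b])
  simpa using key

lemma IsCutoff.bounded₂ {c : ℝ → ℝ} {a b : ℝ} (hc : IsCutoff c a b) :
    ∃ M, 0 ≤ M ∧ (∀ x, |c x| ≤ M) ∧ (∀ x, |_root_.deriv c x| ≤ M) ∧
      ∀ x, |_root_.deriv (_root_.deriv c) x| ≤ M := by
  obtain ⟨M0, h0, b0⟩ := hc.bounded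
  obtain ⟨M1, h1, b1⟩ := hc.deriv.bounded
  obtain ⟨M2, h2, b2⟩ := hc.deriv.deriv.bounded
  exact ⟨M0 + M1 + M2, by positivity, fun x ↦ (b0 x).trans (by linarith),
    fun x ↦ (b1 x).trans (by linarith), fun x ↦ (b2 x).trans (by linarith)⟩

lemma IsCutoff.intervalIntegral_eq {c : ℝ → ℝ} {a b : ℝ} (hc : IsCutoff c a b) {a' b' : ℝ}
    (ha : a' ≤ a) (hb : b ≤ b') (f : ℝ → ℂ) :
    ∫ x in a'..b', (c x : ℂ) * f x = ∫ x in a..b, (c x : ℂ) * f x := by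
  have hs : Function.support (fun x ↦ (c x : ℂ) * f x) ⊆ Set.Ioo a b := by
    intro x hx
    by_contra hn
    exact hx (by simp [hc.2 x hn])
  rw [intervalIntegral.integral_eq_integral_of_support_subset (hs.trans Set.Ioo_subset_Ioc_self),
    intervalIntegral.integral_eq_integral_of_support_subset
      (hs.trans ((Set.Ioo_subset_Ioo ha hb).trans Set.Ioo_subset_Ioc_self))]

/-- Where the cutoff is supported near `S = 0` the phase is not stationary. -/
lemma airyInt_small {c : ℝ → ℝ} (hc : IsCutoff c (-(1/4)) (1/4)) :
    ∃ D, 0 ≤ D ∧ ∀ μ α A : ℝ, 0 < μ → α ≤ 1/4 → 9/20 ≤ A → ‖airyInt c μ α A‖ ≤ D / μ ^ 2 := by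
  obtain ⟨M, hM, b0, b1, b2⟩ := hc.bounded₂
  refine ⟨M * (1 + 4 * 20 + 3 * 20 ^ 2) * (1/4 - -(1/4)) * 10 ^ 2, by positivity, ?_⟩
  intro μ α A hμ hα hA
  have hp : ∀ x ∈ Set.Icc (-(1/4) : ℝ) (1/4), 1/10 ≤ |x ^ 2 - (A - α)| := by
    intro x hx
    rw [le_abs]; right; nlinarith [hx.1, hx.2]
  rw [airyInt, hc.intervalIntegral_eq (by norm_num) (by norm_num)]
  refine (hc.norm_integral_le_of_nonstationary (by norm_num) (p := fun x ↦ x ^ 2 - (A - α))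
    (p' := fun x ↦ 2 * x) (p'' := fun _ ↦ 2) (m := 1/10) (C := 20) hμ (by norm_num) (by norm_num)
    (by fun_prop) ?_ ?_ ?_ hp ?_ ?_ b0 b1 b2).trans (le_of_eq ?_)
  · intro x _
    refine ((((hasDerivAt_id x).pow 3).div_const 3).sub
      ((hasDerivAt_id x).mul_const (A - α))).congr_deriv ?_
    simp only [id]; push_cast; ring
  · intro x _
    refine (((hasDerivAt_id x).pow 2).sub_const (A - α)).congr_deriv ?_
    simp only [id]; push_cast; ring
  · intro x _
    simpa using (hasDerivAt_id x).const_mul (2 : ℝ)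
  · intro x hx
    have := hp x hx
    have : |2 * x| ≤ 1/2 := abs_le.2 ⟨by linarith [hx.1], by linarith [hx.2]⟩
    linarith
  · intro x hx
    have := hp x hx
    rw [abs_of_pos (by norm_num)]
    linarith
  · field_simp

lemma transInt_norm_le {χ c ψ U : ℝ → ℝ} {M M' K μ X α : ℝ} (hM : ∀ x, |ψ x| ≤ M)
    (hM' : ∀ x, |χ x| ≤ M') (hK : ∀ A, 9/20 ≤ A → ‖airyInt c μ α A‖ ≤ K) :
    ‖transInt χ c ψ U μ X α‖ ≤ 6 * M * M' * K := by
  have m0 := (abs_nonneg _).trans (hM 0)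
  have m1 := (abs_nonneg _).trans (hM' 0)
  have m2 := (norm_nonneg _).trans (hK 1 (by norm_num))
  refine (intervalIntegral.norm_integral_le_of_norm_le_const (C := M * (3 * M' * K))
    fun x hx ↦ ?_).trans ?_
  · rw [Set.uIoc_of_le (by norm_num)] at hx
    rw [norm_mul, norm_mul, norm_mul, norm_cis, mul_one, Complex.norm_real]
    have := airyInt_norm_le hM' μ X x
    have := hK x hx.1.le
    have := hM x
    gcongr
    exact this
  · rw [abs_of_pos (by norm_num)]
    have : 0 ≤ M * M' * K := by positivity
    nlinarith

lemma IsCutoff.split {χ : ℝ → ℝ} (hχ : IsCutoff χ (-(3/2)) (3/2)) : ∃ c₁ c₂ c₃ : ℝ → ℝ,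
    IsCutoff c₁ (1/8) (3/2) ∧ IsCutoff (fun x ↦ c₂ (-x)) (1/8) (3/2) ∧ Continuous c₂ ∧
    IsCutoff c₃ (-(1/4)) (1/4) ∧ χ = fun x ↦ (c₁ x + c₂ x) + c₃ x := by
  obtain ⟨θ, hθ⟩ : ∃ θ : ℝ → ℝ, θ = fun x ↦ Real.smoothTransition (8 * x - 1) := ⟨_, rfl⟩
  have hs : ContDiff ℝ (⊤ : ℕ∞) θ := by
    rw [hθ]
    exact Real.smoothTransition.contDiff.comp (by fun_prop)
  have h0 : ∀ x ≤ 1/8, θ x = 0 := fun x hx ↦ by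
    rw [hθ]; exact Real.smoothTransition.zero_of_nonpos (by linarith)
  have h1 : ∀ x, 1/4 ≤ x → θ x = 1 := fun x hx ↦ by
    rw [hθ]; exact Real.smoothTransition.one_of_one_le (by linarith)
  have hn : ContDiff ℝ (⊤ : ℕ∞) (fun x : ℝ ↦ -x) := by fun_prop
  refine ⟨fun x ↦ χ x * θ x, fun x ↦ χ x * θ (-x), fun x ↦ χ x * (1 - θ x - θ (-x)),
    ⟨hχ.1.mul hs, ?_⟩, ⟨?_, ?_⟩, ?_, ⟨?_, ?_⟩, ?_⟩
  · intro x hx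
    by_cases h : x ≤ 1/8
    · simp [h0 x h]
    · simp [hχ.2 x fun h' ↦ hx ⟨not_le.1 h, h'.2⟩]
  · exact (hχ.1.comp hn).mul (hs.comp (hn.comp hn))
  · intro x hx
    by_cases h : x ≤ 1/8
    · simp [h0 x h]
    · simp [hχ.2 (-x) fun h' ↦ hx ⟨not_le.1 h, by linarith [h'.1]⟩]
  · exact (hχ.1.mul (hs.comp hn)).continuous
  · exact hχ.1.mul ((contDiff_const.sub hs).sub (hs.comp hn))
  · intro x hx
    by_cases h : 1/4 ≤ x
    · simp [h1 x h, h0 (-x) (by linarith)]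
    · have : x ≤ -(1/4) := by
        by_contra! h'
        exact hx ⟨h', not_le.1 h⟩
      simp [h0 x (by linarith), h1 (-x) (by linarith)]
  · ext x; ring

lemma integral_mul_airyInt {c : ℝ → ℝ} (hc : Continuous c) {g : ℝ → ℂ} (hg : Continuous g)
    (μ α : ℝ) : ∫ A in (9/20 : ℝ)..2, g A * airyInt c μ α A =
      ∫ S in (-(3/2) : ℝ)..(3/2), (c S : ℂ) * cis (μ * (S ^ 3 / 3 + S * α)) *
        ∫ A in (9/20 : ℝ)..2, g A * cis (-(μ * (A * S))) := by
  have hInt : IntegrableOn (Function.uncurry fun A S : ℝ ↦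
      g A * ((c S : ℂ) * cis (μ * (S ^ 3 / 3 - S * (A - α)))))
      (Set.uIoc (9/20 : ℝ) 2 ×ˢ Set.uIoc (-(3/2) : ℝ) (3/2)) := by
    have hcont : Continuous (Function.uncurry fun A S : ℝ ↦
        g A * ((c S : ℂ) * cis (μ * (S ^ 3 / 3 - S * (A - α))))) :=
      (hg.comp continuous_fst).mul
        ((Complex.continuous_ofReal.comp (hc.comp continuous_snd)).mul
          (continuous_cis.comp (by fun_prop)))
    exact (hcont.continuousOn.integrableOn_compact (isCompact_uIcc.prod isCompact_uIcc)).mono_set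
      (Set.prod_mono Set.uIoc_subset_uIcc Set.uIoc_subset_uIcc)
  simp only [airyInt, ← intervalIntegral.integral_const_mul]
  rw [intervalIntegral_intervalIntegral_swap hInt]
  congr 1
  ext S
  congr 1
  ext A
  have : μ * (S ^ 3 / 3 - S * (A - α)) = μ * (S ^ 3 / 3 + S * α) + -(μ * (A * S)) := by ring
  rw [this, cis_add]
  ring

lemma transInt_eq_outer {χ c ψ U : ℝ → ℝ} (hχ : Continuous χ) (hc : Continuous c)
    (hψ : Continuous ψ) (hU : Continuous U) (μ X α : ℝ) :
    transInt χ c ψ U μ X α = ∫ Υ in (-(3/2) : ℝ)..(3/2),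
      (χ Υ : ℂ) * cis (μ * (Υ ^ 3 / 3 + Υ * X)) *
        ∫ A in (9/20 : ℝ)..2, (ψ A : ℂ) * cis (μ * U A) * airyInt c μ α A * cis (-(μ * (A * Υ))) := by
  rw [← integral_mul_airyInt hχ (g := fun A ↦ (ψ A : ℂ) * cis (μ * U A) * airyInt c μ α A) (((Complex.continuous_ofReal.comp hψ).mul
    (continuous_cis.comp (continuous_const.mul hU))).mul (continuous_airyInt hc μ α)) μ X]
  rw [transInt]
  congr 1
  ext A
  ring

lemma transInt_norm_le_of_inner {χ c ψ U : ℝ → ℝ} (hχ : Continuous χ) (hc : Continuous c)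
    (hψ : Continuous ψ) (hU : Continuous U) {μ X α M M' K : ℝ} (hM : ∀ x, |χ x| ≤ M)
    (hM' : ∀ x, |c x| ≤ M') (hK : ∀ Υ ∈ Set.Icc (-(3/2) : ℝ) (3/2), ∀ S ∈ Set.Icc (-(3/2) : ℝ) (3/2),
      ‖∫ A in (9/20 : ℝ)..2, (ψ A : ℂ) * cis (μ * (U A - A * (Υ + S)))‖ ≤ K) :
    ‖transInt χ c ψ U μ X α‖ ≤ 9 * M * M' * K := by
  have m0 := (abs_nonneg _).trans (hM 0)
  have m1 := (abs_nonneg _).trans (hM' 0)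
  have hsub : ∀ x ∈ Set.uIoc (-(3/2) : ℝ) (3/2), x ∈ Set.Icc (-(3/2) : ℝ) (3/2) := fun x hx ↦ by
    rw [Set.uIoc_of_le (by norm_num)] at hx
    exact ⟨hx.1.le, hx.2⟩
  rw [transInt_eq_outer hχ hc hψ hU]
  refine (intervalIntegral.norm_integral_le_of_norm_le_const (C := M * (3 * M' * K))
    fun Υ hΥ ↦ ?_).trans ?_
  · rw [norm_mul, norm_mul, norm_cis, mul_one, Complex.norm_real]
    refine mul_le_mul (hM Υ) ?_ (norm_nonneg _) m0
    have : ∀ A : ℝ, (ψ A : ℂ) * cis (μ * U A) * airyInt c μ α A * cis (-(μ * (A * Υ))) =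
        (ψ A : ℂ) * cis (μ * U A) * cis (-(μ * (A * Υ))) * airyInt c μ α A := fun A ↦ by ring
    simp only [this]
    rw [integral_mul_airyInt hc
      (g := fun A ↦ (ψ A : ℂ) * cis (μ * U A) * cis (-(μ * (A * Υ)))) (((Complex.continuous_ofReal.comp hψ).mul
      (continuous_cis.comp (continuous_const.mul hU))).mul (continuous_cis.comp (by fun_prop)))]
    refine (intervalIntegral.norm_integral_le_of_norm_le_const (C := M' * K)
      fun S hS ↦ ?_).trans ?_
    · rw [norm_mul, norm_mul, norm_cis, mul_one, Complex.norm_real]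
      refine mul_le_mul (hM' S) ?_ (norm_nonneg _) m1
      refine le_trans (le_of_eq ?_) (hK Υ (hsub Υ hΥ) S (hsub S hS))
      congr 2
      ext A
      rw [mul_assoc, mul_assoc, ← cis_add, ← cis_add]
      congr 2
      ring
    · rw [abs_of_pos (by norm_num)]; linarith
  · rw [abs_of_pos (by norm_num)]; linarith

/-- Phase in `A` of the `N`-th reflected wave, before integrating out `S` and `Υ`. -/
noncomputable def wavePhase (γ T : ℝ) (N : ℤ) (Φ : ℝ → ℝ) (A : ℝ) : ℝ := T * travel γ A - N * Φ A

lemma continuous_wavePhase (γ T : ℝ) (N : ℤ) {Φ : ℝ → ℝ} (hΦ : Continuous Φ) :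
    Continuous (wavePhase γ T N Φ) := by
  unfold wavePhase travel
  fun_prop

theorem transInt_pos_bound {χ c ψ : ℝ → ℝ} (hχ : IsCutoff χ (-(3/2)) (3/2))
    (hc : IsCutoff c (1/8) (3/2)) (hψ : IsCutoff ψ (1/2) (3/2)) :
    ∃ D μ₁ : ℝ, 0 ≤ D ∧ 1 ≤ μ₁ ∧ ∀ (μ γ α X T : ℝ) (N : ℤ) (Φ : ℝ → ℝ), μ₁ ≤ μ → 0 < γ →
      γ ≤ 1/1000 → α ∈ Set.Icc (0 : ℝ) (1/4) → 0 ≤ X → T ≠ 0 → |T| ≤ 1 → |N| ≤ 2 → Continuous Φ →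
      (∀ A ∈ Set.Icc (9/20 : ℝ) 2, HasDerivAt Φ (airySlope (1 / (12 * μ ^ 2)) A) A) →
      ‖transInt χ c ψ (wavePhase γ T N Φ) μ X α‖ ≤ D / μ ∧
      ‖transInt χ c ψ (wavePhase γ T N Φ) μ X α‖ ≤ D / μ / √(μ * |T|) := by
  obtain ⟨κ₁, C, B, hκ₁, hC, hB, hgeo⟩ := slopePhase_good
  obtain ⟨CF, hCF, hS⟩ := S_step hc hψ
  obtain ⟨D, hD, hout⟩ := outer_integral_bound hχ (3/20) B CF (by norm_num) hB hCF
  refine ⟨D * (√10 + √(C + 1)) + D, 1 + 1 / κ₁, by positivity, by simp [hκ₁.le], ?_⟩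
  intro μ γ α X T N Φ hμ hγ hγ' hα hX hT0 hT hN hΦc hΦ
  have hμ1 : 1 ≤ μ := le_trans (by simp [hκ₁.le]) hμ
  have hμ0 : 0 < μ := by linarith
  have hκ : 1 / (12 * μ ^ 2) ∈ Set.Icc 0 κ₁ := by
    refine ⟨by positivity, ?_⟩
    have h1 : 1 / κ₁ ≤ μ := by linarith
    rw [div_le_iff₀ hκ₁] at h1
    rw [div_le_iff₀ (by positivity)]
    nlinarith
  obtain ⟨F, F', F'', hF, hFs, hFe⟩ := hS μ α hμ0 hα
  obtain ⟨s, V, V', V'', hgood, hVB, hphase⟩ :=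
    hgeo _ γ α T N Φ hκ hγ hγ' hα hT hN hΦ
  have hamp : IsAmplitude (CF / √μ) F F' F'' :=
    ⟨fun A hA ↦ (hF A hA).1, fun A hA ↦ (hF A hA).2.1, fun A hA ↦ (hF A hA).2.2.1,
      fun A hA ↦ (hF A hA).2.2.2.1, fun A hA ↦ (hF A hA).2.2.2.2, hFs⟩
  have heq : transInt χ c ψ (wavePhase γ T N Φ) μ X α =
      ∫ Υ in (-(3/2) : ℝ)..(3/2), outerG χ (slopePhase γ α T N Φ) F μ X Υ := by
    rw [transInt_eq_outer hχ.1.continuous hc.1.continuous hψ.1.continuous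
      (continuous_wavePhase γ T N hΦc)]
    congr 1
    ext Υ
    rw [outerG, innerA]
    congr 1
    refine intervalIntegral.integral_congr fun A hA ↦ ?_
    rw [Set.uIcc_of_le (by norm_num)] at hA
    have h1 := hFe A hA
    rw [← hc.intervalIntegral_eq (a' := -(3/2)) (by norm_num) le_rfl
      (fun S ↦ cis (μ * (S ^ 3 / 3 - S * (A - α)))), ← airyInt] at h1
    have h2 : μ * (slopePhase γ α T N Φ A - A * Υ) = μ * wavePhase γ T N Φ A +
        μ * (-(2/3 * ((A - α) * √(A - α)))) + -(μ * (A * Υ)) := by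
      rw [slopePhase, wavePhase]; ring
    simp only [h2, cis_add]
    linear_combination cis (μ * wavePhase γ T N Φ A) * cis (-(μ * (A * Υ))) * h1
  obtain ⟨ho1, ho2⟩ := hout μ X s _ V V' V'' F F' F'' hμ1 hgood hVB hamp
  rw [← heq] at ho1 ho2
  have hTp : 0 < |T| := abs_pos.2 hT0
  refine ⟨ho1.trans ?_, ?_⟩
  · gcongr
    have : 0 ≤ D * (√10 + √(C + 1)) := by positivity
    linarith
  have hsq : 0 < √(μ * |T|) := by positivity
  have hD1 : 0 ≤ D * √10 := by positivity
  have hD2 : 0 ≤ D * √(C + 1) := by positivity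
  by_cases hcase : C * (1 / (12 * μ ^ 2)) ≤ |T|
  · refine (ho2 (|T| / 10) ⟨by positivity, by linarith⟩ (hphase X hX hT0 hcase)).trans ?_
    have : √(μ * (|T| / 10)) = √(μ * |T|) / √10 := by
      rw [← Real.sqrt_div (by positivity)]; congr 1; ring
    rw [this, div_div_eq_mul_div, div_mul_eq_mul_div]
    gcongr
    linarith
  · push Not at hcase
    refine ho1.trans ?_
    rw [le_div_iff₀ hsq, div_mul_eq_mul_div]
    gcongr
    have h3 : √(μ * |T|) ≤ √(C + 1) := by
      apply Real.sqrt_le_sqrt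
      have : μ * |T| ≤ μ * (C * (1 / (12 * μ ^ 2))) := by gcongr
      have h4 : μ * (C * (1 / (12 * μ ^ 2))) = C / (12 * μ) := by field_simp
      have h5 : C / (12 * μ) ≤ C := div_le_self hC (by linarith)
      linarith
    have : D * √(μ * |T|) ≤ D * √(C + 1) := by gcongr
    linarith

lemma IsCutoff.comp_neg {χ : ℝ → ℝ} {a b : ℝ} (hχ : IsCutoff χ a b) :
    IsCutoff (fun x ↦ χ (-x)) (-b) (-a) :=
  ⟨hχ.1.comp (by fun_prop), fun x hx ↦ hχ.2 _ fun h ↦ hx ⟨by linarith [h.2], by linarith [h.1]⟩⟩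

lemma div_sq_le_min {D μ T : ℝ} (hD : 0 ≤ D) (hμ : 1 ≤ μ) (hT0 : T ≠ 0) (hT : |T| ≤ 1) :
    D / μ ^ 2 ≤ D / μ ∧ D / μ ^ 2 ≤ D / μ / √(μ * |T|) := by
  have hTp : 0 < |T| := abs_pos.2 hT0
  have h1 : √(μ * |T|) ≤ μ := by
    rw [Real.sqrt_le_left (by linarith)]
    nlinarith
  have h2 : 0 < √(μ * |T|) := Real.sqrt_pos.2 (by positivity)
  rw [div_div]
  constructor
  · gcongr; nlinarith
  · rw [sq]; gcongr

theorem transInt_bound_of_abs_le_two {χ ψ : ℝ → ℝ} (hχ : IsCutoff χ (-(3/2)) (3/2))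
    (hψ : IsCutoff ψ (1/2) (3/2)) :
    ∃ D μ₁ : ℝ, 0 ≤ D ∧ 1 ≤ μ₁ ∧ ∀ (μ γ α X T : ℝ) (N : ℤ) (Φ : ℝ → ℝ), μ₁ ≤ μ → 0 < γ →
      γ ≤ 1/1000 → α ∈ Set.Icc (0 : ℝ) (1/4) → 0 ≤ X → T ≠ 0 → |T| ≤ 1 → |N| ≤ 2 → Continuous Φ →
      (∀ A ∈ Set.Icc (9/20 : ℝ) 2, HasDerivAt Φ (airySlope (1 / (12 * μ ^ 2)) A) A) →
      ‖transInt χ χ ψ (wavePhase γ T N Φ) μ X α‖ ≤ D / μ ∧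
      ‖transInt χ χ ψ (wavePhase γ T N Φ) μ X α‖ ≤ D / μ / √(μ * |T|) := by
  obtain ⟨c₁, c₂, c₃, h₁, h₂, h₂c, h₃, hsum⟩ := hχ.split
  have hχn : IsCutoff (fun x ↦ χ (-x)) (-(3/2)) (3/2) := by simpa using hχ.comp_neg
  obtain ⟨D₁, μ₁, hD₁, hμ₁, H₁⟩ := transInt_pos_bound hχ h₁ hψ
  obtain ⟨D₂, μ₂, hD₂, hμ₂, H₂⟩ := transInt_pos_bound hχn h₂ hψ
  obtain ⟨D₃, hD₃, H₃⟩ := airyInt_small h₃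
  obtain ⟨M, hM, bM⟩ := hψ.bounded
  obtain ⟨M', hM', bM'⟩ := hχ.bounded
  refine ⟨D₁ + D₂ + 6 * M * M' * D₃, max μ₁ μ₂, by positivity, hμ₁.trans (le_max_left _ _), ?_⟩
  intro μ γ α X T N Φ hμ hγ hγ' hα hX hT0 hT hN hΦc hΦ
  have hμa : μ₁ ≤ μ := (le_max_left _ _).trans hμ
  have hμb : μ₂ ≤ μ := (le_max_right _ _).trans hμ
  have hμ1 : 1 ≤ μ := hμ₁.trans hμa
  have hUc := continuous_wavePhase γ T N hΦc
  have b1 := H₁ μ γ α X T N Φ hμa hγ hγ' hα hX hT0 hT hN hΦc hΦ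
  have b2 := H₂ μ γ α X (-T) (-N) Φ hμb hγ hγ' hα hX (neg_ne_zero.2 hT0) (by rwa [abs_neg])
    (by rwa [abs_neg]) hΦc hΦ
  have e2 : ‖transInt (fun x ↦ χ (-x)) (fun x ↦ c₂ (-x)) ψ (wavePhase γ (-T) (-N) Φ) μ X α‖ =
      ‖transInt χ c₂ ψ (wavePhase γ T N Φ) μ X α‖ := by
    rw [← RCLike.norm_conj (transInt χ c₂ ψ (wavePhase γ T N Φ) μ X α), transInt_conj]
    congr 2
    ext A
    rw [wavePhase, wavePhase]
    push_cast
    ring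
  rw [e2, abs_neg] at b2
  have b3 : ‖transInt χ c₃ ψ (wavePhase γ T N Φ) μ X α‖ ≤ 6 * M * M' * D₃ / μ ^ 2 := by
    rw [mul_div_assoc]
    exact transInt_norm_le bM bM' fun A hA ↦ H₃ μ α A (by linarith) hα.2 hA
  have b3' := div_sq_le_min (by positivity : 0 ≤ 6 * M * M' * D₃) hμ1 hT0 hT
  have e : transInt χ χ ψ (wavePhase γ T N Φ) μ X α =
      transInt χ c₁ ψ (wavePhase γ T N Φ) μ X α + transInt χ c₂ ψ (wavePhase γ T N Φ) μ X α +
      transInt χ c₃ ψ (wavePhase γ T N Φ) μ X α := by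
    have := transInt_add (χ := χ) (c := fun x ↦ c₁ x + c₂ x) (d := c₃) (ψ := ψ)
      (U := wavePhase γ T N Φ) hχ.1.continuous (h₁.1.continuous.add h₂c) h₃.1.continuous
      hψ.1.continuous hUc μ X α
    rw [← hsum] at this
    rw [this, transInt_add hχ.1.continuous h₁.1.continuous h₂c hψ.1.continuous hUc]
  have hn := norm_add₃_le (a := transInt χ c₁ ψ (wavePhase γ T N Φ) μ X α)
    (b := transInt χ c₂ ψ (wavePhase γ T N Φ) μ X α)
    (c := transInt χ c₃ ψ (wavePhase γ T N Φ) μ X α)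
  rw [← e] at hn
  rw [add_div, add_div, add_div, add_div]
  constructor <;> linarith [b1.1, b1.2, b2.1, b2.2, b3'.1, b3'.2]

theorem transInt_bound_of_three_le_abs {χ ψ : ℝ → ℝ} (hχ : IsCutoff χ (-(3/2)) (3/2))
    (hψ : IsCutoff ψ (1/2) (3/2)) :
    ∃ D μ₁ : ℝ, 0 ≤ D ∧ 1 ≤ μ₁ ∧ ∀ (μ γ α X T : ℝ) (N : ℤ) (Φ : ℝ → ℝ), μ₁ ≤ μ → 0 < γ →
      γ ≤ 1/1000 → |T| ≤ 1 → 3 ≤ |N| → Continuous Φ →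
      (∀ A ∈ Set.Icc (9/20 : ℝ) 2, HasDerivAt Φ (airySlope (1 / (12 * μ ^ 2)) A) A) →
      ‖transInt χ χ ψ (wavePhase γ T N Φ) μ X α‖ ≤ D / μ ^ 2 / (1 + (N : ℝ) ^ 2) := by
  obtain ⟨κ₀, C, hκ₀, hC, hb⟩ := airySlope_bounds
  obtain ⟨K, hK, b0, b1, b2⟩ := hψ.bounded₂
  obtain ⟨M, hM, bM⟩ := hχ.bounded
  obtain ⟨C', hC'⟩ : ∃ C', C' = 10 * (1 + C) := ⟨_, rfl⟩
  have hC'0 : 0 ≤ C' := by rw [hC']; positivity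
  refine ⟨9 * M * M * (50 * (K * (1 + 4 * C' + 3 * C' ^ 2))), 1 + 1 / κ₀ + 100 * C, by positivity,
    ?_, ?_⟩
  · have : 0 ≤ 1 / κ₀ + 100 * C := by positivity
    linarith
  intro μ γ α X T N Φ hμ hγ hγ' hT hN hΦc hΦ
  have hik : 0 < 1 / κ₀ := by positivity
  have hμ1 : 1 ≤ μ := by linarith
  have hμ0 : 0 < μ := by linarith
  obtain ⟨κ, hκdef⟩ : ∃ κ, κ = 1 / (12 * μ ^ 2) := ⟨_, rfl⟩
  rw [← hκdef] at hΦ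
  have hκ : κ ∈ Set.Icc 0 κ₀ := by
    rw [hκdef]
    refine ⟨by positivity, ?_⟩
    have h1 : 1 / κ₀ ≤ μ := by linarith
    rw [div_le_iff₀ hκ₀] at h1
    rw [div_le_iff₀ (by positivity)]
    nlinarith
  have hκC : C * κ ≤ 1 / 1000 := by
    rw [hκdef, mul_one_div, div_le_iff₀ (by positivity)]
    nlinarith
  obtain ⟨n, hn⟩ : ∃ n : ℝ, n = |(N : ℝ)| := ⟨_, rfl⟩
  have hn3 : 3 ≤ n := by rw [hn]; exact_mod_cast hN
  have hnsq : (N : ℝ) ^ 2 = n ^ 2 := by rw [hn, sq_abs]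
  have hsub : ∀ x ∈ Set.Icc (1/2 : ℝ) (3/2), x ∈ Set.Icc (9/20 : ℝ) 2 := fun x hx ↦
    ⟨by linarith [hx.1], by linarith [hx.2]⟩
  have hUc := continuous_wavePhase γ T N hΦc
  have hin : ∀ Υ ∈ Set.Icc (-(3/2) : ℝ) (3/2), ∀ S ∈ Set.Icc (-(3/2) : ℝ) (3/2),
      ‖∫ A in (9/20 : ℝ)..2, (ψ A : ℂ) * cis (μ * (wavePhase γ T N Φ A - A * (Υ + S)))‖ ≤
        K * (1 + 4 * C' + 3 * C' ^ 2) * (3/2 - 1/2) / (μ * (n / 5)) ^ 2 := by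
    intro Υ hΥ S hS
    have hw : |Υ + S| ≤ 3 := abs_le.2 ⟨by linarith [hΥ.1, hS.1], by linarith [hΥ.2, hS.2]⟩
    generalize Υ + S = w at hw
    rw [hψ.intervalIntegral_eq (by norm_num) (by norm_num)]
    have hlow : ∀ x ∈ Set.Icc (1/2 : ℝ) (3/2),
        n / 5 ≤ |T * (1 / (2 * √(1 + γ * x))) - N * airySlope κ x - w| := by
      intro x hx
      have hx' := hsub x hx
      have ht := travel_bounds hγ hγ' (by linarith [hx.1] : 0 ≤ x) hx'.2
      have ha := (hb κ hκ x hx').2.2.1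
      have hs : 7/10 ≤ √x := Real.le_sqrt_of_sq_le (by linarith [hx.1])
      have h1 : |T * (1 / (2 * √(1 + γ * x)))| ≤ 1 * (1/2) := by
        rw [abs_mul, abs_of_nonneg (by positivity : 0 ≤ 1 / (2 * √(1 + γ * x)))]
        exact mul_le_mul hT ht.2.1 (by positivity) (by norm_num)
      have h2 : 139/100 * n ≤ |N * airySlope κ x| := by
        rw [abs_mul, ← hn, mul_comm]
        have : 139/100 ≤ |airySlope κ x| := by
          rw [le_abs]; left; linarith [(abs_le.1 ha).1]
        gcongr
      have h3 := abs_sub_abs_le_abs_sub (N * airySlope κ x)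
        (T * (1 / (2 * √(1 + γ * x))) - w)
      have h4 := abs_sub (T * (1 / (2 * √(1 + γ * x)))) w
      have h5 : |T * (1 / (2 * √(1 + γ * x))) - N * airySlope κ x - w| =
          |N * airySlope κ x - (T * (1 / (2 * √(1 + γ * x))) - w)| := by
        rw [← abs_neg]; congr 1; ring
      rw [h5]
      linarith
    refine hψ.norm_integral_le_of_nonstationary (by norm_num)
      (p := fun x ↦ T * (1 / (2 * √(1 + γ * x))) - N * airySlope κ x - w)
      (p' := fun x ↦ T * (-γ / (4 * √(1 + γ * x) ^ 3)) - N * airySlope' κ x)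
      (p'' := fun x ↦ T * (3 * γ ^ 2 / (8 * √(1 + γ * x) ^ 5)) - N * airySlope'' κ x)
      hμ0 (by positivity) hC'0 (hUc.sub (by fun_prop)) ?_ ?_ ?_ hlow ?_ ?_ b0 b1 b2
    · intro x hx
      have ht := hasDerivAt_travel hγ (by linarith [hx.1] : 0 ≤ x)
      refine (((ht.1.const_mul T).sub ((hΦ x (hsub x hx)).const_mul (N : ℝ))).sub
        ((hasDerivAt_id x).mul_const w)).congr_deriv ?_
      ring
    · intro x hx
      have ht := hasDerivAt_travel hγ (by linarith [hx.1] : 0 ≤ x)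
      exact ((ht.2.1.const_mul T).sub ((hb κ hκ x (hsub x hx)).1.const_mul (N : ℝ))).sub_const w
    · intro x hx
      have ht := hasDerivAt_travel hγ (by linarith [hx.1] : 0 ≤ x)
      exact (ht.2.2.const_mul T).sub ((hb κ hκ x (hsub x hx)).2.1.const_mul (N : ℝ))
    · intro x hx
      have hx' := hsub x hx
      have ht := (travel_bounds hγ hγ' (by linarith [hx.1] : 0 ≤ x) hx'.2).2.2.1
      have ha := (hb κ hκ x hx').2.2.2.1
      have hs : 7/10 ≤ √x := Real.le_sqrt_of_sq_le (by linarith [hx.1])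
      have hs' : 1 / √x ≤ 3/2 := by rw [div_le_iff₀ (by positivity)]; linarith
      have hs'' : 0 ≤ 1 / √x := by positivity
      have h1 : |T * (-γ / (4 * √(1 + γ * x) ^ 3))| ≤ 1 * (1/1000) := by
        rw [abs_mul]; exact mul_le_mul hT ht (abs_nonneg _) (by norm_num)
      have ha' := abs_le.1 ha
      have h2 : |N * airySlope' κ x| ≤ n * (8/5) := by
        rw [abs_mul, ← hn]
        gcongr
        rw [abs_le]; constructor <;> linarith
      have h3 := abs_sub (T * (-γ / (4 * √(1 + γ * x) ^ 3))) (N * airySlope' κ x)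
      have h4 := hlow x hx
      have h5 : 10 * (n / 5) ≤ C' * |T * (1 / (2 * √(1 + γ * x))) - N * airySlope κ x - w| := by
        refine mul_le_mul ?_ h4 (by positivity) hC'0
        rw [hC']; linarith
      linarith
    · intro x hx
      have hx' := hsub x hx
      have ht := (travel_bounds hγ hγ' (by linarith [hx.1] : 0 ≤ x) hx'.2).2.2.2
      have ha := (hb κ hκ x hx').2.2.2.2
      have h1 : |T * (3 * γ ^ 2 / (8 * √(1 + γ * x) ^ 5))| ≤ 1 * 1 := by
        rw [abs_mul]; exact mul_le_mul hT ht (abs_nonneg _) (by norm_num)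
      have h2 : |N * airySlope'' κ x| ≤ n * C := by
        rw [abs_mul, ← hn]
        gcongr
      have h3 := abs_sub (T * (3 * γ ^ 2 / (8 * √(1 + γ * x) ^ 5))) (N * airySlope'' κ x)
      have h4 := hlow x hx
      have h5 : C' * (n / 5) ≤ C' * |T * (1 / (2 * √(1 + γ * x))) - N * airySlope κ x - w| :=
        mul_le_mul_of_nonneg_left h4 hC'0
      rw [hC'] at h5 ⊢
      nlinarith
  refine (transInt_norm_le_of_inner hχ.1.continuous hχ.1.continuous hψ.1.continuous hUc bM bM
    hin).trans ?_
  have hKK : 0 ≤ K * (1 + 4 * C' + 3 * C' ^ 2) := by positivity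
  generalize K * (1 + 4 * C' + 3 * C' ^ 2) = Q at hKK
  have h6 : Q * (3/2 - 1/2) / (μ * (n / 5)) ^ 2 ≤ 50 * Q / μ ^ 2 / (1 + (N : ℝ) ^ 2) := by
    rw [hnsq, div_div, div_le_div_iff₀ (by positivity) (by positivity)]
    have h7 : 0 ≤ Q * μ ^ 2 := by positivity
    have h8 : 1 + n ^ 2 ≤ 2 * n ^ 2 := by nlinarith
    linarith [mul_le_mul_of_nonneg_left h8 h7]
  calc 9 * M * M * (Q * (3/2 - 1/2) / (μ * (n / 5)) ^ 2)
      ≤ 9 * M * M * (50 * Q / μ ^ 2 / (1 + (N : ℝ) ^ 2)) := by gcongr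
    _ = _ := by ring

theorem transInt_bound {χ ψ : ℝ → ℝ} (hχ : IsCutoff χ (-(3/2)) (3/2))
    (hψ : IsCutoff ψ (1/2) (3/2)) :
    ∃ D μ₁ : ℝ, 0 ≤ D ∧ 1 ≤ μ₁ ∧ ∀ (μ γ α X T : ℝ) (N : ℤ) (Φ : ℝ → ℝ), μ₁ ≤ μ → 0 < γ →
      γ ≤ 1/1000 → α ∈ Set.Icc (0 : ℝ) (1/4) → 0 ≤ X → T ≠ 0 → |T| ≤ 1 → Continuous Φ →
      (∀ A ∈ Set.Icc (9/20 : ℝ) 2, HasDerivAt Φ (airySlope (1 / (12 * μ ^ 2)) A) A) →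
      ‖transInt χ χ ψ (wavePhase γ T N Φ) μ X α‖ ≤ D / μ / (1 + (N : ℝ) ^ 2) ∧
      ‖transInt χ χ ψ (wavePhase γ T N Φ) μ X α‖ ≤ D / μ / √(μ * |T|) / (1 + (N : ℝ) ^ 2) := by
  obtain ⟨D₁, μ₁, hD₁, hμ₁, H₁⟩ := transInt_bound_of_abs_le_two hχ hψ
  obtain ⟨D₂, μ₂, hD₂, hμ₂, H₂⟩ := transInt_bound_of_three_le_abs hχ hψ
  refine ⟨5 * D₁ + D₂, max μ₁ μ₂, by positivity, hμ₁.trans (le_max_left _ _), ?_⟩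
  intro μ γ α X T N Φ hμ hγ hγ' hα hX hT0 hT hΦc hΦ
  have hμa : μ₁ ≤ μ := (le_max_left _ _).trans hμ
  have hμb : μ₂ ≤ μ := (le_max_right _ _).trans hμ
  have hμ1 : 1 ≤ μ := hμ₁.trans hμa
  have hTp : 0 < |T| := abs_pos.2 hT0
  rcases le_or_gt |N| 2 with hN | hN
  · have hb := H₁ μ γ α X T N Φ hμa hγ hγ' hα hX hT0 hT hN hΦc hΦ
    have hN2 : (N : ℝ) ^ 2 ≤ 4 := by
      have : |(N : ℝ)| ≤ 2 := by exact_mod_cast hN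
      rw [← sq_abs]; nlinarith [abs_nonneg (N : ℝ)]
    have hq : ∀ E : ℝ, 0 ≤ E → D₁ * E ≤ (5 * D₁ + D₂) * E / (1 + (N : ℝ) ^ 2) := by
      intro E hE
      rw [le_div_iff₀ (by positivity)]
      have h1 : 0 ≤ D₁ * E := by positivity
      have h2 : 0 ≤ D₂ * E := by positivity
      nlinarith
    constructor
    · refine hb.1.trans ?_
      simpa only [div_eq_mul_inv, mul_assoc] using hq (μ⁻¹) (by positivity)
    · refine hb.2.trans ?_
      simpa only [div_eq_mul_inv, mul_assoc] using hq (μ⁻¹ * (√(μ * |T|))⁻¹) (by positivity)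
  · have hb := H₂ μ γ α X T N Φ hμb hγ hγ' hT hN hΦc hΦ
    have hm := div_sq_le_min hD₂ hμ1 hT0 hT
    have h5 : D₂ ≤ 5 * D₁ + D₂ := by linarith
    constructor
    · refine hb.trans ?_
      exact div_le_div_of_nonneg_right (hm.1.trans (by gcongr)) (by positivity)
    · refine hb.trans ?_
      exact div_le_div_of_nonneg_right (hm.2.trans (by gcongr)) (by positivity)

lemma integral_prod₄ {f : ℝ × ℝ × ℝ × ℝ → ℂ} (hf : Integrable f) :
    ∫ v, f v = ∫ η, ∫ A, ∫ Υ, ∫ S, f (S, Υ, A, η) := by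
  have h1 : Integrable (fun p : ℝ × ℝ × ℝ ↦ ∫ S, f (S, p)) := hf.integral_prod_right
  have h2 : Integrable (fun q : ℝ × ℝ ↦ ∫ Υ, ∫ S, f (S, Υ, q)) := h1.integral_prod_right
  rw [Measure.volume_eq_prod, integral_prod_symm _ hf, Measure.volume_eq_prod,
    integral_prod_symm _ h1, Measure.volume_eq_prod, integral_prod_symm _ h2]

lemma IsCutoff.integral_eq {c : ℝ → ℝ} {a b : ℝ} (hc : IsCutoff c a b) {a' b' : ℝ}
    (ha : a' ≤ a) (hb : b ≤ b') (f : ℝ → ℂ) :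
    ∫ x, (c x : ℂ) * f x = ∫ x in a'..b', (c x : ℂ) * f x := by
  have hs : Function.support (fun x ↦ (c x : ℂ) * f x) ⊆ Set.Ioo a b := by
    intro x hx
    by_contra hn
    exact hx (by simp [hc.2 x hn])
  rw [intervalIntegral.integral_eq_integral_of_support_subset
    (hs.trans ((Set.Ioo_subset_Ioo ha hb).trans Set.Ioo_subset_Ioc_self))]

lemma continuous_PsiTrans {L : ℝ → ℝ} (hL : Continuous L) (h γ a : ℝ) (N : ℤ) (T X Y : ℝ)
    (hγ : 0 < γ) :
    Continuous fun v : ℝ × ℝ × ℝ × ℝ ↦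
      PsiTrans L h γ a N T X Y v.2.1 v.1 v.2.2.1 v.2.2.2 := by
  have h32 : Continuous fun x : ℝ ↦ x ^ ((3:ℝ)/2) := Real.continuous_rpow_const (by norm_num)
  have h23 : Continuous fun x : ℝ ↦ x ^ ((2:ℝ)/3) := Real.continuous_rpow_const (by norm_num)
  have hA : Continuous fun v : ℝ × ℝ × ℝ × ℝ ↦ v.2.2.1 ^ ((3:ℝ)/2) :=
    h32.comp (by fun_prop)
  have hB : Continuous fun v : ℝ × ℝ × ℝ × ℝ ↦
      v.2.2.2 * (γ ^ ((3:ℝ)/2) / h) * v.2.2.1 ^ ((3:ℝ)/2) :=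
    Continuous.mul (by fun_prop) hA
  have hq : Continuous fun v : ℝ × ℝ × ℝ × ℝ ↦
      T * (v.2.2.1 - 1) / (√(1 + γ * v.2.2.1) + √(1 + γ)) := by
    refine Continuous.div (by fun_prop) (by fun_prop) fun v ↦ ?_
    have := Real.sqrt_pos.2 (by linarith : 0 < 1 + γ)
    positivity
  unfold PsiTrans Bfun
  refine Continuous.add (Continuous.mul (by fun_prop) ?_) (continuous_const.mul ?_)
  · exact ((by fun_prop : Continuous fun v : ℝ × ℝ × ℝ × ℝ ↦
      Y + v.2.1 ^ 3 / 3 + v.2.1 * (X - v.2.2.1) + v.1 ^ 3 / 3 + v.1 * (a / γ - v.2.2.1)).add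
      hq).sub (continuous_const.mul hA)
  · exact ((continuous_const.mul hB).add continuous_const).sub (hL.comp (h23.comp hB))

lemma mul_PsiTrans {L : ℝ → ℝ} {h γ a T X Y Υ S A η : ℝ} (N : ℤ) (hh : 0 < h) (hγ : 0 < γ)
    (hη : 0 < η) (hA : 0 ≤ A) {lam μ : ℝ} (hlam : lam = γ ^ ((3:ℝ)/2) / h) (hμ : μ = lam * η) :
    lam * PsiTrans L h γ a N T X Y Υ S A η =
      (μ * Y + N * (π / 2)) + μ * wavePhase γ T N (fun A ↦ L (μ ^ (2/3 : ℝ) * A) / μ) A +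
      μ * (Υ ^ 3 / 3 - Υ * (A - X)) + μ * (S ^ 3 / 3 - S * (A - a / γ)) := by
  have hlam0 : 0 < lam := by rw [hlam]; positivity
  have hμ0 : 0 < μ := by rw [hμ]; positivity
  have h1 : (μ * A ^ ((3:ℝ)/2)) ^ ((2:ℝ)/3) = μ ^ (2/3 : ℝ) * A := by
    rw [Real.mul_rpow hμ0.le (by positivity), ← Real.rpow_mul hA]
    norm_num
  rw [PsiTrans, Bfun, ← hlam, wavePhase, mul_div_assoc T, travel_eq hγ hA,
    (by rw [hμ]; ring : η * lam = μ), h1]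
  generalize L (μ ^ (2/3 : ℝ) * A) = ℓ
  generalize A ^ ((3:ℝ)/2) = q
  have h2 : lam * (N / lam * (4/3 * (μ * q) + π / 2 - ℓ)) = N * (4/3 * (μ * q) + π / 2 - ℓ) := by
    field_simp
  have h3 : μ * (ℓ / μ) = ℓ := by field_simp
  rw [mul_add lam, h2, ← mul_assoc lam η, ← hμ]
  linear_combination (N : ℝ) * h3

lemma Wtrans_eq {L ψ χ ψ₂ : ℝ → ℝ} (hL : Continuous L) (hψ : IsCutoff ψ (1/2) (3/2))
    (hχ : IsCutoff χ (-(3/2)) (3/2)) (hψ₂ : IsCutoff ψ₂ (1/2) (3/2)) {h γ : ℝ} (a : ℝ) (N : ℤ)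
    (T X Y : ℝ) (hh : 0 < h) (hγ : 0 < γ) {lam : ℝ} (hlam : lam = γ ^ ((3:ℝ)/2) / h) :
    Wtrans L ψ χ ψ₂ h γ a N T X Y = ((γ ^ 2 / (2 * π * h) ^ 3 : ℝ) : ℂ) *
      ∫ η in (1/2 : ℝ)..(3/2), (ψ η : ℂ) * ((η ^ 2 : ℝ) * cis (lam * η * Y + N * (π / 2)) *
        transInt χ χ ψ₂ (wavePhase γ T N fun A ↦ L ((lam * η) ^ (2/3 : ℝ) * A) / (lam * η))
          (lam * η) X (a / γ)) := by
  have hInt : Integrable fun v : ℝ × ℝ × ℝ × ℝ ↦ Complex.exp (Complex.I *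
      (((γ ^ ((3:ℝ)/2) / h) * PsiTrans L h γ a N T X Y v.2.1 v.1 v.2.2.1 v.2.2.2 : ℝ) : ℂ)) *
      ((v.2.2.2 ^ 2 * ψ v.2.2.2 * χ v.1 * χ v.2.1 * ψ₂ v.2.2.1 : ℝ) : ℂ) := by
    have hψc := hψ.1.continuous
    have hχc := hχ.1.continuous
    have hψ₂c := hψ₂.1.continuous
    apply Continuous.integrable_of_hasCompactSupport
    · exact (continuous_cis.comp (continuous_const.mul (continuous_PsiTrans hL h γ a N T X Y hγ))).mul
        (Complex.continuous_ofReal.comp (by fun_prop))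
    · refine HasCompactSupport.intro (K := Set.Icc (-(3/2)) (3/2) ×ˢ Set.Icc (-(3/2)) (3/2) ×ˢ
        Set.Icc (1/2) (3/2) ×ˢ Set.Icc (1/2) (3/2)) (by
          exact isCompact_Icc.prod (isCompact_Icc.prod (isCompact_Icc.prod isCompact_Icc))) ?_
      intro v hv
      have key : ψ v.2.2.2 = 0 ∨ χ v.1 = 0 ∨ χ v.2.1 = 0 ∨ ψ₂ v.2.2.1 = 0 := by
        by_contra! hn
        obtain ⟨n1, n2, n3, n4⟩ := hn
        refine hv ⟨?_, ?_, ?_, ?_⟩ <;> refine Set.Ioo_subset_Icc_self ?_ <;> by_contra hc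
        · exact n2 (hχ.2 _ hc)
        · exact n3 (hχ.2 _ hc)
        · exact n4 (hψ₂.2 _ hc)
        · exact n1 (hψ.2 _ hc)
      rcases key with k | k | k | k <;> simp [k]
  rw [Wtrans, integral_prod₄ hInt, ← hψ.integral_eq le_rfl le_rfl]
  congr 2
  ext η
  by_cases hη : η ∈ Set.Ioo (1/2 : ℝ) (3/2)
  swap
  · simp [hψ.2 η hη]
  have hη0 : 0 < η := by linarith [hη.1]
  obtain ⟨μ, hμ⟩ : ∃ μ, μ = lam * η := ⟨_, rfl⟩
  obtain ⟨U, hU⟩ : ∃ U, U = wavePhase γ T N fun A ↦ L (μ ^ (2/3 : ℝ) * A) / μ := ⟨_, rfl⟩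
  obtain ⟨k, hk⟩ : ∃ k : ℂ, k = (ψ η : ℂ) * ((η ^ 2 : ℝ) * cis (μ * Y + N * (π / 2))) := ⟨_, rfl⟩
  rw [← hμ, ← hU, transInt]
  have hA : ∀ A, (∫ Υ, ∫ S, Complex.exp (Complex.I *
      (((γ ^ ((3:ℝ)/2) / h) * PsiTrans L h γ a N T X Y Υ S A η : ℝ) : ℂ)) *
      ((η ^ 2 * ψ η * χ S * χ Υ * ψ₂ A : ℝ) : ℂ)) =
      (ψ₂ A : ℂ) * (k * cis (μ * U A) * (airyInt χ μ X A * airyInt χ μ (a / γ) A)) := by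
    intro A
    by_cases hAm : A ∈ Set.Ioo (1/2 : ℝ) (3/2)
    swap
    · simp [hψ₂.2 A hAm]
    have hA0 : 0 ≤ A := by linarith [hAm.1]
    have hS : ∀ Υ S, Complex.exp (Complex.I *
        (((γ ^ ((3:ℝ)/2) / h) * PsiTrans L h γ a N T X Y Υ S A η : ℝ) : ℂ)) *
        ((η ^ 2 * ψ η * χ S * χ Υ * ψ₂ A : ℝ) : ℂ) =
        ((ψ₂ A : ℂ) * (k * cis (μ * U A))) * (((χ Υ : ℂ) * cis (μ * (Υ ^ 3 / 3 - Υ * (A - X)))) *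
          ((χ S : ℂ) * cis (μ * (S ^ 3 / 3 - S * (A - a / γ))))) := by
      intro Υ S
      rw [← hlam, mul_PsiTrans N hh hγ hη0 hA0 hlam hμ, ← hU, ← cis, cis_add, cis_add, cis_add, hk]
      push_cast
      ring
    simp only [hS, integral_const_mul, integral_mul_const]
    rw [airyInt, airyInt, hχ.integral_eq le_rfl le_rfl, hχ.integral_eq le_rfl le_rfl]
    ring
  simp only [hA]
  rw [hψ₂.integral_eq (a' := 9/20) (b' := 2) (by norm_num) (by norm_num), ← mul_assoc, ← hk,
    ← intervalIntegral.integral_const_mul]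
  congr 1
  ext A
  ring

lemma IsCutoff.of_tsupport_subset_Icc {c : ℝ → ℝ} {a b : ℝ} (hc : ContDiff ℝ (⊤ : ℕ∞) c)
    (hs : tsupport c ⊆ Set.Icc a b) : IsCutoff c a b :=
  .of_lt hc
    (fun _ hx ↦ image_eq_zero_of_notMem_tsupport fun h ↦ absurd (hs h).1 (not_le.2 hx))
    (fun _ hx ↦ image_eq_zero_of_notMem_tsupport fun h ↦ absurd (hs h).2 (not_le.2 hx))

lemma rpow_three_halves {x : ℝ} (hx : 0 ≤ x) : x ^ ((3:ℝ)/2) = x * √x := by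
  rw [show ((3:ℝ)/2) = 1 + 1/2 by norm_num, Real.rpow_add_of_nonneg hx (by norm_num) (by norm_num),
    Real.rpow_one, ← Real.sqrt_eq_rpow]

theorem Wtrans_bound {L ψ χ ψ₂ : ℝ → ℝ} (hL : Continuous L)
    (hL' : ∀ μ > 0, ∀ A ≥ 0,
      HasDerivAt (fun A => L (μ ^ (2/3 : ℝ) * A) / μ) (airySlope (1 / (12 * μ ^ 2)) A) A)
    (hψ : IsCutoff ψ (1/2) (3/2)) (hχ : IsCutoff χ (-(3/2)) (3/2))
    (hψ₂ : IsCutoff ψ₂ (1/2) (3/2)) :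
    ∃ C Λ : ℝ, 0 ≤ C ∧ 1 ≤ Λ ∧ ∀ (h γ a T X Y : ℝ) (N : ℤ), 0 < h → 0 < γ → γ ≤ 1/1000 →
      Λ ≤ γ ^ ((3:ℝ)/2) / h → 0 < a → a < γ / 4 → 0 ≤ X → 0 < |T| → |T| ≤ 1 →
      ‖Wtrans L ψ χ ψ₂ h γ a N T X Y‖ ≤ C * (√γ / h ^ 2) *
        min 1 ((h / (γ * (√γ * |T|))) ^ ((1:ℝ)/2)) * (1 / (1 + (N : ℝ) ^ 2)) := by
  obtain ⟨D, μ₁, hD, hμ₁, H⟩ := transInt_bound hχ hψ₂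
  obtain ⟨M, hM, bM⟩ := hψ.bounded
  refine ⟨9 * M * D, 2 * μ₁, by positivity, by linarith, ?_⟩
  intro h γ a T X Y N hh hγ hγ' hΛ ha ha' hX hT0 hT
  obtain ⟨lam, hlam⟩ : ∃ lam, lam = γ ^ ((3:ℝ)/2) / h := ⟨_, rfl⟩
  rw [← hlam] at hΛ
  have hlam0 : 0 < lam := by linarith
  have hlam' : lam = γ * √γ / h := by rw [hlam, rpow_three_halves hγ.le]
  have hsq : 0 < √γ := Real.sqrt_pos.2 hγ
  have hmin : (h / (γ * (√γ * |T|))) ^ ((1:ℝ)/2) = 1 / √(lam * |T|) := by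
    rw [← Real.sqrt_eq_rpow, one_div, ← Real.sqrt_inv, hlam']
    congr 1
    field_simp
  have hN : 0 < 1 + (N : ℝ) ^ 2 := by positivity
  obtain ⟨m, hm⟩ : ∃ m, m = min 1 (1 / √(lam * |T|)) := ⟨_, rfl⟩
  have hinner : ∀ η ∈ Set.Icc (1/2 : ℝ) (3/2),
      ‖transInt χ χ ψ₂ (wavePhase γ T N fun A ↦ L ((lam * η) ^ (2/3 : ℝ) * A) / (lam * η))
          (lam * η) X (a / γ)‖ ≤ 4 * D / lam * m * (1 / (1 + (N : ℝ) ^ 2)) := by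
    intro η hη
    have hμ : lam / 2 ≤ lam * η := by nlinarith [hη.1]
    have hμ0 : 0 < lam * η := by linarith
    have hcont : Continuous fun A ↦ L ((lam * η) ^ (2/3 : ℝ) * A) / (lam * η) := by fun_prop
    obtain ⟨e1, e2⟩ := H (lam * η) γ (a / γ) X T N
      (fun A ↦ L ((lam * η) ^ (2/3 : ℝ) * A) / (lam * η)) (by linarith) hγ hγ'
      ⟨by positivity, by rw [div_le_iff₀ hγ]; linarith⟩ hX (abs_pos.1 hT0) hT hcont
      (fun A hA ↦ hL' _ hμ0 A (by linarith [hA.1]))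
    have hDμ : D / (lam * η) ≤ 2 * D / lam := by
      rw [show 2 * D / lam = D / (lam / 2) by field_simp]
      gcongr
    have hs : √(lam * |T|) / 2 ≤ √(lam * η * |T|) := by
      apply Real.le_sqrt_of_sq_le
      rw [div_pow, Real.sq_sqrt (by positivity)]
      nlinarith
    have hs0 : 0 < √(lam * |T|) := Real.sqrt_pos.2 (by positivity)
    rw [mul_one_div]
    rw [le_div_iff₀ hN] at *
    rw [hm, mul_min_of_nonneg _ _ (by positivity)]
    refine le_min (e1.trans ?_) (e2.trans ?_)
    · rw [mul_one]
      refine hDμ.trans ?_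
      gcongr
      norm_num
    · calc D / (lam * η) / √(lam * η * |T|) ≤ (2 * D / lam) / (√(lam * |T|) / 2) := by gcongr
        _ = 4 * D / lam * (1 / √(lam * |T|)) := by field_simp; ring
  obtain ⟨B, hB⟩ : ∃ B, B = 4 * D / lam * m * (1 / (1 + (N : ℝ) ^ 2)) := ⟨_, rfl⟩
  rw [← hB] at hinner
  have hm0 : 0 ≤ m := by rw [hm]; positivity
  have hB0 : 0 ≤ B := by rw [hB]; positivity
  rw [Wtrans_eq hL hψ hχ hψ₂ a N T X Y hh hγ hlam, norm_mul, Complex.norm_real, Real.norm_eq_abs,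
    abs_of_nonneg (by positivity), hmin, ← hm]
  have hI := intervalIntegral.norm_integral_le_of_norm_le_const (a := (1/2 : ℝ)) (b := 3/2)
    (C := M * (9/4 * B)) (f := fun η ↦ (ψ η : ℂ) * ((η ^ 2 : ℝ) *
        cis (lam * η * Y + N * (π / 2)) *
        transInt χ χ ψ₂ (wavePhase γ T N fun A ↦ L ((lam * η) ^ (2/3 : ℝ) * A) / (lam * η))
          (lam * η) X (a / γ))) (by
      intro η hη
      rw [Set.uIoc_of_le (by norm_num)] at hη
      rw [norm_mul, norm_mul, norm_mul, norm_cis, mul_one, Complex.norm_real, Complex.norm_real]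
      have h1 : ‖η ^ 2‖ ≤ 9/4 := by
        rw [Real.norm_eq_abs, abs_of_nonneg (by positivity)]
        nlinarith [hη.1, hη.2]
      gcongr
      · exact bM η
      · exact hinner η ⟨hη.1.le, hη.2⟩)
  rw [show |(3/2 : ℝ) - 1/2| = 1 by norm_num, mul_one] at hI
  have hpre : γ ^ 2 / (2 * π * h) ^ 3 / lam ≤ √γ / h ^ 2 := by
    have hpi : (1 : ℝ) ≤ (2 * π) ^ 3 := one_le_pow₀ (by linarith [Real.pi_gt_three])
    have hγs : γ = √γ * √γ := (Real.mul_self_sqrt hγ.le).symm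
    calc γ ^ 2 / (2 * π * h) ^ 3 / lam = √γ / h ^ 2 / (2 * π) ^ 3 := by
          rw [hlam']
          generalize √γ = s at *
          subst hγs
          field_simp
      _ ≤ √γ / h ^ 2 := div_le_self (by positivity) hpi
  calc _ ≤ γ ^ 2 / (2 * π * h) ^ 3 * (M * (9/4 * B)) := by gcongr
    _ = 9 * M * D * (γ ^ 2 / (2 * π * h) ^ 3 / lam) * m * (1 / (1 + (N : ℝ) ^ 2)) := by
      rw [hB]; ring
    _ ≤ _ := by gcongr

lemma summable_one_div_one_add_int_sq : Summable fun N : ℤ ↦ 1 / (1 + (N : ℝ) ^ 2) := by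
  refine Summable.of_norm_bounded_eventually
    (Real.summable_one_div_int_pow (p := 2) |>.2 one_lt_two) ?_
  filter_upwards [(Set.finite_singleton (0 : ℤ)).compl_mem_cofinite] with N hN
  have : (N : ℝ) ≠ 0 := by simpa using hN
  rw [Real.norm_eq_abs, abs_of_nonneg (by positivity)]
  gcongr
  linarith

lemma exists_le_rpow_div {ε Λ : ℝ} (hε : 0 < ε) (hε' : ε < 1/10) (hΛ : 1 ≤ Λ) :
    ∃ h₀ ∈ Set.Ioo (0:ℝ) 1, ∀ h γ : ℝ, 0 < h → h ≤ h₀ → h ^ ((2:ℝ)/3 - ε) ≤ γ →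
      Λ ≤ γ ^ ((3:ℝ)/2) / h := by
  have hΛ0 : 0 < Λ := by linarith
  refine ⟨min (1/2) (Λ ^ (-(2 / (3 * ε)))), ⟨by positivity, by
    exact (min_le_left _ _).trans_lt (by norm_num)⟩, fun h γ hh hh0 hγ ↦ ?_⟩
  have h1 : h ≤ Λ ^ (-(2 / (3 * ε))) := hh0.trans (min_le_right _ _)
  calc Λ = (Λ ^ (-(2 / (3 * ε)))) ^ (-(3/2 * ε)) := by
        rw [← Real.rpow_mul hΛ0.le, show -(2 / (3 * ε)) * -(3/2 * ε) = 1 by field_simp,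
          Real.rpow_one]
    _ ≤ h ^ (-(3/2 * ε)) := Real.rpow_le_rpow_of_nonpos hh h1 (by linarith)
    _ = (h ^ ((2:ℝ)/3 - ε)) ^ ((3:ℝ)/2) / h := by
        rw [← Real.rpow_mul hh.le, eq_div_iff hh.ne', ← Real.rpow_add_one hh.ne']
        congr 1; ring
    _ ≤ γ ^ ((3:ℝ)/2) / h := by gcongr

/-- dispersive bound for the transverse wave `W_{0,γ}` and for `G^♭`
for `|T| ≤ 1`, with `t = √γ T`. -/
theorem dispersion_transverse_smallT
    (Ai : ℂ → ℂ)
    (hAi_diff : Differentiable ℂ Ai)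
    (hAi_diff' : Differentiable ℂ (deriv Ai))
    (hAi_ode : ∀ z : ℂ, deriv (deriv Ai) z = z * Ai z)
    (hAi_zero : Ai 0 = (3 : ℂ) ^ (-(2 : ℂ)/3) / Complex.Gamma (2/3))
    (hAi_zero' : deriv Ai 0 = -((3 : ℂ) ^ (-(1 : ℂ)/3)) / Complex.Gamma (1/3))
    (hAi_real : ∀ x : ℝ, (Ai x).im = 0)
    (L : ℝ → ℝ)
    (hL_cont : Continuous L)
    (hL_zero : L 0 = Real.pi / 3)
    (hAp_ne : ∀ w : ℝ, Aplus Ai w ≠ 0)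
    (hL_char : ∀ w : ℝ, Complex.exp (-(L w : ℂ) * Complex.I) = -(Aminus Ai w) / (Aplus Ai w))
    (ψ : ℝ → ℝ) (hψ : ContDiff ℝ (⊤ : ℕ∞) ψ) (hψs : tsupport ψ ⊆ Set.Icc (1/2 : ℝ) (3/2))
    (ψ₂ : ℝ → ℝ) (hψ₂ : ContDiff ℝ (⊤ : ℕ∞) ψ₂) (hψ₂s : tsupport ψ₂ ⊆ Set.Icc (1/2 : ℝ) (3/2))
    (χ₂ : ℝ → ℝ) (hχ₂ : ContDiff ℝ (⊤ : ℕ∞) χ₂)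
    (hχ₂s : tsupport χ₂ ⊆ Set.Ioo (-(3/2) : ℝ) (3/2))
    (ε : ℝ) (hε : ε ∈ Set.Ioo (0:ℝ) (1/10)) :
    ∃ γ₀ ∈ Set.Ioo (0:ℝ) 1, ∃ h₀ ∈ Set.Ioo (0:ℝ) 1, ∃ C : ℝ,
      ∀ h γ a : ℝ, 0 < h → h ≤ h₀ → h ^ ((2:ℝ)/3 - ε) ≤ γ → γ ≤ γ₀ →
      0 < a → a < γ / 4 →
      ∀ X : ℝ, 0 ≤ X → ∀ Y T : ℝ, 0 < |T| → |T| ≤ 1 →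
        ‖Wtrans L ψ χ₂ ψ₂ h γ a 0 T X Y‖ + ‖Gflat L ψ χ₂ ψ₂ h γ a T X Y‖
          ≤ C * (Real.sqrt γ / h ^ 2) *
            min 1 ((h / (γ * (Real.sqrt γ * |T|))) ^ ((1:ℝ)/2)) := by
  obtain ⟨C, Λ, hC, hΛ, H⟩ := Wtrans_bound hL_cont
    (fun μ hμ A hA ↦ hasDerivAt_airyPhase hAi_diff hAi_diff' hAi_ode hAi_zero hAi_zero' hAp_ne
      hL_cont hL_char hμ hA)
    (.of_tsupport_subset_Icc hψ hψs) (.of_tsupport_subset_Icc hχ₂ (hχ₂s.trans Set.Ioo_subset_Icc_self))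
    (.of_tsupport_subset_Icc hψ₂ hψ₂s)
  obtain ⟨h₀, hh₀, H₀⟩ := exists_le_rpow_div hε.1 hε.2 hΛ
  obtain ⟨σ, hσ⟩ := summable_one_div_one_add_int_sq
  refine ⟨1/1000, by norm_num, h₀, hh₀, C * (1 + σ), ?_⟩
  intro h γ a hh hh' hγ hγ' ha ha' X hX Y T hT hT'
  have hγ0 : 0 < γ := (Real.rpow_pos_of_pos hh _).trans_le hγ
  have hN := fun N : ℤ ↦ H h γ a T X Y N hh hγ0 hγ' (H₀ h γ hh hh' hγ) ha ha' hX hT hT'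
  set K := C * (√γ / h ^ 2) * min 1 ((h / (γ * (√γ * |T|))) ^ ((1:ℝ)/2)) with hK
  have h0 : ‖Wtrans L ψ χ₂ ψ₂ h γ a 0 T X Y‖ ≤ K := by simpa using hN 0
  have h1 : ‖Gflat L ψ χ₂ ψ₂ h γ a T X Y‖ ≤ K * σ :=
    tsum_of_norm_bounded (hσ.mul_left K) fun N ↦ (norm_indicator_le_norm_self _ _).trans (hN N)
  calc _ ≤ K + K * σ := add_le_add h0 h1
    _ = _ := by rw [hK]; ring
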